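/- Let Ω be a bounded open set in ℝ^d with d ≥ 2, T > 0, ε > 0, and set q₀ = 2d/(d+1), p₀ = 2d/(d−1). Let g : Ω_T × ℝ^{d+1} → ℝ^d be measurable, 1-periodic in (y,τ), with ‖g‖_{L^∞(Ω_T;L²)} := ess sup_{(x,t)∈Ω_T} (∫₀¹∫_{[0,1]^d} |g(x,t;y,τ)|² dy dτ)^{1/2} < ∞. Let f have weak derivatives with ∂_t f ∈ L²(0,T;L^{q₀}(Ω)) and ∇f ∈ L²(0,T;Ẇ^{1,q₀}(Ω)), and let h ∈ L²(0,T;L^{p₀}(Ω)) with supp(h) ⊂ Ω_T ∖ Ω_T^{2,ε}. Then | ∬_{Ω_T} (∇f − S_ε(∇f)) · [S_ε(g·h)]^ε dx dt | ≤ C ε { ‖∇²f‖_{L^{2,q₀}(Ω_T)} + ‖∂_t f‖_{L^{2,q₀}(Ω_T)} } · ‖g‖_{L^∞(Ω_T;L²)} · ‖h‖_{L^{2,p₀}(Ω_T)}, where C depends only on d. -/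

import Mathlib

open MeasureTheory ENNReal Set

noncomputable section

abbrev Esp (d : ℕ) : Type := EuclideanSpace ℝ (Fin d)

/-- `L^p` "norm" (in `ℝ≥0∞`) of an `ℝ≥0∞`-valued function, essential-sup for `p = ∞`. -/
def eLp {α : Type*} [MeasurableSpace α] (p : ℝ≥0∞) (μ : Measure α) (f : α → ℝ≥0∞) : ℝ≥0∞ :=
  if p = ∞ then essSup f μ else (∫⁻ x, f x ^ p.toReal ∂μ) ^ (1 / p.toReal)

/-- Unit periodicity cell `[0,1]^d`. -/
def unitCell (d : ℕ) : Set (Esp d) := {y | ∀ i, y i ∈ Icc (0:ℝ) 1}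

/-- `L^{s,r}` norm over the unit periodicity cell (`τ` outer, `y` inner);
`s = r = ∞` gives the essential supremum over the cell. -/
def cellNorm {d : ℕ} (s r : ℝ≥0∞) (g : Esp d → ℝ → ℝ) : ℝ≥0∞ :=
  eLp s (volume.restrict (Ioc (0:ℝ) 1)) fun τ =>
    eLp r (volume.restrict (unitCell d)) fun y => (‖g y τ‖₊ : ℝ≥0∞)

/-- Mixed `L^{q,p}` norm (`t` outer, `x` inner) over a space-time region `A`. -/
def mixNorm {d : ℕ} (q p : ℝ≥0∞) (A : Set (Esp d × ℝ)) (F : Esp d → ℝ → ℝ≥0∞) : ℝ≥0∞ :=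
  eLp q volume fun t => eLp p (volume.restrict {x | (x, t) ∈ A}) fun x => F x t

/-- 1-periodicity in the microscopic variables `(y,τ)`. -/
def Per4 {d : ℕ} (g : Esp d → ℝ → Esp d → ℝ → ℝ) : Prop :=
  ∀ x t y τ, (∀ i, g x t (y + EuclideanSpace.single i 1) τ = g x t y τ) ∧
    g x t y (τ + 1) = g x t y τ

def Meas4 {d : ℕ} (g : Esp d → ℝ → Esp d → ℝ → ℝ) : Prop :=
  Measurable fun w : (Esp d × ℝ) × Esp d × ℝ => g w.1.1 w.1.2 w.2.1 w.2.2

/-- Time smoothing `S^t_ε` of a four-variable function. -/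
def St4 {d : ℕ} (φ₁ : ℝ → ℝ) (ε : ℝ) (g : Esp d → ℝ → Esp d → ℝ → ℝ) :
    Esp d → ℝ → Esp d → ℝ → ℝ :=
  fun x t y τ => ∫ s : ℝ, g x (t - s) y τ * ((ε ^ 2)⁻¹ * φ₁ (s / ε ^ 2))

/-- Space smoothing `S^x_ε` of a four-variable function. -/
def Sx4 {d : ℕ} (φ₂ : Esp d → ℝ) (ε : ℝ) (g : Esp d → ℝ → Esp d → ℝ → ℝ) :
    Esp d → ℝ → Esp d → ℝ → ℝ :=
  fun x t y τ => ∫ z : Esp d, g (x - z) t y τ * ((ε ^ d)⁻¹ * φ₂ (ε⁻¹ • z))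

/-- `S_ε = S^t_ε ∘ S^x_ε`. -/
def S4 {d : ℕ} (φ₁ : ℝ → ℝ) (φ₂ : Esp d → ℝ) (ε : ℝ) (g : Esp d → ℝ → Esp d → ℝ → ℝ) :
    Esp d → ℝ → Esp d → ℝ → ℝ :=
  St4 φ₁ ε (Sx4 φ₂ ε g)

/-- `g^ε(x,t) := g(x,t; x/ε, t/ε²)`. -/
def osc4 {d : ℕ} (ε : ℝ) (g : Esp d → ℝ → Esp d → ℝ → ℝ) : Esp d → ℝ → ℝ :=
  fun x t => g x t (ε⁻¹ • x) (t / ε ^ 2)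

/-- Smooth nonnegative normalized kernel supported in `(-1/2,1/2)`. -/
def GoodK1 (φ₁ : ℝ → ℝ) : Prop :=
  ContDiff ℝ (⊤ : ℕ∞) φ₁ ∧ HasCompactSupport φ₁ ∧ tsupport φ₁ ⊆ Ioo (-(1/2) : ℝ) (1/2) ∧
    (∀ s, 0 ≤ φ₁ s) ∧ (∫ s : ℝ, φ₁ s) = 1

/-- Smooth nonnegative normalized kernel supported in the ball `B(0,1/2) ⊆ ℝ^d`. -/
def GoodK2 {d : ℕ} (φ₂ : Esp d → ℝ) : Prop :=
  ContDiff ℝ (⊤ : ℕ∞) φ₂ ∧ HasCompactSupport φ₂ ∧ tsupport φ₂ ⊆ Metric.ball (0 : Esp d) (1/2) ∧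
    (∀ z, 0 ≤ φ₂ z) ∧ (∫ z : Esp d, φ₂ z) = 1

/-- `Ω_T = Ω × (0,T)`. -/
def timeSpace {d : ℕ} (Ω : Set (Esp d)) (T : ℝ) : Set (Esp d × ℝ) := Ω ×ˢ Ioo 0 T

/-- The boundary layer `Ω_T^{k,ε}`. -/
def blayer {d : ℕ} (Ω : Set (Esp d)) (T k ε : ℝ) : Set (Esp d × ℝ) :=
  ({x ∈ Ω | Metric.infDist x Ωᶜ < k * ε} ×ˢ Ioo 0 T) ∪ (Ω ×ˢ Ioo 0 (k * ε ^ 2)) ∪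
    (Ω ×ˢ Ioo (T - k * ε ^ 2) T)

/-- Time smoothing `S^t_ε` for functions of `(x,t)`. -/
def St2 {d : ℕ} (φ₁ : ℝ → ℝ) (ε : ℝ) (f : Esp d → ℝ → ℝ) : Esp d → ℝ → ℝ :=
  fun x t => ∫ s : ℝ, f x (t - s) * ((ε ^ 2)⁻¹ * φ₁ (s / ε ^ 2))

/-- Space smoothing `S^x_ε` for functions of `(x,t)`. -/
def Sx2 {d : ℕ} (φ₂ : Esp d → ℝ) (ε : ℝ) (f : Esp d → ℝ → ℝ) : Esp d → ℝ → ℝ :=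
  fun x t => ∫ z : Esp d, f (x - z) t * ((ε ^ d)⁻¹ * φ₂ (ε⁻¹ • z))

/-- `S_ε = S^t_ε ∘ S^x_ε` for functions of `(x,t)`. -/
def S2 {d : ℕ} (φ₁ : ℝ → ℝ) (φ₂ : Esp d → ℝ) (ε : ℝ) (f : Esp d → ℝ → ℝ) : Esp d → ℝ → ℝ :=
  St2 φ₁ ε (Sx2 φ₂ ε f)

/-- Weak (distributional) derivative in space-time, in direction `dir`, on a region `U`. -/
def IsWeakDerivST {d : ℕ} (U : Set (Esp d × ℝ)) (u v : Esp d → ℝ → ℝ) (dir : Esp d × ℝ) :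
    Prop :=
  ∀ φ : Esp d × ℝ → ℝ, ContDiff ℝ (⊤ : ℕ∞) φ → HasCompactSupport φ → tsupport φ ⊆ U →
    ∫ w in U, u w.1 w.2 * fderiv ℝ φ w dir = - ∫ w in U, v w.1 w.2 * φ w

def q0E (d : ℕ) : ℝ≥0∞ := ENNReal.ofReal (2 * (d:ℝ) / ((d:ℝ) + 1))
def p0E (d : ℕ) : ℝ≥0∞ := ENNReal.ofReal (2 * (d:ℝ) / ((d:ℝ) - 1))
def q0star (d : ℕ) : ℝ≥0∞ :=
  ENNReal.ofReal ((d:ℝ) * (2 * (d:ℝ) / ((d:ℝ) + 1)) / ((d:ℝ) - 2 * (d:ℝ) / ((d:ℝ) + 1)))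

theorem lintegral_rpow_le_measure_mul {α : Type*} [MeasurableSpace α] {μ : Measure α} {p : ℝ}
    (hp : 1 ≤ p) {f : α → ℝ≥0∞} (hf : AEMeasurable f μ) :
    (∫⁻ a, f a ∂μ) ^ p ≤ μ univ ^ (p - 1) * ∫⁻ a, f a ^ p ∂μ := by
  have hp0 : 0 < p := by linarith
  have h := eLpNorm'_le_eLpNorm'_mul_rpow_measure_univ (μ := μ) one_pos hp
    hf.aestronglyMeasurable
  simp only [eLpNorm', enorm_eq_self, ENNReal.rpow_one, div_one] at h
  calc (∫⁻ a, f a ∂μ) ^ p ≤ ((∫⁻ a, f a ^ p ∂μ) ^ (1 / p) * μ univ ^ (1 - 1 / p)) ^ p := by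
        gcongr
    _ = μ univ ^ (p - 1) * ∫⁻ a, f a ^ p ∂μ := by
        rw [ENNReal.mul_rpow_of_nonneg _ _ hp0.le, ← ENNReal.rpow_mul, ← ENNReal.rpow_mul,
          one_div_mul_cancel hp0.ne', ENNReal.rpow_one, mul_comm]
        congr 2
        field_simp

/-- Jensen's inequality with respect to a density of total mass at most one. -/
theorem lintegral_mul_rpow_le_of_lintegral_le_one {α : Type*} [MeasurableSpace α]
    {μ : Measure α} {p : ℝ} (hp : 1 ≤ p) {f k : α → ℝ≥0∞} (hf : Measurable f)
    (hk : Measurable k) (hk1 : ∫⁻ a, k a ∂μ ≤ 1) :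
    (∫⁻ a, k a * f a ∂μ) ^ p ≤ ∫⁻ a, k a * f a ^ p ∂μ := by
  have h := lintegral_rpow_le_measure_mul (μ := μ.withDensity k) hp hf.aemeasurable
  rw [lintegral_withDensity_eq_lintegral_mul _ hk hf,
    lintegral_withDensity_eq_lintegral_mul _ hk (hf.pow_const p)] at h
  refine h.trans ?_
  simp only [Pi.mul_apply]
  have h1 : (μ.withDensity k) univ ^ (p - 1) ≤ 1 := by
    apply ENNReal.rpow_le_one _ (by linarith)
    simpa [withDensity_apply] using hk1
  calc _ ≤ 1 * ∫⁻ a, k a * f a ^ p ∂μ := by gcongr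
    _ = _ := one_mul _

theorem sum_rpow_le_card_mul_sum {ι : Type*} (s : Finset ι) {p : ℝ} (hp : 1 ≤ p)
    (f : ι → ℝ≥0∞) : (∑ i ∈ s, f i) ^ p ≤ (s.card : ℝ≥0∞) ^ (p - 1) * ∑ i ∈ s, f i ^ p := by
  exact ENNReal.rpow_sum_le_const_mul_sum_rpow s f hp

theorem add_rpow_le_two_mul {p : ℝ} (hp : 1 ≤ p) (a b : ℝ≥0∞) :
    (a + b) ^ p ≤ 2 ^ (p - 1) * (a ^ p + b ^ p) :=
  ENNReal.rpow_add_le_mul_rpow_add_rpow a b hp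

theorem lintegral_comp_smul_add {d : ℕ} {c : ℝ} (hc : c ≠ 0) (a : Esp d) (H : Esp d → ℝ≥0∞) :
    ∫⁻ x, H (c • x + a) = ENNReal.ofReal |(c ^ d)⁻¹| * ∫⁻ x, H x := by
  have h1 : ∫⁻ x, H (c • x + a) = ∫⁻ x, H (x + a) ∂(Measure.map (c • ·) volume) :=
    ((Homeomorph.smulOfNeZero c hc).measurableEmbedding.lintegral_map (fun x => H (x + a))).symm
  rw [h1, Measure.map_addHaar_smul _ hc, lintegral_smul_measure, lintegral_add_right_eq_self]
  simp [finrank_euclideanSpace]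

theorem enorm_sub_midpoint_le {d : ℕ} {G : Esp d → ℝ} (hG : ContDiff ℝ 1 G) {r : ℝ}
    {x y : Esp d} (hx : ‖x‖ < r) (hy : ‖y‖ < r) :
    ‖G x - G (midpoint ℝ x y)‖ₑ ≤
      ENNReal.ofReal r * ∫⁻ θ in Ioc (0:ℝ) 1, ‖fderiv ℝ G ((1 - θ / 2) • x + (θ / 2) • y)‖ₑ := by
  set γ : ℝ → Esp d := fun θ => (1 - θ / 2) • x + (θ / 2) • y with hγ
  have hγd : ∀ θ, HasDerivAt γ ((1 / 2 : ℝ) • (y - x)) θ := by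
    intro θ
    have h1 : HasDerivAt (fun θ : ℝ => 1 - θ / 2) (-(1 / 2)) θ := by
      simpa using ((hasDerivAt_id θ).div_const 2).const_sub 1
    have h2 : HasDerivAt (fun θ : ℝ => θ / 2) (1 / 2) θ := by
      simpa using ((hasDerivAt_id θ).div_const 2)
    have h3 : (1 / 2 : ℝ) • (y - x) = (-(1 / 2) : ℝ) • x + (1 / 2 : ℝ) • y := by
      rw [smul_sub, neg_smul]; abel
    rw [h3]
    exact (h1.smul_const x).add (h2.smul_const y)
  have hγc : Continuous γ := by fun_prop
  have hd : ∀ θ ∈ uIcc (0:ℝ) 1, HasDerivAt (fun θ => G (γ θ))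
      (fderiv ℝ G (γ θ) ((1 / 2 : ℝ) • (y - x))) θ := fun θ _ =>
    ((hG.differentiable one_ne_zero (γ θ)).hasFDerivAt.comp_hasDerivAt θ (hγd θ))
  have hcont : Continuous fun θ => fderiv ℝ G (γ θ) ((1 / 2 : ℝ) • (y - x)) :=
    ((hG.continuous_fderiv one_ne_zero).comp hγc).clm_apply continuous_const
  have hInt := intervalIntegral.integral_eq_sub_of_hasDerivAt hd (hcont.intervalIntegrable 0 1)
  have hm : γ 1 = midpoint ℝ x y := by
    simp only [hγ, midpoint_eq_smul_add]
    rw [smul_add]; norm_num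
  have h0 : γ 0 = x := by simp [hγ]
  rw [h0, hm, intervalIntegral.integral_of_le zero_le_one] at hInt
  rw [← enorm_neg, neg_sub, ← hInt]
  refine (enorm_integral_le_lintegral_enorm _).trans ?_
  rw [← lintegral_const_mul' _ _ ENNReal.ofReal_ne_top]
  refine lintegral_mono fun θ => ?_
  have hxy : ‖(1 / 2 : ℝ) • (y - x)‖ ≤ r := by
    rw [norm_smul]
    have := norm_sub_le y x
    norm_num
    linarith
  have h3 : ‖(1 / 2 : ℝ) • (y - x)‖ₑ ≤ ENNReal.ofReal r := by
    rw [← ofReal_norm]; exact ENNReal.ofReal_le_ofReal hxy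
  calc _ ≤ ‖fderiv ℝ G (γ θ)‖ₑ * ‖(1 / 2 : ℝ) • (y - x)‖ₑ :=
        ContinuousLinearMap.le_opENorm _ _
    _ ≤ ‖fderiv ℝ G (γ θ)‖ₑ * ENNReal.ofReal r := by gcongr
    _ = _ := mul_comm _ _

theorem lintegral_ball_midpoint_le {d : ℕ} {G : Esp d → ℝ} (hG : ContDiff ℝ 1 G) (r : ℝ)
    {q : ℝ} (hq : 1 ≤ q) :
    ∫⁻ x in Metric.ball (0 : Esp d) r, ∫⁻ y in Metric.ball (0 : Esp d) r,
        ‖G x - G (midpoint ℝ x y)‖ₑ ^ q ≤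
      ENNReal.ofReal r ^ q * (2 ^ d * volume (Metric.ball (0 : Esp d) r)) *
        ∫⁻ x in Metric.ball (0 : Esp d) r, ‖fderiv ℝ G x‖ₑ ^ q := by
  set B := Metric.ball (0 : Esp d) r with hB
  have hBm : MeasurableSet B := measurableSet_ball
  have hq0 : 0 ≤ q := by linarith
  have hGc : Continuous (fderiv ℝ G) := hG.continuous_fderiv one_ne_zero
  set H : Esp d → ℝ≥0∞ := B.indicator fun x => ‖fderiv ℝ G x‖ₑ ^ q with hH
  have hHm : Measurable H := by
    refine Measurable.indicator ?_ hBm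
    exact (hGc.measurable.enorm).pow_const q
  have key : ∀ x ∈ B, ∀ y ∈ B, ‖G x - G (midpoint ℝ x y)‖ₑ ^ q ≤
      ENNReal.ofReal r ^ q * ∫⁻ θ in Ioc (0:ℝ) 1, H ((1 - θ / 2) • x + (θ / 2) • y) := by
    intro x hx y hy
    have hx' : ‖x‖ < r := by simpa [hB] using hx
    have hy' : ‖y‖ < r := by simpa [hB] using hy
    calc _ ≤ (ENNReal.ofReal r *
          ∫⁻ θ in Ioc (0:ℝ) 1, ‖fderiv ℝ G ((1 - θ / 2) • x + (θ / 2) • y)‖ₑ) ^ q := by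
          gcongr; exact enorm_sub_midpoint_le hG hx' hy'
      _ = ENNReal.ofReal r ^ q *
          (∫⁻ θ in Ioc (0:ℝ) 1, ‖fderiv ℝ G ((1 - θ / 2) • x + (θ / 2) • y)‖ₑ) ^ q :=
          ENNReal.mul_rpow_of_nonneg _ _ hq0
      _ ≤ ENNReal.ofReal r ^ q *
          ∫⁻ θ in Ioc (0:ℝ) 1, ‖fderiv ℝ G ((1 - θ / 2) • x + (θ / 2) • y)‖ₑ ^ q := by
          gcongr
          refine (lintegral_rpow_le_measure_mul hq ?_).trans (by simp)
          refine Measurable.aemeasurable ?_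
          exact (hGc.comp (by fun_prop)).measurable.enorm
      _ ≤ _ := by
          refine mul_le_mul' le_rfl (setLIntegral_mono' measurableSet_Ioc fun θ hθ => ?_)
          have : (1 - θ / 2) • x + (θ / 2) • y ∈ B :=
            convex_ball (0 : Esp d) r hx hy (by linarith [hθ.2]) (by linarith [hθ.1]) (by ring)
          rw [hH, indicator_of_mem this]
  calc _ ≤ ∫⁻ x in B, ∫⁻ y in B, ENNReal.ofReal r ^ q *
        ∫⁻ θ in Ioc (0:ℝ) 1, H ((1 - θ / 2) • x + (θ / 2) • y) :=
        setLIntegral_mono' hBm fun x hx => setLIntegral_mono' hBm fun y hy => key x hx y hy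
    _ ≤ ∫⁻ x, ∫⁻ y in B, ENNReal.ofReal r ^ q *
        ∫⁻ θ in Ioc (0:ℝ) 1, H ((1 - θ / 2) • x + (θ / 2) • y) := setLIntegral_le_lintegral _ _
    _ = ENNReal.ofReal r ^ q * ∫⁻ y in B, ∫⁻ θ in Ioc (0:ℝ) 1, ∫⁻ x,
          H ((1 - θ / 2) • x + (θ / 2) • y) := by
        have hne : ENNReal.ofReal r ^ q ≠ ∞ := ENNReal.rpow_ne_top_of_nonneg hq0 ofReal_ne_top
        simp_rw [lintegral_const_mul' _ _ hne]
        congr 1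
        rw [lintegral_lintegral_swap]
        · refine lintegral_congr fun y => ?_
          rw [lintegral_lintegral_swap]
          refine Measurable.aemeasurable ?_
          exact hHm.comp (by fun_prop)
        · refine Measurable.aemeasurable ?_
          have : Measurable fun p : (Esp d × Esp d) × ℝ =>
              H ((1 - p.2 / 2) • p.1.1 + (p.2 / 2) • p.1.2) := hHm.comp (by fun_prop)
          exact this.lintegral_prod_right'
    _ ≤ ENNReal.ofReal r ^ q * ∫⁻ y in B, ∫⁻ θ in Ioc (0:ℝ) 1, 2 ^ d * ∫⁻ x, H x := by
        refine mul_le_mul' le_rfl (lintegral_mono fun y =>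
          setLIntegral_mono' measurableSet_Ioc fun θ hθ => ?_)
        have h12 : 1 / 2 ≤ 1 - θ / 2 := by linarith [hθ.2]
        rw [lintegral_comp_smul_add (by linarith)]
        gcongr
        rw [← ENNReal.ofReal_ofNat, ← ENNReal.ofReal_pow (by norm_num)]
        apply ENNReal.ofReal_le_ofReal
        rw [abs_of_nonneg (by positivity), ← inv_pow]
        gcongr
        rw [inv_le_comm₀ (by linarith) (by norm_num)]
        linarith
    _ = _ := by
        rw [hH, lintegral_indicator hBm]
        simp only [lintegral_const, MeasurableSet.univ, Measure.restrict_apply, univ_inter,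
          Real.volume_Ioc, sub_zero, ofReal_one, mul_one]
        ring

theorem lintegral_ball_ball_enorm_sub_rpow_le {d : ℕ} (r : ℝ) {q : ℝ} (hq : 1 ≤ q) :
    ∃ C : ℝ≥0∞, C ≠ ∞ ∧ ∀ G : Esp d → ℝ, ContDiff ℝ 1 G →
    ∫⁻ x in Metric.ball (0 : Esp d) r, ∫⁻ y in Metric.ball (0 : Esp d) r, ‖G x - G y‖ₑ ^ q ≤
      C * ∫⁻ x in Metric.ball (0 : Esp d) r, ‖fderiv ℝ G x‖ₑ ^ q := by
  have hq0 : 0 ≤ q := by linarith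
  set C₀ := ENNReal.ofReal r ^ q * (2 ^ d * volume (Metric.ball (0 : Esp d) r)) with hC₀
  have hC₀t : C₀ ≠ ∞ := by
    refine ENNReal.mul_ne_top (ENNReal.rpow_ne_top_of_nonneg hq0 ofReal_ne_top) ?_
    exact ENNReal.mul_ne_top (by simp) measure_ball_lt_top.ne
  have h2t : (2 : ℝ≥0∞) ^ (q - 1) ≠ ∞ :=
    ENNReal.rpow_ne_top_of_nonneg (by linarith) (by simp)
  refine ⟨2 ^ (q - 1) * (C₀ + C₀), ENNReal.mul_ne_top h2t (by simp [hC₀t]), fun G hG => ?_⟩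
  set B := Metric.ball (0 : Esp d) r
  have hGm := hG.continuous.measurable
  have hmeas : Measurable fun p : Esp d × Esp d => ‖G p.1 - G (midpoint ℝ p.1 p.2)‖ₑ ^ q := by
    refine Measurable.pow_const ?_ q
    refine Measurable.enorm ?_
    refine (hGm.comp measurable_fst).sub (hGm.comp ?_)
    simp only [midpoint_eq_smul_add]
    fun_prop
  have hmid := lintegral_ball_midpoint_le hG r hq
  calc _ ≤ ∫⁻ x in B, ∫⁻ y in B, 2 ^ (q - 1) * (‖G x - G (midpoint ℝ x y)‖ₑ ^ q +
        ‖G y - G (midpoint ℝ y x)‖ₑ ^ q) := by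
        gcongr with x y
        refine le_trans ?_ (add_rpow_le_two_mul hq _ _)
        gcongr
        rw [midpoint_comm (R := ℝ) y x, ← enorm_neg (G y - _)]
        refine le_trans (le_of_eq ?_) (enorm_add_le _ _)
        congr 1; ring
    _ = 2 ^ (q - 1) * ((∫⁻ x in B, ∫⁻ y in B, ‖G x - G (midpoint ℝ x y)‖ₑ ^ q) +
          ∫⁻ x in B, ∫⁻ y in B, ‖G y - G (midpoint ℝ y x)‖ₑ ^ q) := by
        simp_rw [lintegral_const_mul' _ _ h2t]
        rw [← lintegral_add_left hmeas.lintegral_prod_right']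
        congr 1
        refine lintegral_congr fun x => ?_
        rw [← lintegral_add_left]
        exact hmeas.comp measurable_prodMk_left
    _ ≤ _ := by
        rw [lintegral_lintegral_swap (f := fun x y => ‖G y - G (midpoint ℝ y x)‖ₑ ^ q)
          (hmeas.comp measurable_swap).aemeasurable, mul_assoc, add_mul]
        gcongr

instance {d : ℕ} : (volume : Measure (Esp d × ℝ)).IsAddHaarMeasure :=
  inferInstanceAs ((volume : Measure (Esp d)).prod (volume : Measure ℝ)).IsAddHaarMeasure

/-- The partial derivative in the `i`-th spatial direction. -/
def spaceDeriv {d : ℕ} (i : Fin d) (F : Esp d × ℝ → ℝ) : Esp d × ℝ → ℝ :=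
  fun p => fderiv ℝ F p (EuclideanSpace.single i 1, 0)

/-- The partial derivative in time. -/
def timeDeriv {d : ℕ} (F : Esp d × ℝ → ℝ) : Esp d × ℝ → ℝ :=
  fun p => fderiv ℝ F p (0, 1)

section derivs
variable {d : ℕ} {F : Esp d × ℝ → ℝ}

theorem contDiff_fderiv_apply_const (hF : ContDiff ℝ (⊤ : ℕ∞) F) (v : Esp d × ℝ) :
    ContDiff ℝ (⊤ : ℕ∞) fun p => fderiv ℝ F p v :=
  (hF.fderiv_right (m := (⊤ : ℕ∞)) (by simp)).clm_apply contDiff_const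

theorem ContDiff.spaceDeriv (hF : ContDiff ℝ (⊤ : ℕ∞) F) (i : Fin d) :
    ContDiff ℝ (⊤ : ℕ∞) (spaceDeriv i F) := contDiff_fderiv_apply_const hF _

theorem ContDiff.timeDeriv (hF : ContDiff ℝ (⊤ : ℕ∞) F) :
    ContDiff ℝ (⊤ : ℕ∞) (timeDeriv F) := contDiff_fderiv_apply_const hF _

theorem HasCompactSupport.spaceDeriv (hF : HasCompactSupport F) (i : Fin d) :
    HasCompactSupport (spaceDeriv i F) := hF.fderiv_apply ℝ _

theorem HasCompactSupport.timeDeriv (hF : HasCompactSupport F) :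
    HasCompactSupport (timeDeriv F) := hF.fderiv_apply ℝ _

theorem hasFDerivAt_slice_space (hF : ContDiff ℝ (⊤ : ℕ∞) F) (x : Esp d) (t : ℝ) :
    HasFDerivAt (fun x => F (x, t))
      ((fderiv ℝ F (x, t)).comp (ContinuousLinearMap.inl ℝ (Esp d) ℝ)) x :=
  HasFDerivAt.comp x (hF.differentiable (by simp) (x, t)).hasFDerivAt (hasFDerivAt_prodMk_left x t)

theorem hasDerivAt_slice_time (hF : ContDiff ℝ (⊤ : ℕ∞) F) (x : Esp d) (t : ℝ) :
    HasDerivAt (fun s => F (x, s)) (timeDeriv F (x, t)) t := by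
  have h := HasFDerivAt.comp t (hF.differentiable (by simp) (x, t)).hasFDerivAt
    (hasFDerivAt_prodMk_right (𝕜 := ℝ) x t)
  simpa [_root_.timeDeriv, Function.comp_def] using h.hasDerivAt

theorem contDiff_slice_space (hF : ContDiff ℝ (⊤ : ℕ∞) F) (t : ℝ) :
    ContDiff ℝ (⊤ : ℕ∞) fun x => F (x, t) := hF.comp (contDiff_prodMk_left t)

theorem contDiff_slice_time (hF : ContDiff ℝ (⊤ : ℕ∞) F) (x : Esp d) :
    ContDiff ℝ (⊤ : ℕ∞) fun t => F (x, t) := hF.comp (contDiff_prodMk_right x)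

theorem HasCompactSupport.slice_space (hF : HasCompactSupport F) (t : ℝ) :
    HasCompactSupport fun x => F (x, t) :=
  hF.comp_isClosedEmbedding (g := fun x : Esp d => (x, t))
    (Isometry.of_dist_eq fun a b => by simp [Prod.dist_eq]).isClosedEmbedding

theorem HasCompactSupport.slice_time (hF : HasCompactSupport F) (x : Esp d) :
    HasCompactSupport fun t => F (x, t) :=
  hF.comp_isClosedEmbedding (g := fun t : ℝ => (x, t))
    (Isometry.of_dist_eq fun a b => by simp [Prod.dist_eq]).isClosedEmbedding

theorem enorm_clm_le_sum (L : Esp d →L[ℝ] ℝ) :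
    ‖L‖ₑ ≤ ∑ i, ‖L (EuclideanSpace.single i 1)‖ₑ := by
  have h : ‖L‖ ≤ ∑ i, ‖L (EuclideanSpace.single i 1)‖ := by
    refine L.opNorm_le_bound (by positivity) fun x => ?_
    have hx : x = ∑ i, x i • EuclideanSpace.single i (1:ℝ) := by
      ext j; simp [Finset.sum_apply, Pi.single_apply]
    conv_lhs => rw [hx]
    rw [map_sum, Finset.sum_mul]
    refine (norm_sum_le _ _).trans (Finset.sum_le_sum fun i _ => ?_)
    rw [map_smul, norm_smul, mul_comm]
    gcongr
    exact PiLp.norm_apply_le x i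
  calc ‖L‖ₑ = ENNReal.ofReal ‖L‖ := (ofReal_norm L).symm
    _ ≤ ENNReal.ofReal (∑ i, ‖L (EuclideanSpace.single i 1)‖) := ENNReal.ofReal_le_ofReal h
    _ = _ := by
      rw [ENNReal.ofReal_sum_of_nonneg (fun _ _ => norm_nonneg _)]
      simp only [ofReal_norm]

theorem enorm_fderiv_slice_le (hF : ContDiff ℝ (⊤ : ℕ∞) F) (x : Esp d) (t : ℝ) :
    ‖fderiv ℝ (fun x => F (x, t)) x‖ₑ ≤ ∑ i, ‖spaceDeriv i F (x, t)‖ₑ := by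
  rw [(hasFDerivAt_slice_space hF x t).fderiv]
  refine (enorm_clm_le_sum _).trans (le_of_eq ?_)
  simp [_root_.spaceDeriv]

theorem lintegral_enorm_sq_spaceDeriv_le (hF : ContDiff ℝ (⊤ : ℕ∞) F) (hc : HasCompactSupport F)
    (i : Fin d) :
    ∫⁻ p, ‖spaceDeriv i F p‖ₑ ^ 2 ≤ ∫⁻ p, ‖F p‖ₑ * ‖spaceDeriv i (spaceDeriv i F) p‖ₑ := by
  have h1 := hF.spaceDeriv i
  have hc1 := hc.spaceDeriv i
  have h2 := h1.spaceDeriv i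
  have hIBP := integral_mul_fderiv_eq_neg_fderiv_mul_of_integrable
    (μ := (volume : Measure (Esp d × ℝ))) (f := F) (g := spaceDeriv i F)
    (v := (EuclideanSpace.single i 1, 0))
    ((h1.continuous.mul h1.continuous).integrable_of_hasCompactSupport hc1.mul_left)
    ((hF.continuous.mul h2.continuous).integrable_of_hasCompactSupport hc.mul_right)
    ((hF.continuous.mul h1.continuous).integrable_of_hasCompactSupport hc.mul_right)
    (fun x _ => hF.differentiable (by simp) x) (fun x _ => h1.differentiable (by simp) x)
  have e1 : ∫⁻ p, ‖spaceDeriv i F p‖ₑ ^ 2 =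
      ENNReal.ofReal (∫ p, spaceDeriv i F p * spaceDeriv i F p) := by
    rw [ofReal_integral_eq_lintegral_ofReal (f := fun p => spaceDeriv i F p * spaceDeriv i F p)
      ((h1.continuous.mul h1.continuous).integrable_of_hasCompactSupport hc1.mul_left)
      (Filter.Eventually.of_forall fun p => mul_self_nonneg _)]
    refine lintegral_congr fun p => ?_
    rw [← ofReal_norm, ← ENNReal.ofReal_pow (norm_nonneg _), Real.norm_eq_abs, sq_abs, sq]
  have e2 : ∫ p, spaceDeriv i F p * spaceDeriv i F p =
      -∫ p, F p * spaceDeriv i (spaceDeriv i F) p := by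
    rw [neg_eq_iff_eq_neg.mpr]
    exact hIBP
  rw [e1, e2]
  calc _ ≤ ‖-∫ p, F p * spaceDeriv i (spaceDeriv i F) p‖ₑ := by
        rw [← ofReal_norm]; exact ENNReal.ofReal_le_ofReal (Real.le_norm_self _)
    _ ≤ _ := by
        rw [enorm_neg]
        refine (enorm_integral_le_lintegral_enorm _).trans (le_of_eq ?_)
        simp_rw [enorm_mul]

theorem lintegral_slice_enorm_sq_le (hF : ContDiff ℝ (⊤ : ℕ∞) F) (hc : HasCompactSupport F)
    (t : ℝ) :
    ∫⁻ x, ‖F (x, t)‖ₑ ^ 2 ≤ 2 * ∫⁻ p, ‖F p‖ₑ * ‖timeDeriv F p‖ₑ := by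
  have hpt : ∀ x, ‖F (x, t)‖ₑ ^ 2 ≤ ∫⁻ s, 2 * (‖F (x, s)‖ₑ * ‖timeDeriv F (x, s)‖ₑ) := by
    intro x
    have hd : ∀ s, deriv (fun s => F (x, s) ^ 2) s = 2 * (F (x, s) * timeDeriv F (x, s)) := by
      intro s
      rw [((hasDerivAt_slice_time hF x s).fun_pow 2).deriv]
      push_cast; ring
    have h := HasCompactSupport.enorm_le_lintegral_Ici_deriv
      (f := fun s => F (x, s) ^ 2) (((contDiff_slice_time hF x).pow 2).of_le (by simp))
      ((hc.slice_time x).comp_left (g := fun y : ℝ => y ^ 2) (by simp)) t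
    simp only [enorm_pow] at h
    refine h.trans ((setLIntegral_le_lintegral _ _).trans (lintegral_mono fun s => ?_))
    rw [hd, enorm_mul, enorm_mul]
    gcongr
    rw [← ofReal_norm]; simp
  have hm : Measurable fun p => ‖F p‖ₑ * ‖timeDeriv F p‖ₑ :=
    hF.continuous.measurable.enorm.mul hF.timeDeriv.continuous.measurable.enorm
  calc _ ≤ ∫⁻ x, ∫⁻ s, 2 * (‖F (x, s)‖ₑ * ‖timeDeriv F (x, s)‖ₑ) := lintegral_mono hpt
    _ = ∫⁻ p, 2 * (‖F p‖ₑ * ‖timeDeriv F p‖ₑ) := by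
        rw [Measure.volume_eq_prod, lintegral_prod _ (hm.const_mul 2).aemeasurable]
    _ = _ := lintegral_const_mul _ hm

end derivs

theorem lintegral_mul_le_sq_mul_sq {α : Type*} [MeasurableSpace α] {μ : Measure α}
    {f g : α → ℝ≥0∞} (hf : AEMeasurable f μ) (hg : AEMeasurable g μ) :
    ∫⁻ a, f a * g a ∂μ ≤
      (∫⁻ a, f a ^ 2 ∂μ) ^ (1 / 2 : ℝ) * (∫⁻ a, g a ^ 2 ∂μ) ^ (1 / 2 : ℝ) := by
  have := lintegral_mul_le_Lp_mul_Lq μ Real.HolderConjugate.two_two hf hg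
  simpa using this

/-- A Ladyzhenskaya-type inequality: the borderline Gagliardo–Nirenberg–Sobolev inequality applied
to the square of a function. -/
theorem exists_lintegral_rpow_le_ladyzhenskaya {d : ℕ} (hd : 2 ≤ d) :
    ∃ C : ℝ≥0∞, C ≠ ∞ ∧ ∀ u : Esp d → ℝ, ContDiff ℝ (⊤ : ℕ∞) u → HasCompactSupport u →
      ∫⁻ x, ‖u x‖ₑ ^ (2 * d / (d - 1) : ℝ) ≤
        C * (∫⁻ x, ‖u x‖ₑ ^ 2) ^ (d / (2 * (d - 1)) : ℝ) *
          (∫⁻ x, ‖fderiv ℝ u x‖ₑ ^ 2) ^ (d / (2 * (d - 1)) : ℝ) := by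
  have hd' : (2:ℝ) ≤ d := by exact_mod_cast hd
  set s : ℝ := d / (d - 1) with hs
  have hs0 : 0 ≤ s := div_nonneg (by linarith) (by linarith)
  have hconj : Real.HolderConjugate (Module.finrank ℝ (Esp d)) s := by
    rw [finrank_euclideanSpace, Fintype.card_fin]
    exact Real.HolderConjugate.conjExponent (by linarith)
  set K := lintegralPowLePowLIntegralFDerivConst (volume : Measure (Esp d)) s
  refine ⟨K * 2 ^ s, ENNReal.mul_ne_top coe_ne_top
    (ENNReal.rpow_ne_top_of_nonneg hs0 (by simp)), fun u hu hc => ?_⟩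
  have h := lintegral_pow_le_pow_lintegral_fderiv (volume : Measure (Esp d))
    (u := fun x => u x ^ 2) ((hu.pow 2).of_le (by simp))
    (hc.comp_left (g := fun y : ℝ => y ^ 2) (by simp)) hconj
  have hfd : ∀ x, ‖fderiv ℝ (fun x => u x ^ 2) x‖ₑ = 2 * (‖u x‖ₑ * ‖fderiv ℝ u x‖ₑ) := by
    intro x
    rw [((hu.differentiable (by simp) x).hasFDerivAt.pow 2).fderiv, enorm_smul]
    simp only [Nat.cast_ofNat, Nat.add_one_sub_one, pow_one, nsmul_eq_mul, enorm_mul]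
    rw [← ofReal_norm (2:ℝ)]
    simp [mul_assoc]
  have hum : Measurable fun x => ‖u x‖ₑ := hu.continuous.measurable.enorm
  have hdm : Measurable fun x => ‖fderiv ℝ u x‖ₑ :=
    (hu.continuous_fderiv (by simp)).measurable.enorm
  have e1 : ∀ x, ‖u x ^ 2‖ₑ ^ s = ‖u x‖ₑ ^ (2 * d / (d - 1) : ℝ) := by
    intro x
    rw [enorm_pow, ← ENNReal.rpow_natCast, ← ENNReal.rpow_mul, hs]
    congr 1; push_cast; ring
  simp_rw [e1, hfd] at h
  refine h.trans ?_
  rw [lintegral_const_mul (2 : ℝ≥0∞) (f := fun x => ‖u x‖ₑ * ‖fderiv ℝ u x‖ₑ) (hum.mul hdm),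
    mul_assoc, mul_assoc]
  gcongr
  rw [ENNReal.mul_rpow_of_nonneg _ _ hs0]
  gcongr
  refine (ENNReal.rpow_le_rpow (lintegral_mul_le_sq_mul_sq hum.aemeasurable hdm.aemeasurable)
    hs0).trans (le_of_eq ?_)
  rw [ENNReal.mul_rpow_of_nonneg _ _ hs0, ← ENNReal.rpow_mul, ← ENNReal.rpow_mul]
  have : 1 / 2 * s = d / (2 * (d - 1)) := by rw [hs]; field_simp
  rw [this]

theorem lintegral_rpow_le_of_le_one {α : Type*} [MeasurableSpace α] {μ : Measure α} {r : ℝ}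
    (hr0 : 0 < r) (hr : r ≤ 1) {f : α → ℝ≥0∞} (hf : AEMeasurable f μ) :
    ∫⁻ a, f a ^ r ∂μ ≤ μ univ ^ (1 - r) * (∫⁻ a, f a ∂μ) ^ r := by
  have h := lintegral_rpow_le_measure_mul (μ := μ) (p := 1 / r) (one_le_one_div hr0 hr)
    (hf.pow_const r)
  simp_rw [← ENNReal.rpow_mul, mul_one_div_cancel hr0.ne', ENNReal.rpow_one] at h
  calc _ = ((∫⁻ a, f a ^ r ∂μ) ^ (1 / r)) ^ r := by
        rw [← ENNReal.rpow_mul, one_div_mul_cancel hr0.ne', ENNReal.rpow_one]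
    _ ≤ (μ univ ^ (1 / r - 1) * ∫⁻ a, f a ∂μ) ^ r := by gcongr
    _ = _ := by
        rw [ENNReal.mul_rpow_of_nonneg _ _ hr0.le, ← ENNReal.rpow_mul]
        congr 2; field_simp

/-- The size of the second-order parabolic derivatives of `F`: all second spatial derivatives and
the time derivative. -/
def parabolicSize {d : ℕ} (F : Esp d × ℝ → ℝ) (p : Esp d × ℝ) : ℝ≥0∞ :=
  (∑ i, ∑ j, ‖spaceDeriv j (spaceDeriv i F) p‖ₑ) + ‖timeDeriv F p‖ₑ

theorem continuous_parabolicSize {d : ℕ} {F : Esp d × ℝ → ℝ} (hF : ContDiff ℝ (⊤ : ℕ∞) F) :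
    Continuous (parabolicSize F) := by
  refine Continuous.add ?_ hF.timeDeriv.continuous.enorm
  exact continuous_finsetSum _ fun i _ => continuous_finsetSum _ fun j _ =>
    ((hF.spaceDeriv i).spaceDeriv j).continuous.enorm

theorem enorm_spaceDeriv_spaceDeriv_le_parabolicSize {d : ℕ} (F : Esp d × ℝ → ℝ) (i j : Fin d)
    (p : Esp d × ℝ) : ‖spaceDeriv j (spaceDeriv i F) p‖ₑ ≤ parabolicSize F p := by
  refine le_trans ?_ (le_self_add (b := ‖timeDeriv F p‖ₑ))
  calc _ ≤ ∑ j, ‖spaceDeriv j (spaceDeriv i F) p‖ₑ :=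
        Finset.single_le_sum (f := fun j => ‖spaceDeriv j (spaceDeriv i F) p‖ₑ)
          (fun _ _ => zero_le) (Finset.mem_univ j)
    _ ≤ _ := Finset.single_le_sum
          (f := fun i => ∑ j, ‖spaceDeriv j (spaceDeriv i F) p‖ₑ)
          (fun _ _ => zero_le) (Finset.mem_univ i)

theorem enorm_timeDeriv_le_parabolicSize {d : ℕ} (F : Esp d × ℝ → ℝ) (p : Esp d × ℝ) :
    ‖timeDeriv F p‖ₑ ≤ parabolicSize F p := by
  unfold parabolicSize
  exact le_add_self

/-- `a ≤ K √a b` forces `a ≤ K² b²` when `a` is finite. -/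
theorem le_sq_of_le_mul_rpow_half {a K b : ℝ≥0∞} (ha : a ≠ ∞)
    (h : a ≤ K * a ^ (1 / 2 : ℝ) * b) : a ≤ (K * b) ^ 2 := by
  rcases eq_or_ne a 0 with rfl | h0
  · simp
  have hs0 : a ^ (1 / 2 : ℝ) ≠ 0 := by simp [h0, ha]
  have hst : a ^ (1 / 2 : ℝ) ≠ ∞ := ENNReal.rpow_ne_top_of_nonneg (by norm_num) ha
  have hsq : a = a ^ (1 / 2 : ℝ) * a ^ (1 / 2 : ℝ) := by
    rw [← ENNReal.rpow_add_of_nonneg _ _ (by norm_num) (by norm_num)]; norm_num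
  have h2 : a ^ (1 / 2 : ℝ) ≤ K * b := by
    rw [← ENNReal.mul_le_mul_iff_right hs0 hst, ← hsq]
    calc a ≤ _ := h
      _ = _ := by ring
  calc a = a ^ (1 / 2 : ℝ) * a ^ (1 / 2 : ℝ) := hsq
    _ ≤ (K * b) * (K * b) := by gcongr
    _ = _ := (sq _).symm

theorem exists_lintegral_rpow_le_of_energy {d : ℕ} (hd : 2 ≤ d) (R : ℝ) :
    ∃ C : ℝ≥0∞, C ≠ ∞ ∧ ∀ w : Esp d × ℝ → ℝ, ContDiff ℝ (⊤ : ℕ∞) w → HasCompactSupport w →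
      (∀ x t, R ≤ |t| → w (x, t) = 0) → ∀ J : ℝ≥0∞,
      (∀ i, ∫⁻ p, ‖spaceDeriv i w p‖ₑ ^ 2 ≤ J) → (∀ t, ∫⁻ x, ‖w (x, t)‖ₑ ^ 2 ≤ J) →
      ∫⁻ p, ‖w p‖ₑ ^ (2 * d / (d - 1) : ℝ) ≤ C * J ^ (d / (d - 1) : ℝ) := by
  have hd' : (2:ℝ) ≤ d := by exact_mod_cast hd
  obtain ⟨C, hC, H⟩ := exists_lintegral_rpow_le_ladyzhenskaya hd
  set r : ℝ := d / (2 * (d - 1)) with hr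
  have hr0 : 0 < r := div_pos (by linarith) (by linarith)
  have hr1 : r ≤ 1 := (div_le_one (by linarith)).2 (by linarith)
  set V : ℝ≥0∞ := volume (Icc (-R) R) with hV
  refine ⟨C * (V ^ (1 - r) * (d * d) ^ r), ?_, fun w hw hc hR J hJ1 hJ2 => ?_⟩
  · refine ENNReal.mul_ne_top hC (ENNReal.mul_ne_top ?_ ?_)
    · exact ENNReal.rpow_ne_top_of_nonneg (by linarith) (by simp [hV])
    · exact ENNReal.rpow_ne_top_of_nonneg hr0.le (by finiteness)
  set P : ℝ := 2 * d / (d - 1) with hP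
  have hP0 : 0 < P := div_pos (by linarith) (by linarith)
  have hwm : Measurable fun p => ‖w p‖ₑ ^ P := hw.continuous.measurable.enorm.pow_const _
  have hdm : Measurable fun p => (∑ i, ‖spaceDeriv i w p‖ₑ) ^ 2 :=
    (Finset.measurable_sum _ fun i _ =>
      (hw.spaceDeriv i).continuous.measurable.enorm).pow_const 2
  have hdm' : Measurable fun t => ∫⁻ x, (∑ i, ‖spaceDeriv i w (x, t)‖ₑ) ^ 2 :=
    hdm.lintegral_prod_left'
  have hslice : ∀ t, ∫⁻ x, ‖w (x, t)‖ₑ ^ P ≤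
      (Icc (-R) R).indicator
        (fun t => C * J ^ r * (∫⁻ x, (∑ i, ‖spaceDeriv i w (x, t)‖ₑ) ^ 2) ^ r) t := by
    intro t
    by_cases ht : t ∈ Icc (-R) R
    · rw [indicator_of_mem ht]
      refine (H _ (contDiff_slice_space hw t) (hc.slice_space t)).trans ?_
      gcongr with x
      · exact hJ2 t
      · exact enorm_fderiv_slice_le hw x t
    · have : R ≤ |t| := by
        by_contra! h
        exact ht (abs_le.1 h.le)
      simp [hR _ t this, hP0]
  calc ∫⁻ p, ‖w p‖ₑ ^ P = ∫⁻ t, ∫⁻ x, ‖w (x, t)‖ₑ ^ P := by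
        rw [Measure.volume_eq_prod, lintegral_prod_symm _ hwm.aemeasurable]
    _ ≤ ∫⁻ t in Icc (-R) R, C * J ^ r * (∫⁻ x, (∑ i, ‖spaceDeriv i w (x, t)‖ₑ) ^ 2) ^ r := by
        rw [← lintegral_indicator measurableSet_Icc]
        exact lintegral_mono hslice
    _ = C * J ^ r * ∫⁻ t in Icc (-R) R, (∫⁻ x, (∑ i, ‖spaceDeriv i w (x, t)‖ₑ) ^ 2) ^ r :=
        lintegral_const_mul _ (hdm'.pow_const r)
    _ ≤ C * J ^ r * (V ^ (1 - r) * (d * d * J) ^ r) := by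
        gcongr
        refine (lintegral_rpow_le_of_le_one hr0 hr1 hdm'.aemeasurable).trans ?_
        rw [Measure.restrict_apply_univ]
        gcongr
        refine (setLIntegral_le_lintegral _ _).trans ?_
        rw [← lintegral_prod_symm (μ := (volume : Measure (Esp d)))
          (fun p => (∑ i, ‖spaceDeriv i w p‖ₑ) ^ 2) hdm.aemeasurable, ← Measure.volume_eq_prod]
        calc _ ≤ ∫⁻ p, (d:ℝ≥0∞) * ∑ i, ‖spaceDeriv i w p‖ₑ ^ 2 := by
              refine lintegral_mono fun p => ?_
              have := sum_rpow_le_card_mul_sum Finset.univ one_le_two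
                (fun i => ‖spaceDeriv i w p‖ₑ)
              norm_num at this
              exact this
          _ = (d:ℝ≥0∞) * ∑ i, ∫⁻ p, ‖spaceDeriv i w p‖ₑ ^ 2 := by
              rw [lintegral_const_mul' _ _ (by simp), lintegral_finsetSum]
              exact fun i _ => (hw.spaceDeriv i).continuous.measurable.enorm.pow_const 2
          _ ≤ (d:ℝ≥0∞) * ∑ i : Fin d, J := by gcongr with i; exact hJ1 i
          _ = _ := by simp [mul_assoc]
    _ = C * (V ^ (1 - r) * (d * d) ^ r) * J ^ (d / (d - 1) : ℝ) := by
        have : (d / (d - 1) : ℝ) = r + r := by rw [hr]; field_simp; ring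
        rw [this, ENNReal.rpow_add_of_nonneg _ _ hr0.le hr0.le,
          ENNReal.mul_rpow_of_nonneg _ _ hr0.le]
        ring

/-- The energy estimate for compactly supported functions, with the forcing measured in the
borderline Lebesgue space. -/
theorem exists_lintegral_sq_spaceDeriv_le {d : ℕ} (hd : 2 ≤ d) (R : ℝ) :
    ∃ C : ℝ≥0∞, C ≠ ∞ ∧ ∀ w : Esp d × ℝ → ℝ, ContDiff ℝ (⊤ : ℕ∞) w → HasCompactSupport w →
      (∀ x t, R ≤ |t| → w (x, t) = 0) → ∀ i,
      ∫⁻ p, ‖spaceDeriv i w p‖ₑ ^ 2 ≤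
        C * ((∫⁻ p, parabolicSize w p ^ (2 * d / (d + 1) : ℝ)) ^
          (1 / (2 * d / (d + 1)) : ℝ)) ^ 2 := by
  have hd' : (2:ℝ) ≤ d := by exact_mod_cast hd
  obtain ⟨C, hC, H⟩ := exists_lintegral_rpow_le_of_energy hd R
  set P : ℝ := 2 * d / (d - 1) with hP
  set Q : ℝ := 2 * d / (d + 1) with hQ
  have hP0 : 0 < P := div_pos (by linarith) (by linarith)
  have hPQ : P.HolderConjugate Q := by
    rw [Real.holderConjugate_iff]
    refine ⟨(one_lt_div (by linarith)).2 (by linarith), ?_⟩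
    rw [hP, hQ]; field_simp; ring
  refine ⟨(C ^ (1 / P) * 2 ^ (1 / 2 : ℝ)) ^ 2, ?_, fun w hw hc hR i => ?_⟩
  · refine ENNReal.pow_ne_top (ENNReal.mul_ne_top ?_ ?_)
    · exact ENNReal.rpow_ne_top_of_nonneg (by positivity) hC
    · exact ENNReal.rpow_ne_top_of_nonneg (by norm_num) (by simp)
  set J := ∫⁻ p, ‖w p‖ₑ * parabolicSize w p with hJ
  have hNc := continuous_parabolicSize hw
  have h1 : ∀ i, ∫⁻ p, ‖spaceDeriv i w p‖ₑ ^ 2 ≤ J := by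
    intro i
    refine (lintegral_enorm_sq_spaceDeriv_le hw hc i).trans (lintegral_mono fun p => ?_)
    exact mul_le_mul' le_rfl (enorm_spaceDeriv_spaceDeriv_le_parabolicSize w i i p)
  have h2 : ∀ t, ∫⁻ x, ‖w (x, t)‖ₑ ^ 2 ≤ 2 * J := by
    intro t
    refine (lintegral_slice_enorm_sq_le hw hc t).trans ?_
    refine mul_le_mul' le_rfl (lintegral_mono fun p => ?_)
    exact mul_le_mul' le_rfl (enorm_timeDeriv_le_parabolicSize w p)
  have hJt : J ≠ ∞ := by
    have hInt : ∀ G : Esp d × ℝ → ℝ, Continuous G → ∫⁻ p, ‖w p‖ₑ * ‖G p‖ₑ ≠ ∞ := by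
      intro G hG
      have := ((hw.continuous.mul hG).integrable_of_hasCompactSupport
        (μ := volume) hc.mul_right).hasFiniteIntegral
      simpa [HasFiniteIntegral, enorm_mul] using this.ne
    have : J = (∑ i, ∑ j, ∫⁻ p, ‖w p‖ₑ * ‖spaceDeriv j (spaceDeriv i w) p‖ₑ) +
        ∫⁻ p, ‖w p‖ₑ * ‖timeDeriv w p‖ₑ := by
      simp only [hJ, parabolicSize, mul_add, Finset.mul_sum]
      have hm : ∀ i j, Measurable fun p => ‖w p‖ₑ * ‖spaceDeriv j (spaceDeriv i w) p‖ₑ :=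
        fun i j => hw.continuous.measurable.enorm.mul
          ((hw.spaceDeriv i).spaceDeriv j).continuous.measurable.enorm
      rw [lintegral_add_left (Finset.measurable_sum _ fun i _ =>
        Finset.measurable_sum _ fun j _ => hm i j), lintegral_finsetSum _
          fun i _ => Finset.measurable_sum _ fun j _ => hm i j]
      simp_rw [lintegral_finsetSum _ fun j _ => hm _ j]
    rw [this]
    refine ENNReal.add_ne_top.2 ⟨?_, hInt _ hw.timeDeriv.continuous⟩
    exact ENNReal.sum_ne_top.2 fun i _ => ENNReal.sum_ne_top.2 fun j _ =>
      hInt _ ((hw.spaceDeriv i).spaceDeriv j).continuous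
  have h3 := H w hw hc hR (2 * J) (fun i => (h1 i).trans (by rw [two_mul]; exact le_self_add)) h2
  have hhold : J ≤ (∫⁻ p, ‖w p‖ₑ ^ P) ^ (1 / P) * (∫⁻ p, parabolicSize w p ^ Q) ^ (1 / Q) :=
    ENNReal.lintegral_mul_le_Lp_mul_Lq volume hPQ hw.continuous.measurable.enorm.aemeasurable
      hNc.measurable.aemeasurable
  have h4 : J ≤ (C ^ (1 / P) * 2 ^ (1 / 2 : ℝ)) * J ^ (1 / 2 : ℝ) *
      (∫⁻ p, parabolicSize w p ^ Q) ^ (1 / Q) := by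
    refine hhold.trans ?_
    gcongr
    refine (ENNReal.rpow_le_rpow h3 (by positivity)).trans (le_of_eq ?_)
    rw [ENNReal.mul_rpow_of_nonneg _ _ (by positivity), ← ENNReal.rpow_mul]
    have : (d / (d - 1) : ℝ) * (1 / P) = 1 / 2 := by
      have h1 : (d:ℝ) - 1 ≠ 0 := by linarith
      rw [hP]; field_simp
    rw [this, ENNReal.mul_rpow_of_nonneg _ _ (by norm_num), mul_assoc]
  exact (h1 i).trans ((le_sq_of_le_mul_rpow_half hJt h4).trans (le_of_eq (mul_pow _ _ _)))

theorem exists_enorm_le_indicator {E : Type*} [TopologicalSpace E]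
    {k : E → ℝ} (hk : Continuous k) (hc : HasCompactSupport k) {s : Set E} (hs : tsupport k ⊆ s) :
    ∃ K : ℝ≥0∞, K ≠ ∞ ∧ ∀ y, ‖k y‖ₑ ≤ s.indicator (fun _ => K) y := by
  obtain ⟨K, hK⟩ := hc.exists_bound_of_continuous hk
  refine ⟨ENNReal.ofReal K, ofReal_ne_top, fun y => ?_⟩
  by_cases hy : y ∈ s
  · rw [indicator_of_mem hy, ← ofReal_norm]
    exact ENNReal.ofReal_le_ofReal (hK y)
  · rw [image_eq_zero_of_notMem_tsupport fun h => hy (hs h)]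
    simp

theorem lintegral_enorm_eq_one_of_nonneg {α : Type*} [MeasurableSpace α] {μ : Measure α}
    {k : α → ℝ} (h0 : ∀ x, 0 ≤ k x) (h1 : ∫ x, k x ∂μ = 1) : ∫⁻ x, ‖k x‖ₑ ∂μ = 1 := by
  have hInt : Integrable k μ := by
    by_contra h
    rw [integral_undef h] at h1
    exact zero_ne_one h1
  have := ofReal_integral_eq_lintegral_ofReal hInt (Filter.Eventually.of_forall h0)
  rw [h1, ofReal_one] at this
  rw [this]
  refine lintegral_congr fun x => ?_
  rw [← ofReal_norm, Real.norm_of_nonneg (h0 x)]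

theorem enorm_sub_average_rpow_le {d : ℕ} {k u : Esp d → ℝ} (hk : GoodK2 k) (hu : Continuous u)
    {K : ℝ≥0∞} {B : Set (Esp d)} (hB : MeasurableSet B)
    (hK : ∀ y, ‖k y‖ₑ ≤ B.indicator (fun _ => K) y) {q : ℝ} (hq : 1 ≤ q) (x : Esp d) :
    ‖u x - ∫ y, u y * k y‖ₑ ^ q ≤ K * ∫⁻ y in B, ‖u x - u y‖ₑ ^ q := by
  obtain ⟨hks, hkc, -, hk0, hk1⟩ := hk
  have hkint : Integrable k := hks.continuous.integrable_of_hasCompactSupport hkc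
  have huk : Integrable fun y => u y * k y :=
    (hu.mul hks.continuous).integrable_of_hasCompactSupport hkc.mul_left
  have e : u x - ∫ y, u y * k y = ∫ y, k y * (u x - u y) := by
    have : (fun y => k y * (u x - u y)) = fun y => u x * k y - u y * k y := by
      ext y; ring
    rw [this, integral_sub (hkint.const_mul _) huk, integral_const_mul, hk1, mul_one]
  have hm : Measurable fun y => ‖u x - u y‖ₑ :=
    (continuous_const.sub hu).measurable.enorm
  rw [e]
  calc _ ≤ (∫⁻ y, ‖k y‖ₑ * ‖u x - u y‖ₑ) ^ q := by
        gcongr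
        refine (enorm_integral_le_lintegral_enorm _).trans (le_of_eq ?_)
        simp_rw [enorm_mul]
    _ ≤ ∫⁻ y, ‖k y‖ₑ * ‖u x - u y‖ₑ ^ q :=
        lintegral_mul_rpow_le_of_lintegral_le_one hq hm hks.continuous.measurable.enorm
          (lintegral_enorm_eq_one_of_nonneg hk0 hk1).le
    _ ≤ ∫⁻ y, B.indicator (fun y => K * ‖u x - u y‖ₑ ^ q) y := by
        refine lintegral_mono fun y => ?_
        refine (mul_le_mul_left (hK y) _).trans (le_of_eq ?_)
        by_cases hy : y ∈ B <;> simp [hy]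
    _ = _ := by rw [lintegral_indicator hB, lintegral_const_mul _ (hm.pow_const q)]

theorem ball_prod_eq {d : ℕ} (r : ℝ) :
    Metric.ball (0 : Esp d × ℝ) r = Metric.ball (0 : Esp d) r ×ˢ Metric.ball (0 : ℝ) r :=
  (ball_prod_same (0 : Esp d) (0 : ℝ) r).symm

theorem setLIntegral_ball_prod {d : ℕ} (r : ℝ) {f : Esp d × ℝ → ℝ≥0∞} (hf : Measurable f) :
    ∫⁻ p in Metric.ball (0 : Esp d × ℝ) r, f p =
      ∫⁻ t in Metric.ball (0 : ℝ) r, ∫⁻ x in Metric.ball (0 : Esp d) r, f (x, t) := by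
  rw [ball_prod_eq, Measure.volume_eq_prod, ← Measure.prod_restrict,
    lintegral_prod_symm _ hf.aemeasurable]

theorem exists_lintegral_sub_slice_average_le {d : ℕ} {k : Esp d → ℝ} (hk : GoodK2 k) {r : ℝ}
    (hr : 1 / 2 ≤ r) {q : ℝ} (hq : 1 ≤ q) :
    ∃ C : ℝ≥0∞, C ≠ ∞ ∧ ∀ u : Esp d × ℝ → ℝ, ContDiff ℝ (⊤ : ℕ∞) u →
      ∫⁻ p in Metric.ball (0 : Esp d × ℝ) r, ‖u p - ∫ y, u (y, p.2) * k y‖ₑ ^ q ≤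
        C * ∑ i, ∫⁻ p in Metric.ball (0 : Esp d × ℝ) r, ‖spaceDeriv i u p‖ₑ ^ q := by
  obtain ⟨C, hC, H⟩ := lintegral_ball_ball_enorm_sub_rpow_le (d := d) r hq
  set B := Metric.ball (0 : Esp d) r
  obtain ⟨K, hKt, hK⟩ := exists_enorm_le_indicator (s := B) hk.1.continuous hk.2.1
    (hk.2.2.1.trans (Metric.ball_subset_ball hr))
  have hq0 : 0 ≤ q - 1 := by linarith
  refine ⟨K * (C * (d : ℝ≥0∞) ^ (q - 1)), ?_, fun u hu => ?_⟩
  · exact ENNReal.mul_ne_top hKt (ENNReal.mul_ne_top hC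
      (ENNReal.rpow_ne_top_of_nonneg hq0 (by simp)))
  have huc := hu.continuous
  have hm1 : Measurable fun p : Esp d × ℝ => ‖u p - ∫ y, u (y, p.2) * k y‖ₑ ^ q := by
    refine Measurable.pow_const (Measurable.enorm ?_) q
    refine huc.measurable.sub ?_
    have : StronglyMeasurable fun z : (Esp d × ℝ) × Esp d => u (z.2, z.1.2) * k z.2 := by
      refine Continuous.stronglyMeasurable ?_
      have := hk.1.continuous
      fun_prop
    exact this.integral_prod_right.measurable
  have hm2 : ∀ i, Measurable fun p => ‖spaceDeriv i u p‖ₑ ^ q := fun i =>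
    (hu.spaceDeriv i).continuous.measurable.enorm.pow_const q
  rw [setLIntegral_ball_prod _ hm1]
  simp_rw [setLIntegral_ball_prod _ (hm2 _)]
  rw [← lintegral_finsetSum]
  swap
  · intro i _
    exact (hm2 i).lintegral_prod_left'
  rw [← lintegral_const_mul' _ _ (ENNReal.mul_ne_top hKt (ENNReal.mul_ne_top hC
      (ENNReal.rpow_ne_top_of_nonneg hq0 (by simp))))]
  refine lintegral_mono fun t => ?_
  have hut := contDiff_slice_space hu t
  calc _ ≤ ∫⁻ x in B, K * ∫⁻ y in B, ‖u (x, t) - u (y, t)‖ₑ ^ q :=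
        lintegral_mono fun x => enorm_sub_average_rpow_le hk hut.continuous
          measurableSet_ball hK hq x
    _ = K * ∫⁻ x in B, ∫⁻ y in B, ‖u (x, t) - u (y, t)‖ₑ ^ q := lintegral_const_mul' _ _ hKt
    _ ≤ K * (C * ∫⁻ x in B, ‖fderiv ℝ (fun x => u (x, t)) x‖ₑ ^ q) := by
        gcongr
        exact H _ (hut.of_le (by simp))
    _ ≤ K * (C * ∫⁻ x in B, (d : ℝ≥0∞) ^ (q - 1) * ∑ i, ‖spaceDeriv i u (x, t)‖ₑ ^ q) := by
        gcongr with x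
        refine (ENNReal.rpow_le_rpow (enorm_fderiv_slice_le hu x t) (by linarith)).trans ?_
        simpa using sum_rpow_le_card_mul_sum Finset.univ hq (fun i => ‖spaceDeriv i u (x, t)‖ₑ)
    _ = _ := by
        rw [lintegral_const_mul' _ _ (ENNReal.rpow_ne_top_of_nonneg hq0 (by simp)),
          lintegral_finsetSum, mul_assoc, mul_assoc]
        exact fun i _ => (hm2 i).comp measurable_prodMk_right

theorem enorm_sub_slice_le {d : ℕ} {F : Esp d × ℝ → ℝ} (hF : ContDiff ℝ (⊤ : ℕ∞) F) {r : ℝ}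
    (y : Esp d) {t : ℝ} (ht : t ∈ Metric.ball (0 : ℝ) r) :
    ‖F (y, t) - F (y, 0)‖ₑ ≤ ∫⁻ s in Metric.ball (0 : ℝ) r, ‖timeDeriv F (y, s)‖ₑ := by
  have hc : Continuous fun s => timeDeriv F (y, s) := hF.timeDeriv.continuous.comp (by fun_prop)
  have hInt := intervalIntegral.integral_eq_sub_of_hasDerivAt (a := 0) (b := t)
    (fun s _ => hasDerivAt_slice_time hF y s) (hc.intervalIntegrable 0 t)
  rw [← hInt]
  have h1 : ‖∫ s in (0:ℝ)..t, timeDeriv F (y, s)‖ₑ =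
      ‖∫ s in uIoc 0 t, timeDeriv F (y, s)‖ₑ := by
    rw [← ofReal_norm, ← ofReal_norm, intervalIntegral.norm_intervalIntegral_eq]
  rw [h1]
  refine (enorm_integral_le_lintegral_enorm _).trans (lintegral_mono_set ?_)
  refine uIoc_subset_uIcc.trans ?_
  have h0 : (0:ℝ) ∈ Metric.ball (0:ℝ) r := Metric.mem_ball_self (Metric.pos_of_mem_ball ht)
  exact ((convex_ball (0:ℝ) r).ordConnected).uIcc_subset h0 ht

theorem enorm_slice_average_sub_le {d : ℕ} {F : Esp d × ℝ → ℝ} (hF : ContDiff ℝ (⊤ : ℕ∞) F)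
    {m : Esp d → ℝ} (hm : Continuous m) (hmc : HasCompactSupport m) {r : ℝ} {K : ℝ≥0∞}
    (hK : ∀ y, ‖m y‖ₑ ≤ (Metric.ball (0 : Esp d) r).indicator (fun _ => K) y)
    {t : ℝ} (ht : t ∈ Metric.ball (0 : ℝ) r) :
    ‖(∫ y, F (y, t) * m y) - ∫ y, F (y, 0) * m y‖ₑ ≤
      K * ∫⁻ p in Metric.ball (0 : Esp d × ℝ) r, ‖timeDeriv F p‖ₑ := by
  have hi : ∀ t, Integrable fun y => F (y, t) * m y := fun t =>
    ((contDiff_slice_space hF t).continuous.mul hm).integrable_of_hasCompactSupport hmc.mul_left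
  have hT : Measurable fun p => ‖timeDeriv F p‖ₑ := hF.timeDeriv.continuous.measurable.enorm
  rw [← integral_sub (hi t) (hi 0)]
  calc _ ≤ ∫⁻ y, ‖F (y, t) * m y - F (y, 0) * m y‖ₑ := enorm_integral_le_lintegral_enorm _
    _ ≤ ∫⁻ y, (Metric.ball (0 : Esp d) r).indicator
          (fun y => K * ∫⁻ s in Metric.ball (0 : ℝ) r, ‖timeDeriv F (y, s)‖ₑ) y := by
        refine lintegral_mono fun y => ?_
        rw [← sub_mul, enorm_mul, mul_comm]
        refine (mul_le_mul' (hK y) (enorm_sub_slice_le hF y ht)).trans (le_of_eq ?_)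
        by_cases hy : y ∈ Metric.ball (0 : Esp d) r <;> simp only [hy, indicator_of_mem,
          not_false_eq_true, indicator_of_notMem, zero_mul]
    _ = _ := by
        rw [lintegral_indicator measurableSet_ball, lintegral_const_mul _ hT.lintegral_prod_right',
          ball_prod_eq, Measure.volume_eq_prod, ← Measure.prod_restrict,
          lintegral_prod _ hT.aemeasurable]

theorem exists_lintegral_slice_average_sub_le {d : ℕ} {m : Esp d → ℝ} (hm : Continuous m)
    (hmc : HasCompactSupport m) {r : ℝ} (hs : tsupport m ⊆ Metric.ball 0 r) {q : ℝ} (hq : 1 ≤ q) :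
    ∃ C : ℝ≥0∞, C ≠ ∞ ∧ ∀ F : Esp d × ℝ → ℝ, ContDiff ℝ (⊤ : ℕ∞) F →
      ∫⁻ p in Metric.ball (0 : Esp d × ℝ) r,
        ‖(∫ y, F (y, p.2) * m y) - ∫ y, F (y, 0) * m y‖ₑ ^ q ≤
        C * ∫⁻ p in Metric.ball (0 : Esp d × ℝ) r, ‖timeDeriv F p‖ₑ ^ q := by
  obtain ⟨K, hKt, hK⟩ := exists_enorm_le_indicator hm hmc hs
  set B := Metric.ball (0 : Esp d × ℝ) r with hB
  have hVt : volume B ≠ ∞ := measure_ball_lt_top.ne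
  refine ⟨K ^ q * volume B ^ (q - 1) * volume B, ?_, fun F hF => ?_⟩
  · exact ENNReal.mul_ne_top (ENNReal.mul_ne_top (ENNReal.rpow_ne_top_of_nonneg (by linarith) hKt)
      (ENNReal.rpow_ne_top_of_nonneg (by linarith) hVt)) hVt
  calc _ ≤ ∫⁻ p in B, (K * ∫⁻ p in B, ‖timeDeriv F p‖ₑ) ^ q := by
        refine setLIntegral_mono' measurableSet_ball fun p hp => ?_
        rw [hB, ball_prod_eq] at hp
        gcongr
        exact enorm_slice_average_sub_le hF hm hmc hK hp.2
    _ = (K * ∫⁻ p in B, ‖timeDeriv F p‖ₑ) ^ q * volume B := by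
        rw [lintegral_const, Measure.restrict_apply_univ]
    _ ≤ K ^ q * (volume B ^ (q - 1) * ∫⁻ p in B, ‖timeDeriv F p‖ₑ ^ q) * volume B := by
        rw [ENNReal.mul_rpow_of_nonneg _ _ (by linarith)]
        gcongr
        refine (lintegral_rpow_le_measure_mul hq
          hF.timeDeriv.continuous.measurable.enorm.aemeasurable).trans ?_
        rw [Measure.restrict_apply_univ]
    _ = _ := by ring

theorem exists_lintegral_le_of_slice_average {d : ℕ} {k : Esp d → ℝ} (hk : GoodK2 k) {r : ℝ}
    (hr : 1 / 2 ≤ r) {q : ℝ} (hq : 1 ≤ q) :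
    ∃ C : ℝ≥0∞, C ≠ ∞ ∧ ∀ u : Esp d × ℝ → ℝ, ContDiff ℝ (⊤ : ℕ∞) u →
      ∫⁻ p in Metric.ball (0 : Esp d × ℝ) r, ‖u p‖ₑ ^ q ≤
        C * ((∑ i, ∫⁻ p in Metric.ball (0 : Esp d × ℝ) r, ‖spaceDeriv i u p‖ₑ ^ q) +
          ∫⁻ p in Metric.ball (0 : Esp d × ℝ) r, ‖∫ y, u (y, p.2) * k y‖ₑ ^ q) := by
  obtain ⟨C, hC, H⟩ := exists_lintegral_sub_slice_average_le hk hr hq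
  have h2t : (2 : ℝ≥0∞) ^ (q - 1) ≠ ∞ :=
    ENNReal.rpow_ne_top_of_nonneg (by linarith) (by simp)
  refine ⟨2 ^ (q - 1) * (C + 1), ENNReal.mul_ne_top h2t (by simp [hC]), fun u hu => ?_⟩
  set B := Metric.ball (0 : Esp d × ℝ) r
  have hA : Measurable fun p : Esp d × ℝ => ∫ y, u (y, p.2) * k y := by
    have : StronglyMeasurable fun z : (Esp d × ℝ) × Esp d => u (z.2, z.1.2) * k z.2 := by
      refine Continuous.stronglyMeasurable ?_
      have := hk.1.continuous
      have := hu.continuous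
      fun_prop
    exact this.integral_prod_right.measurable
  calc _ ≤ ∫⁻ p in B, 2 ^ (q - 1) * (‖u p - ∫ y, u (y, p.2) * k y‖ₑ ^ q +
        ‖∫ y, u (y, p.2) * k y‖ₑ ^ q) := by
        refine lintegral_mono fun p => ?_
        refine le_trans ?_ (add_rpow_le_two_mul hq _ _)
        gcongr
        refine le_trans (le_of_eq ?_) (enorm_add_le _ _)
        rw [sub_add_cancel]
    _ = 2 ^ (q - 1) * ((∫⁻ p in B, ‖u p - ∫ y, u (y, p.2) * k y‖ₑ ^ q) +
          ∫⁻ p in B, ‖∫ y, u (y, p.2) * k y‖ₑ ^ q) := by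
        rw [lintegral_const_mul' _ _ h2t, lintegral_add_right _ (hA.enorm.pow_const q)]
    _ ≤ 2 ^ (q - 1) * ((C + 1) * (∑ i, ∫⁻ p in B, ‖spaceDeriv i u p‖ₑ ^ q) +
          (C + 1) * ∫⁻ p in B, ‖∫ y, u (y, p.2) * k y‖ₑ ^ q) := by
        gcongr
        · refine (H u hu).trans ?_
          gcongr
          exact le_self_add
        · exact le_mul_of_one_le_left' le_add_self
    _ = _ := by ring

theorem integral_spaceDeriv_mul_slice {d : ℕ} {k : Esp d → ℝ} (hk : ContDiff ℝ (⊤ : ℕ∞) k)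
    (hc : HasCompactSupport k) {v : Esp d × ℝ → ℝ} (hv : ContDiff ℝ (⊤ : ℕ∞) v) (i : Fin d)
    (t : ℝ) :
    ∫ y, spaceDeriv i v (y, t) * k y =
      -∫ y, v (y, t) * fderiv ℝ k y (EuclideanSpace.single i 1) := by
  have hvt := contDiff_slice_space hv t
  have hkd : Continuous fun y => fderiv ℝ k y (EuclideanSpace.single i 1) :=
    (hk.continuous_fderiv (by simp)).clm_apply continuous_const
  have hvd : Continuous fun y => fderiv ℝ (fun x => v (x, t)) y (EuclideanSpace.single i 1) :=
    (hvt.continuous_fderiv (by simp)).clm_apply continuous_const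
  have h := integral_mul_fderiv_eq_neg_fderiv_mul_of_integrable
    (μ := (volume : Measure (Esp d))) (f := fun y => v (y, t)) (g := k)
    (v := EuclideanSpace.single i 1)
    ((hvd.mul hk.continuous).integrable_of_hasCompactSupport hc.mul_left)
    ((hvt.continuous.mul hkd).integrable_of_hasCompactSupport (hc.fderiv_apply ℝ _).mul_left)
    ((hvt.continuous.mul hk.continuous).integrable_of_hasCompactSupport hc.mul_left)
    (fun x _ => hvt.differentiable (by simp) x) (fun x _ => hk.differentiable (by simp) x)
  rw [h, neg_neg]
  refine integral_congr_ae (Filter.Eventually.of_forall fun y => ?_)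
  simp only [(hasFDerivAt_slice_space hv y t).fderiv]
  simp [spaceDeriv]

/-- Parabolic Poincaré inequality for functions normalized at time `0`. -/
theorem exists_parabolic_poincare {d : ℕ} {k : Esp d → ℝ} (hk : GoodK2 k) {r : ℝ}
    (hr : 1 / 2 ≤ r) {q : ℝ} (hq : 1 ≤ q) :
    ∃ C : ℝ≥0∞, C ≠ ∞ ∧ ∀ v : Esp d × ℝ → ℝ, ContDiff ℝ (⊤ : ℕ∞) v →
      (∀ i, ∫ y, spaceDeriv i v (y, 0) * k y = 0) → ∫ y, v (y, 0) * k y = 0 →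
      (∫⁻ p in Metric.ball (0 : Esp d × ℝ) r, ‖v p‖ₑ ^ q) +
          ∑ i, ∫⁻ p in Metric.ball (0 : Esp d × ℝ) r, ‖spaceDeriv i v p‖ₑ ^ q ≤
        C * ∫⁻ p in Metric.ball (0 : Esp d × ℝ) r, parabolicSize v p ^ q := by
  set B := Metric.ball (0 : Esp d × ℝ) r
  have hq0 : 0 ≤ q := by linarith
  have hks : tsupport k ⊆ Metric.ball 0 r := hk.2.2.1.trans (Metric.ball_subset_ball hr)
  obtain ⟨C₁, hC₁, H₁⟩ := exists_lintegral_le_of_slice_average hk hr hq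
  obtain ⟨C₂, hC₂, H₂⟩ := exists_lintegral_slice_average_sub_le hk.1.continuous hk.2.1 hks hq
  have hder : ∀ i, ∃ C : ℝ≥0∞, C ≠ ∞ ∧ ∀ F : Esp d × ℝ → ℝ, ContDiff ℝ (⊤ : ℕ∞) F →
      ∫⁻ p in B, ‖(∫ y, F (y, p.2) * fderiv ℝ k y (EuclideanSpace.single i 1)) -
          ∫ y, F (y, 0) * fderiv ℝ k y (EuclideanSpace.single i 1)‖ₑ ^ q ≤
        C * ∫⁻ p in B, ‖timeDeriv F p‖ₑ ^ q := fun i =>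
    exists_lintegral_slice_average_sub_le
      ((hk.1.continuous_fderiv (by simp)).clm_apply continuous_const)
      (hk.2.1.fderiv_apply ℝ _)
      ((tsupport_fderiv_apply_subset ℝ _).trans hks) hq
  choose C₃ hC₃ H₃ using hder
  refine ⟨C₁ * (∑ i, C₁ * (d + C₃ i) + C₂) + ∑ i, C₁ * (d + C₃ i), ?_,
    fun v hv hv1 hv0 => ?_⟩
  · have : ∑ i, C₁ * (d + C₃ i) ≠ ∞ := ENNReal.sum_ne_top.2 fun i _ =>
      ENNReal.mul_ne_top hC₁ (by simp [hC₃ i])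
    exact ENNReal.add_ne_top.2
      ⟨ENNReal.mul_ne_top hC₁ (ENNReal.add_ne_top.2 ⟨this, hC₂⟩), this⟩
  set X := ∫⁻ p in B, parabolicSize v p ^ q
  have hT : ∫⁻ p in B, ‖timeDeriv v p‖ₑ ^ q ≤ X := by
    refine lintegral_mono fun p => ?_
    gcongr
    exact enorm_timeDeriv_le_parabolicSize v p
  have hgrad : ∀ i, ∫⁻ p in B, ‖spaceDeriv i v p‖ₑ ^ q ≤ C₁ * (d + C₃ i) * X := by
    intro i
    refine (H₁ _ (hv.spaceDeriv i)).trans ?_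
    rw [mul_assoc, add_mul]
    gcongr
    · calc _ ≤ ∑ j : Fin d, X := by
            refine Finset.sum_le_sum fun j _ => lintegral_mono fun p => ?_
            gcongr
            exact enorm_spaceDeriv_spaceDeriv_le_parabolicSize v i j p
        _ = _ := by simp
    · refine le_trans ?_ ((H₃ i v hv).trans (mul_le_mul' le_rfl hT))
      refine lintegral_mono fun p => ?_
      have h0 : ∫ y, v (y, 0) * fderiv ℝ k y (EuclideanSpace.single i 1) = 0 := by
        have := integral_spaceDeriv_mul_slice hk.1 hk.2.1 hv i 0
        rw [hv1 i] at this
        linarith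
      rw [integral_spaceDeriv_mul_slice hk.1 hk.2.1 hv i p.2, enorm_neg, h0, sub_zero]
  have hsum : ∑ i, ∫⁻ p in B, ‖spaceDeriv i v p‖ₑ ^ q ≤ (∑ i, C₁ * (d + C₃ i)) * X := by
    rw [Finset.sum_mul]
    exact Finset.sum_le_sum fun i _ => hgrad i
  rw [add_mul]
  refine add_le_add ?_ hsum
  refine (H₁ v hv).trans ?_
  rw [mul_assoc, add_mul]
  gcongr
  refine le_trans ?_ ((H₂ v hv).trans (mul_le_mul' le_rfl hT))
  refine lintegral_mono fun p => ?_
  rw [hv0, sub_zero]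

theorem fderiv_mul_apply_const {E : Type*} [NormedAddCommGroup E] [NormedSpace ℝ E]
    {η v : E → ℝ} (hη : Differentiable ℝ η) (hv : Differentiable ℝ v) (e : E) :
    (fun p => fderiv ℝ (fun p => η p * v p) p e) =
      fun p => η p * fderiv ℝ v p e + fderiv ℝ η p e * v p := by
  ext p
  rw [fderiv_fun_mul (hη p) (hv p)]
  simp [mul_comm]

theorem spaceDeriv_mul {d : ℕ} {η v : Esp d × ℝ → ℝ} (hη : Differentiable ℝ η)
    (hv : Differentiable ℝ v) (i : Fin d) :
    spaceDeriv i (fun p => η p * v p) =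
      fun p => η p * spaceDeriv i v p + spaceDeriv i η p * v p :=
  fderiv_mul_apply_const hη hv _

theorem spaceDeriv_add {d : ℕ} {η v : Esp d × ℝ → ℝ} (hη : Differentiable ℝ η)
    (hv : Differentiable ℝ v) (i : Fin d) :
    spaceDeriv i (fun p => η p + v p) = fun p => spaceDeriv i η p + spaceDeriv i v p := by
  ext p
  simp only [spaceDeriv]
  rw [fderiv_fun_add (hη p) (hv p)]
  rfl

/-- Multiplication by a cutoff function supported in `s`. -/
theorem exists_parabolicSize_mul_le {d : ℕ} {η : Esp d × ℝ → ℝ} (hη : ContDiff ℝ (⊤ : ℕ∞) η)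
    (hc : HasCompactSupport η) {s : Set (Esp d × ℝ)} (hs : tsupport η ⊆ s) :
    ∃ M : ℝ≥0∞, M ≠ ∞ ∧ ∀ v : Esp d × ℝ → ℝ, ContDiff ℝ (⊤ : ℕ∞) v → ∀ p,
      parabolicSize (fun p => η p * v p) p ≤
        s.indicator (fun p => M * (‖v p‖ₑ + ∑ i, ‖spaceDeriv i v p‖ₑ + parabolicSize v p)) p := by
  obtain ⟨K, hKt, hK⟩ := exists_enorm_le_indicator hη.continuous hc hs
  obtain ⟨T, hTt, hT⟩ := exists_enorm_le_indicator hη.timeDeriv.continuous hc.timeDeriv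
    ((tsupport_fderiv_apply_subset ℝ _).trans hs)
  choose K₁ hK₁t hK₁ using fun i => exists_enorm_le_indicator (hη.spaceDeriv i).continuous
    (hc.spaceDeriv i) ((tsupport_fderiv_apply_subset ℝ _).trans hs)
  choose K₂ hK₂t hK₂ using fun i j =>
    exists_enorm_le_indicator ((hη.spaceDeriv i).spaceDeriv j).continuous
    ((hc.spaceDeriv i).spaceDeriv j) ((tsupport_fderiv_apply_subset ℝ _).trans
      ((tsupport_fderiv_apply_subset ℝ _).trans hs))
  set M := K + T + ∑ i, K₁ i + ∑ i, ∑ j, K₂ i j with hM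
  have hMt : M ≠ ∞ := by
    simp [hM, hKt, hTt, hK₁t, hK₂t]
  refine ⟨(d * d * 4 + 2) * M, ENNReal.mul_ne_top (by finiteness) hMt, fun v hv p => ?_⟩
  have hηd : Differentiable ℝ η := hη.differentiable (by simp)
  have hvd : Differentiable ℝ v := hv.differentiable (by simp)
  have hη1 : ∀ i, Differentiable ℝ (spaceDeriv i η) := fun i =>
    (hη.spaceDeriv i).differentiable (by simp)
  have hv1 : ∀ i, Differentiable ℝ (spaceDeriv i v) := fun i =>
    (hv.spaceDeriv i).differentiable (by simp)
  have hsp : ∀ i j, spaceDeriv j (spaceDeriv i fun p => η p * v p) = fun p =>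
      (η p * spaceDeriv j (spaceDeriv i v) p + spaceDeriv j η p * spaceDeriv i v p) +
        (spaceDeriv i η p * spaceDeriv j v p + spaceDeriv j (spaceDeriv i η) p * v p) := by
    intro i j
    rw [spaceDeriv_mul hηd hvd, spaceDeriv_add (hηd.fun_mul (hv1 i)) ((hη1 i).fun_mul hvd),
      spaceDeriv_mul hηd (hv1 i), spaceDeriv_mul (hη1 i) hvd]
  have htm : timeDeriv (fun p => η p * v p) =
      fun p => η p * timeDeriv v p + timeDeriv η p * v p := fderiv_mul_apply_const hηd hvd _
  have b1 : ∀ i, K₁ i ≤ M := fun i => by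
    calc K₁ i ≤ ∑ i, K₁ i := Finset.single_le_sum (fun _ _ => zero_le) (Finset.mem_univ i)
      _ ≤ K + T + ∑ i, K₁ i := le_add_self
      _ ≤ M := le_self_add
  have b2 : ∀ i j, K₂ i j ≤ M := fun i j => by
    calc K₂ i j ≤ ∑ j, K₂ i j := Finset.single_le_sum (fun _ _ => zero_le) (Finset.mem_univ j)
      _ ≤ ∑ i, ∑ j, K₂ i j := Finset.single_le_sum (f := fun i => ∑ j, K₂ i j)
          (fun _ _ => zero_le) (Finset.mem_univ i)
      _ ≤ M := le_add_self
  have bK : K ≤ M := by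
    rw [hM, add_assoc, add_assoc]; exact le_self_add
  have bT : T ≤ M := by
    rw [hM, add_assoc, add_comm K, add_assoc]; exact le_self_add
  by_cases hp : p ∈ s
  · rw [indicator_of_mem hp]
    set G := ‖v p‖ₑ + ∑ i, ‖spaceDeriv i v p‖ₑ + parabolicSize v p with hG
    have g0 : ‖v p‖ₑ ≤ G := by rw [hG, add_assoc]; exact le_self_add
    have g1 : ∀ i, ‖spaceDeriv i v p‖ₑ ≤ G := fun i => by
      calc _ ≤ ∑ i, ‖spaceDeriv i v p‖ₑ := Finset.single_le_sum
            (f := fun i => ‖spaceDeriv i v p‖ₑ) (fun _ _ => zero_le) (Finset.mem_univ i)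
        _ ≤ ‖v p‖ₑ + ∑ i, ‖spaceDeriv i v p‖ₑ := le_add_self
        _ ≤ G := le_self_add
    have g2 : ∀ i j, ‖spaceDeriv j (spaceDeriv i v) p‖ₑ ≤ G := fun i j =>
      (enorm_spaceDeriv_spaceDeriv_le_parabolicSize v i j p).trans le_add_self
    have g3 : ‖timeDeriv v p‖ₑ ≤ G := (enorm_timeDeriv_le_parabolicSize v p).trans le_add_self
    have hK' : ‖η p‖ₑ ≤ M := (by simpa [hp] using hK p : ‖η p‖ₑ ≤ K).trans bK
    have hT' : ‖timeDeriv η p‖ₑ ≤ M := (by simpa [hp] using hT p : ‖timeDeriv η p‖ₑ ≤ T).trans bT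
    have hK₁' : ∀ i, ‖spaceDeriv i η p‖ₑ ≤ M := fun i =>
      (by simpa [hp] using hK₁ i p : ‖spaceDeriv i η p‖ₑ ≤ K₁ i).trans (b1 i)
    have hK₂' : ∀ i j, ‖spaceDeriv j (spaceDeriv i η) p‖ₑ ≤ M := fun i j =>
      (by simpa [hp] using hK₂ i j p : ‖spaceDeriv j (spaceDeriv i η) p‖ₑ ≤ K₂ i j).trans (b2 i j)
    have e1 : ∀ i j, ‖spaceDeriv j (spaceDeriv i fun p => η p * v p) p‖ₑ ≤ 4 * (M * G) := by
      intro i j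
      rw [hsp]
      calc _ ≤ (M * G + M * G) + (M * G + M * G) := by
            refine (enorm_add_le _ _).trans (add_le_add ?_ ?_) <;>
            refine (enorm_add_le _ _).trans (add_le_add ?_ ?_) <;> rw [enorm_mul]
            · exact mul_le_mul' hK' (g2 i j)
            · exact mul_le_mul' (hK₁' j) (g1 i)
            · exact mul_le_mul' (hK₁' i) (g1 j)
            · exact mul_le_mul' (hK₂' i j) g0
        _ = _ := by ring
    have e2 : ‖timeDeriv (fun p => η p * v p) p‖ₑ ≤ 2 * (M * G) := by
      rw [htm]
      calc _ ≤ M * G + M * G := by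
            refine (enorm_add_le _ _).trans (add_le_add ?_ ?_) <;> rw [enorm_mul]
            · exact mul_le_mul' hK' g3
            · exact mul_le_mul' hT' g0
        _ = _ := by ring
    calc _ ≤ (∑ i : Fin d, ∑ j : Fin d, 4 * (M * G)) + 2 * (M * G) :=
          add_le_add (Finset.sum_le_sum fun i _ => Finset.sum_le_sum fun j _ => e1 i j) e2
      _ = _ := by
          simp only [Finset.sum_const, Finset.card_univ, Fintype.card_fin, nsmul_eq_mul]
          ring
  · have z0 : η p = 0 := by simpa [hp] using hK p
    have z1 : ∀ i, spaceDeriv i η p = 0 := fun i => by simpa [hp] using hK₁ i p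
    have z2 : ∀ i j, spaceDeriv j (spaceDeriv i η) p = 0 := fun i j => by
      simpa [hp] using hK₂ i j p
    have z3 : timeDeriv η p = 0 := by simpa [hp] using hT p
    simp [parabolicSize, hsp, htm, z0, z1, z2, z3, hp]

/-- Subtracting an affine function normalizes the averages at time `0` without changing the
second-order parabolic derivatives. -/
theorem exists_normalized {d : ℕ} {k : Esp d → ℝ} (hk : GoodK2 k) {F : Esp d × ℝ → ℝ}
    (hF : ContDiff ℝ (⊤ : ℕ∞) F) :
    ∃ (v : Esp d × ℝ → ℝ) (b : Fin d → ℝ), ContDiff ℝ (⊤ : ℕ∞) v ∧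
      (∀ i p, spaceDeriv i v p = spaceDeriv i F p - b i) ∧ parabolicSize v = parabolicSize F ∧
      (∀ i, ∫ y, spaceDeriv i v (y, 0) * k y = 0) ∧ ∫ y, v (y, 0) * k y = 0 := by
  obtain ⟨hks, hkc, -, -, hk1⟩ := hk
  have hkint : Integrable k := hks.continuous.integrable_of_hasCompactSupport hkc
  have hi : ∀ u : Esp d × ℝ → ℝ, Continuous u → Integrable fun y => u (y, 0) * k y := by
    intro u hu
    have h1 : Continuous fun y => u (y, 0) := by fun_prop
    exact (h1.mul hks.continuous).integrable_of_hasCompactSupport hkc.mul_left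
  set b : Fin d → ℝ := fun i => ∫ y, spaceDeriv i F (y, 0) * k y with hb
  set L : Esp d × ℝ →L[ℝ] ℝ :=
    (∑ i, b i • (EuclideanSpace.proj i : Esp d →L[ℝ] ℝ)).comp
      (ContinuousLinearMap.fst ℝ (Esp d) ℝ) with hL
  have hLs : ∀ i, L (EuclideanSpace.single i 1, 0) = b i := by
    intro i; simp [hL]
  have hLt : L (0, 1) = 0 := by simp [hL]
  set a : ℝ := ∫ y, (F (y, 0) - L (y, 0)) * k y with ha
  have hfd : ∀ p, fderiv ℝ (fun p => F p - L p - a) p = fderiv ℝ F p - L := by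
    intro p
    rw [fderiv_sub_const, fderiv_fun_sub (hF.differentiable (by simp) p) L.differentiableAt,
      L.fderiv]
  have hsd : ∀ i, spaceDeriv i (fun p => F p - L p - a) = fun p => spaceDeriv i F p - b i := by
    intro i; ext p
    simp only [spaceDeriv, hfd, sub_apply, hLs]
  refine ⟨fun p => F p - L p - a, b, ?_, fun i p => by rw [hsd], ?_, fun i => ?_, ?_⟩
  · exact (hF.sub L.contDiff).sub contDiff_const
  · ext p
    simp only [parabolicSize, hsd]
    congr 1
    · refine Finset.sum_congr rfl fun i _ => Finset.sum_congr rfl fun j _ => ?_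
      simp only [spaceDeriv, fderiv_sub_const]
      rfl
    · simp only [timeDeriv, hfd, sub_apply, hLt, sub_zero]
  · rw [hsd]
    simp_rw [sub_mul]
    rw [integral_sub (hi _ (hF.spaceDeriv i).continuous) (hkint.const_mul _), integral_const_mul,
      hk1, mul_one, hb, sub_self]
  · have : (fun y => (F (y, 0) - L (y, 0) - a) * k y) = fun y =>
        (F (y, 0) - L (y, 0)) * k y - a * k y := by ext y; ring
    simp only [this]
    rw [integral_sub (hi (fun p => F p - L p) (hF.continuous.sub L.continuous))
      (hkint.const_mul _), integral_const_mul, hk1, mul_one, ha, sub_self]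

/-- Interior estimate: the oscillation of the spatial gradient in `L²` is controlled by the
second-order parabolic derivatives in the borderline Lebesgue space. -/
theorem exists_lintegral_lintegral_spaceDeriv_sub_le {d : ℕ} (hd : 2 ≤ d) {k : Esp d → ℝ}
    (hk : GoodK2 k) :
    ∃ C : ℝ≥0∞, C ≠ ∞ ∧ ∀ F : Esp d × ℝ → ℝ, ContDiff ℝ (⊤ : ℕ∞) F → ∀ i,
      ∫⁻ p in Metric.ball (0 : Esp d × ℝ) 1, ∫⁻ p' in Metric.ball (0 : Esp d × ℝ) 1,
          ‖spaceDeriv i F p - spaceDeriv i F p'‖ₑ ^ 2 ≤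
        C * ((∫⁻ p in Metric.ball (0 : Esp d × ℝ) (3 / 2),
          parabolicSize F p ^ (2 * d / (d + 1) : ℝ)) ^ (1 / (2 * d / (d + 1)) : ℝ)) ^ 2 := by
  have hd' : (2:ℝ) ≤ d := by exact_mod_cast hd
  set q : ℝ := 2 * d / (d + 1) with hq
  have hq1 : 1 ≤ q := (one_le_div (by linarith)).2 (by linarith)
  have hq0 : 0 ≤ q := by linarith
  set B := Metric.ball (0 : Esp d × ℝ) (3 / 2) with hB
  set B₁ := Metric.ball (0 : Esp d × ℝ) 1 with hB₁
  let η : ContDiffBump (0 : Esp d × ℝ) := ⟨1, 5 / 4, by norm_num, by norm_num⟩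
  have hηs : tsupport η ⊆ B := by
    rw [η.tsupport_eq]
    exact Metric.closedBall_subset_ball (by norm_num)
  obtain ⟨M, hMt, hM⟩ := exists_parabolicSize_mul_le (η := η) η.contDiff η.hasCompactSupport hηs
  obtain ⟨CP, hCPt, hCP⟩ := exists_parabolic_poincare hk (r := 3 / 2) (by norm_num) hq1
  obtain ⟨CE, hCEt, hCE⟩ := exists_lintegral_sq_spaceDeriv_le hd (3 / 2)
  set S : ℝ≥0∞ := M ^ q * (((d : ℝ≥0∞) + 2) ^ (q - 1) * (CP + 1)) with hS
  have hSt : S ≠ ∞ := by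
    refine ENNReal.mul_ne_top (ENNReal.rpow_ne_top_of_nonneg hq0 hMt) (ENNReal.mul_ne_top ?_ ?_)
    · exact ENNReal.rpow_ne_top_of_nonneg (by linarith) (by simp)
    · simp [hCPt]
  refine ⟨volume B₁ * (4 * (CE * (S ^ (1 / q)) ^ 2)), ?_, fun F hF i => ?_⟩
  · refine ENNReal.mul_ne_top measure_ball_lt_top.ne (ENNReal.mul_ne_top (by simp)
      (ENNReal.mul_ne_top hCEt (ENNReal.pow_ne_top ?_)))
    exact ENNReal.rpow_ne_top_of_nonneg (by positivity) hSt
  obtain ⟨v, b, hv, hvb, hvN, hv1, hv0⟩ := exists_normalized hk hF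
  have hPoinc := hCP v hv hv1 hv0
  set X := ∫⁻ p in B, parabolicSize F p ^ q with hX
  rw [hvN] at hPoinc
  set w : Esp d × ℝ → ℝ := fun p => η p * v p with hw
  have hws : ContDiff ℝ (⊤ : ℕ∞) w := η.contDiff.mul hv
  have hwc : HasCompactSupport w := η.hasCompactSupport.mul_right
  have hwt : ∀ x t, 3 / 2 ≤ |t| → w (x, t) = 0 := by
    intro x t ht
    have : η (x, t) = 0 := by
      refine image_eq_zero_of_notMem_tsupport fun h => ?_
      have := hηs h
      rw [hB, ball_prod_eq] at this
      have h2 := this.2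
      simp only [mem_ball_zero_iff, Real.norm_eq_abs] at h2
      linarith
    simp [hw, this]
  have hE := hCE w hws hwc hwt i
  have hwq : ∫⁻ p, parabolicSize w p ^ q ≤ S * X := by
    have hm0 : Measurable fun p => ‖v p‖ₑ ^ q := hv.continuous.measurable.enorm.pow_const q
    have hm1 : ∀ i, Measurable fun p => ‖spaceDeriv i v p‖ₑ ^ q := fun i =>
      (hv.spaceDeriv i).continuous.measurable.enorm.pow_const q
    have hne : M ^ q * ((d : ℝ≥0∞) + 2) ^ (q - 1) ≠ ∞ :=
      ENNReal.mul_ne_top (ENNReal.rpow_ne_top_of_nonneg hq0 hMt)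
        (ENNReal.rpow_ne_top_of_nonneg (by linarith) (by simp))
    calc _ ≤ ∫⁻ p, B.indicator (fun p => M ^ q * ((d : ℝ≥0∞) + 2) ^ (q - 1) *
          ((‖v p‖ₑ ^ q + ∑ i, ‖spaceDeriv i v p‖ₑ ^ q) + parabolicSize F p ^ q)) p := by
          refine lintegral_mono fun p => ?_
          refine (ENNReal.rpow_le_rpow (hM v hv p) hq0).trans ?_
          by_cases hp : p ∈ B
          · simp only [indicator_of_mem hp]
            rw [ENNReal.mul_rpow_of_nonneg _ _ hq0, mul_assoc]
            gcongr
            have h := sum_rpow_le_card_mul_sum (Finset.univ : Finset (Option (Option (Fin d))))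
              hq1 (fun o => o.elim (parabolicSize v p)
                (fun o => o.elim ‖v p‖ₑ (fun i => ‖spaceDeriv i v p‖ₑ)))
            simp only [Fintype.sum_option, Option.elim, Finset.card_univ, Fintype.card_option,
              Fintype.card_fin] at h
            rw [add_comm _ (parabolicSize v p), ← hvN, add_comm _ (parabolicSize v p ^ q)]
            refine h.trans (le_of_eq ?_)
            push_cast
            ring_nf
          · simp [hp, zero_lt_one.trans_le hq1]
      _ = M ^ q * ((d : ℝ≥0∞) + 2) ^ (q - 1) *
          (((∫⁻ p in B, ‖v p‖ₑ ^ q) + ∑ i, ∫⁻ p in B, ‖spaceDeriv i v p‖ₑ ^ q) + X) := by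
          rw [lintegral_indicator measurableSet_ball, lintegral_const_mul' _ _ hne,
            lintegral_add_right _ ((continuous_parabolicSize hF).measurable.pow_const q),
            lintegral_add_left hm0, lintegral_finsetSum _ fun i _ => hm1 i]
      _ ≤ M ^ q * ((d : ℝ≥0∞) + 2) ^ (q - 1) * (CP * X + X) := by gcongr
      _ = S * X := by rw [hS]; ring
  have hone : ∀ p ∈ B₁, spaceDeriv i w p = spaceDeriv i v p := by
    intro p hp
    have : w =ᶠ[nhds p] v := by
      filter_upwards [Metric.isOpen_ball.mem_nhds hp] with y hy
      have : η y = 1 := η.one_of_mem_closedBall (Metric.ball_subset_closedBall hy)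
      simp [hw, this]
    simp only [spaceDeriv, this.fderiv_eq]
  have hgm : Measurable fun p => ‖spaceDeriv i v p‖ₑ ^ 2 :=
    (hv.spaceDeriv i).continuous.measurable.enorm.pow_const 2
  have hsq : ∀ a b : ℝ≥0∞, (a + b) ^ 2 ≤ 2 * (a ^ 2 + b ^ 2) := by
    intro a b
    have := add_rpow_le_two_mul one_le_two a b
    norm_num at this
    exact this
  set Y := ∫⁻ p in B₁, ‖spaceDeriv i v p‖ₑ ^ 2 with hY
  have hYle : Y ≤ CE * (S ^ (1 / q)) ^ 2 * (X ^ (1 / q)) ^ 2 := by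
    calc Y = ∫⁻ p in B₁, ‖spaceDeriv i w p‖ₑ ^ 2 :=
          setLIntegral_congr_fun measurableSet_ball fun p hp => by rw [hone p hp]
      _ ≤ ∫⁻ p, ‖spaceDeriv i w p‖ₑ ^ 2 := setLIntegral_le_lintegral _ _
      _ ≤ _ := hE
      _ ≤ CE * ((S * X) ^ (1 / q)) ^ 2 := by gcongr
      _ = _ := by
          rw [ENNReal.mul_rpow_of_nonneg _ _ (by positivity), mul_pow]
          ring
  calc _ ≤ ∫⁻ p in B₁, ∫⁻ p' in B₁, 2 * (‖spaceDeriv i v p‖ₑ ^ 2 + ‖spaceDeriv i v p'‖ₑ ^ 2) := by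
        refine lintegral_mono fun p => lintegral_mono fun p' => ?_
        refine le_trans ?_ (hsq _ _)
        gcongr
        have : spaceDeriv i F p - spaceDeriv i F p' = spaceDeriv i v p - spaceDeriv i v p' := by
          rw [hvb, hvb]; ring
        rw [this]
        exact enorm_sub_le
    _ = volume B₁ * (4 * Y) := by
        simp_rw [lintegral_const_mul' (2 : ℝ≥0∞) _ (by simp), lintegral_add_left measurable_const,
          lintegral_const, Measure.restrict_apply_univ]
        rw [lintegral_add_right _ measurable_const, lintegral_mul_const _ hgm, lintegral_const,
          Measure.restrict_apply_univ]
        ring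
    _ ≤ volume B₁ * (4 * (CE * (S ^ (1 / q)) ^ 2 * (X ^ (1 / q)) ^ 2)) := by gcongr
    _ = _ := by ring

/-- `v` is the weak derivative of `u` in direction `e` on `V`. -/
def WeakDerivOn {d : ℕ} (V : Set (Esp d × ℝ)) (u v : Esp d × ℝ → ℝ) (e : Esp d × ℝ) : Prop :=
  ∀ φ : Esp d × ℝ → ℝ, ContDiff ℝ (⊤ : ℕ∞) φ → HasCompactSupport φ → tsupport φ ⊆ V →
    ∫ p, u p * fderiv ℝ φ p e = -∫ p, v p * φ p

/-- Convolution with the kernel `ρ`. -/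
def mollify {d : ℕ} (ρ u : Esp d × ℝ → ℝ) (p : Esp d × ℝ) : ℝ := ∫ y, ρ (p - y) * u y

/-- A smooth probability density supported near the origin. -/
structure IsMollifier {d : ℕ} (r : ℝ) (ρ : Esp d × ℝ → ℝ) : Prop where
  contDiff : ContDiff ℝ (⊤ : ℕ∞) ρ
  hasCompactSupport : HasCompactSupport ρ
  tsupport_subset : tsupport ρ ⊆ Metric.closedBall 0 r
  lintegral_eq_one : ∫⁻ p, ‖ρ p‖ₑ = 1

section mollify
variable {d : ℕ} {ρ u v : Esp d × ℝ → ℝ}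

theorem mollify_eq_convolution :
    mollify ρ u = convolution ρ u (ContinuousLinearMap.lsmul ℝ ℝ) volume := by
  ext p
  rw [convolution_lsmul_swap]
  rfl

theorem contDiff_mollify {r : ℝ} (hρ : IsMollifier r ρ) (hu : LocallyIntegrable u) :
    ContDiff ℝ (⊤ : ℕ∞) (mollify ρ u) := by
  rw [mollify_eq_convolution]
  exact hρ.hasCompactSupport.contDiff_convolution_left _ hρ.contDiff hu

theorem fderiv_mollify_apply {r : ℝ} (hρ : IsMollifier r ρ) (hu : LocallyIntegrable u)
    (p e : Esp d × ℝ) :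
    fderiv ℝ (mollify ρ u) p e = ∫ y, fderiv ℝ ρ (p - y) e * u y := by
  have h := hρ.hasCompactSupport.hasFDerivAt_convolution_left
    (ContinuousLinearMap.lsmul ℝ ℝ) (hρ.contDiff.of_le (by simp)) hu p
  have hex := (hρ.hasCompactSupport.fderiv ℝ).convolutionExists_left
    ((ContinuousLinearMap.lsmul ℝ ℝ).precompL (Esp d × ℝ))
    (hρ.contDiff.continuous_fderiv (by simp)) hu p
  rw [mollify_eq_convolution, h.fderiv, convolution_def,
    ContinuousLinearMap.integral_apply hex.integrable,
    ← integral_sub_left_eq_self (fun t => fderiv ℝ ρ (p - t) e * u t) volume p]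
  refine integral_congr_ae (Filter.Eventually.of_forall fun y => ?_)
  simp [ContinuousLinearMap.precompL_apply]

theorem fderiv_mollify_eq {r s R : ℝ} (hρ : IsMollifier r ρ) {W : Set (Esp d × ℝ)}
    (hW : Metric.ball 0 s ⊆ W) (hu : LocallyIntegrable (W.indicator u)) {e : Esp d × ℝ}
    (h : WeakDerivOn (Metric.ball 0 R) u v e) {p : Esp d × ℝ} (hps : ‖p‖ + r < s)
    (hpR : ‖p‖ + r < R) :
    fderiv ℝ (mollify ρ (W.indicator u)) p e = mollify ρ (W.indicator v) p := by
  have hnorm : ∀ y, p - y ∈ tsupport ρ → ‖y‖ ≤ ‖p‖ + r := fun y hy => by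
    have h1 := hρ.tsupport_subset hy
    rw [mem_closedBall_zero_iff] at h1
    have h2 : ‖y‖ ≤ ‖p‖ + ‖p - y‖ := by
      calc ‖y‖ = ‖p - (p - y)‖ := congrArg _ (sub_sub_cancel p y).symm
        _ ≤ _ := norm_sub_le _ _
    linarith
  have hW' : ∀ y, p - y ∈ tsupport ρ → y ∈ W := fun y hy =>
    hW (mem_ball_zero_iff.2 ((hnorm y hy).trans_lt hps))
  set ψ : Esp d × ℝ → ℝ := fun y => ρ (p - y) with hψ
  have hψd : ContDiff ℝ (⊤ : ℕ∞) ψ := hρ.contDiff.comp (contDiff_const.sub contDiff_id)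
  have hψc : HasCompactSupport ψ := hρ.hasCompactSupport.comp_homeomorph (Homeomorph.subLeft p)
  have hψs : tsupport ψ ⊆ Metric.ball 0 R := by
    have : tsupport ψ ⊆ (fun y => p - y) ⁻¹' tsupport ρ :=
      closure_minimal (fun y hy => subset_tsupport _ hy)
        ((isClosed_tsupport _).preimage (by fun_prop))
    exact fun y hy => mem_ball_zero_iff.2 ((hnorm y (this hy)).trans_lt hpR)
  have hψf : ∀ y, fderiv ℝ ψ y e = -fderiv ℝ ρ (p - y) e := by
    intro y
    have h1 : HasFDerivAt (fun y : Esp d × ℝ => p - y)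
        (-ContinuousLinearMap.id ℝ (Esp d × ℝ)) y := (hasFDerivAt_id y).const_sub p
    have h2 := (hρ.contDiff.differentiable (by simp) (p - y)).hasFDerivAt.comp y h1
    have h3 : fderiv ℝ ψ y = _ := h2.fderiv
    rw [h3]
    simp
  have hw := h ψ hψd hψc hψs
  rw [fderiv_mollify_apply hρ hu, mollify]
  have e1 : ∫ y, fderiv ℝ ρ (p - y) e * W.indicator u y = -∫ y, u y * fderiv ℝ ψ y e := by
    rw [← integral_neg]
    refine integral_congr_ae (Filter.Eventually.of_forall fun y => ?_)
    simp only [hψf]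
    by_cases hy : p - y ∈ tsupport ρ
    · rw [indicator_of_mem (hW' y hy)]; ring
    · have : fderiv ℝ ρ (p - y) = 0 :=
        image_eq_zero_of_notMem_tsupport fun h => hy (tsupport_fderiv_subset ℝ h)
      simp [this]
  rw [e1, hw, neg_neg]
  refine integral_congr_ae (Filter.Eventually.of_forall fun y => ?_)
  simp only [hψ]
  by_cases hy : p - y ∈ tsupport ρ
  · rw [indicator_of_mem (hW' y hy)]; ring
  · simp [image_eq_zero_of_notMem_tsupport hy]

theorem enorm_mollify_le (p : Esp d × ℝ) :
    ‖mollify ρ u p‖ₑ ≤ ∫⁻ y, ‖ρ (p - y)‖ₑ * ‖u y‖ₑ := by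
  refine (enorm_integral_le_lintegral_enorm _).trans (le_of_eq ?_)
  simp_rw [enorm_mul]

theorem lintegral_lintegral_kernel_rpow_le {r : ℝ} (hρ : IsMollifier r ρ)
    {N : Esp d × ℝ → ℝ≥0∞} (hN : Measurable N) {q : ℝ} (hq : 1 ≤ q) :
    ∫⁻ p, (∫⁻ y, ‖ρ (p - y)‖ₑ * N y) ^ q ≤ ∫⁻ y, N y ^ q := by
  have hm : Measurable fun z : (Esp d × ℝ) × (Esp d × ℝ) => ‖ρ (z.1 - z.2)‖ₑ := by
    have := hρ.contDiff.continuous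
    exact Continuous.measurable (by fun_prop)
  calc _ ≤ ∫⁻ p, ∫⁻ y, ‖ρ (p - y)‖ₑ * N y ^ q := by
        refine lintegral_mono fun p => lintegral_mul_rpow_le_of_lintegral_le_one hq hN
          (hm.comp measurable_prodMk_left) ?_
        rw [lintegral_sub_left_eq_self (fun y => ‖ρ y‖ₑ) p, hρ.lintegral_eq_one]
    _ = ∫⁻ y, ∫⁻ p, ‖ρ (p - y)‖ₑ * N y ^ q := by
        rw [lintegral_lintegral_swap]
        exact (hm.mul ((hN.pow_const q).comp measurable_snd)).aemeasurable
    _ = _ := by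
        refine lintegral_congr fun y => ?_
        have h1 : Measurable fun p => ‖ρ (p - y)‖ₑ := hm.comp measurable_prodMk_right
        rw [lintegral_mul_const _ h1,
          lintegral_sub_right_eq_self (fun p => ‖ρ p‖ₑ) y, hρ.lintegral_eq_one, one_mul]

end mollify

theorem exists_mollifier_seq (d : ℕ) {r : ℝ} (hr : 0 < r) :
    ∃ ρ : ℕ → Esp d × ℝ → ℝ, (∀ n, IsMollifier r (ρ n)) ∧
      ∀ u : Esp d × ℝ → ℝ, LocallyIntegrable u → ∀ᵐ p,
        Filter.Tendsto (fun n => mollify (ρ n) u p) Filter.atTop (nhds (u p)) := by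
  let φ : ℕ → ContDiffBump (0 : Esp d × ℝ) := fun n =>
    ⟨r / (2 * (n + 1)), r / (n + 1), by positivity, by
      rw [div_lt_div_iff_of_pos_left hr (by positivity) (by positivity)]
      linarith [(n.cast_nonneg : (0:ℝ) ≤ n)]⟩
  refine ⟨fun n => (φ n).normed volume, fun n => ⟨(φ n).contDiff_normed,
    (φ n).hasCompactSupport_normed, ?_, ?_⟩, fun u hu => ?_⟩
  · rw [(φ n).tsupport_normed_eq]
    refine Metric.closedBall_subset_closedBall (div_le_self hr.le ?_)
    linarith [(n.cast_nonneg : (0:ℝ) ≤ n)]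
  · exact lintegral_enorm_eq_one_of_nonneg (φ n).nonneg_normed ((φ n).integral_normed)
  · simp_rw [mollify_eq_convolution]
    refine ContDiffBump.ae_convolution_tendsto_right_of_locallyIntegrable (φ := φ) (K := 2)
      ?_ (Filter.Eventually.of_forall fun n => ?_) hu
    · exact tendsto_const_div_atTop_nhds_zero_nat r |>.comp (Filter.tendsto_add_atTop_nat 1)
        |>.congr fun n => by simp [φ]
    · simp only [φ]
      apply le_of_eq
      field_simp

theorem WeakDerivOn.ae_eq_zero_of_not_locallyIntegrableOn {d : ℕ} {V : Set (Esp d × ℝ)}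
    (hV : IsOpen V) {u v : Esp d × ℝ → ℝ} {e : Esp d × ℝ} (he : e ≠ 0)
    (h : WeakDerivOn V u v e) (hv : IntegrableOn v V) (hu : ¬ LocallyIntegrableOn u V) :
    ∀ᵐ p, p ∈ V → v p = 0 := by
  obtain ⟨x₀, hx₀, hbad⟩ : ∃ x ∈ V, ¬ IntegrableAtFilter u (nhdsWithin x V) := by
    simpa [LocallyIntegrableOn] using hu
  obtain ⟨r, hr, hrV⟩ := Metric.nhds_basis_closedBall.mem_iff.1 (hV.mem_nhds hx₀)
  obtain ⟨ℓ, hℓ⟩ := SeparatingDual.exists_eq_one (R := ℝ) he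
  let b : ContDiffBump x₀ := ⟨r / 2, r, by positivity, by linarith⟩
  set φ₀ : Esp d × ℝ → ℝ := fun p => b p * ℓ p with hφ₀
  have hφd : ContDiff ℝ (⊤ : ℕ∞) φ₀ := b.contDiff.mul ℓ.contDiff
  have hφc : HasCompactSupport φ₀ := b.hasCompactSupport.mul_right
  have hφs : tsupport φ₀ ⊆ V := (tsupport_mul_subset_left.trans b.tsupport_eq.subset).trans hrV
  have hφe : ∀ p ∈ Metric.ball x₀ (r / 2), fderiv ℝ φ₀ p e = 1 := by
    intro p hp
    have : φ₀ =ᶠ[nhds p] ℓ := by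
      filter_upwards [Metric.isOpen_ball.mem_nhds hp] with y hy
      have : b y = 1 := b.one_of_mem_closedBall (Metric.ball_subset_closedBall hy)
      simp [hφ₀, this]
    rw [this.fderiv_eq, ℓ.fderiv, hℓ]
  have hni : ¬ Integrable fun p => u p * fderiv ℝ φ₀ p e := by
    intro hi
    refine hbad ⟨Metric.ball x₀ (r / 2), mem_nhdsWithin_of_mem_nhds
      (Metric.ball_mem_nhds _ (by positivity)), ?_⟩
    refine (hi.integrableOn (s := Metric.ball x₀ (r / 2))).congr_fun (fun p hp => ?_)
      measurableSet_ball
    simp [hφe p hp]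
  have hvi : ∀ ψ : Esp d × ℝ → ℝ, Continuous ψ → HasCompactSupport ψ → tsupport ψ ⊆ V →
      Integrable fun p => v p * ψ p := by
    intro ψ hψ hc hs
    obtain ⟨c, hc⟩ := hc.exists_bound_of_continuous hψ
    refine ((hv.integrable_indicator hV.measurableSet).mul_bdd hψ.aestronglyMeasurable
      (Filter.Eventually.of_forall hc)).congr (Filter.Eventually.of_forall fun p => ?_)
    by_cases hp : p ∈ V
    · simp [hp]
    · simp [hp, image_eq_zero_of_notMem_tsupport fun h => hp (hs h)]
  refine hV.ae_eq_zero_of_integral_contDiff_smul_eq_zero hv.locallyIntegrableOn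
    fun ψ hψd hψc hψs => ?_
  simp only [smul_eq_mul]
  simp_rw [mul_comm (ψ _)]
  have hψ := h ψ hψd hψc hψs
  by_cases hi : Integrable fun p => u p * fderiv ℝ ψ p e
  · have h0 := h φ₀ hφd hφc hφs
    rw [integral_undef hni] at h0
    have h1 := h (φ₀ + ψ) (hφd.add hψd) (hφc.add hψc)
      ((tsupport_add _ _).trans (union_subset hφs hψs))
    have hadd : ∀ p, fderiv ℝ (φ₀ + ψ) p e = fderiv ℝ φ₀ p e + fderiv ℝ ψ p e := fun p => by
      rw [fderiv_add (hφd.differentiable (by simp) p) (hψd.differentiable (by simp) p)]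
      rfl
    have hni1 : ¬ Integrable fun p => u p * fderiv ℝ (φ₀ + ψ) p e := by
      intro hi1
      refine hni ((hi1.sub hi).congr (Filter.Eventually.of_forall fun p => ?_))
      simp only [Pi.sub_apply, hadd]
      ring
    rw [integral_undef hni1] at h1
    have h2 : ∫ p, v p * (φ₀ + ψ) p = (∫ p, v p * φ₀ p) + ∫ p, v p * ψ p := by
      rw [← integral_add (hvi _ hφd.continuous hφc hφs) (hvi _ hψd.continuous hψc hψs)]
      simp only [Pi.add_apply, mul_add]
    linarith
  · rw [integral_undef hi] at hψ
    linarith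

theorem lintegral_lintegral_enorm_sub_sq_le_of_tendsto {α : Type*} [MeasurableSpace α]
    {μ : Measure α} [SFinite μ] {m : ℕ → α → ℝ} (hm : ∀ n, Measurable (m n)) {u : α → ℝ}
    (hu : ∀ᵐ p ∂μ, Filter.Tendsto (fun n => m n p) Filter.atTop (nhds (u p))) {K : ℝ≥0∞}
    (h : ∀ n, ∫⁻ p, ∫⁻ p', ‖m n p - m n p'‖ₑ ^ 2 ∂μ ∂μ ≤ K) :
    ∫⁻ p, ∫⁻ p', ‖u p - u p'‖ₑ ^ 2 ∂μ ∂μ ≤ K := by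
  have hmm : ∀ n, Measurable fun z : α × α => ‖m n z.1 - m n z.2‖ₑ ^ 2 := fun n =>
    (((hm n).comp measurable_fst).sub ((hm n).comp measurable_snd)).enorm.pow_const 2
  calc _ ≤ ∫⁻ p, ∫⁻ p', Filter.liminf (fun n => ‖m n p - m n p'‖ₑ ^ 2) Filter.atTop ∂μ ∂μ := by
        refine lintegral_mono_ae ?_
        filter_upwards [hu] with p hp
        refine lintegral_mono_ae ?_
        filter_upwards [hu] with p' hp'
        refine le_of_eq (Filter.Tendsto.liminf_eq ?_).symm
        exact ((ENNReal.continuous_pow 2).comp continuous_enorm).continuousAt.tendsto.comp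
          (hp.sub hp')
    _ ≤ ∫⁻ p, Filter.liminf (fun n => ∫⁻ p', ‖m n p - m n p'‖ₑ ^ 2 ∂μ) Filter.atTop ∂μ :=
        lintegral_mono fun p => lintegral_liminf_le fun n => (hmm n).comp measurable_prodMk_left
    _ ≤ Filter.liminf (fun n => ∫⁻ p, ∫⁻ p', ‖m n p - m n p'‖ₑ ^ 2 ∂μ ∂μ) Filter.atTop :=
        lintegral_liminf_le fun n => (hmm n).lintegral_prod_right'
    _ ≤ K := Filter.liminf_le_of_frequently_le' (Filter.Frequently.of_forall h)

/-- Poincaré-type inequality for the gradient of a function with weak parabolic derivatives. -/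
theorem exists_lintegral_lintegral_weakGrad_sub_le {d : ℕ} (hd : 2 ≤ d) {k : Esp d → ℝ}
    (hk : GoodK2 k) :
    ∃ C : ℝ≥0∞, C ≠ ∞ ∧ ∀ (f : Esp d × ℝ → ℝ) (D : Fin d → Esp d × ℝ → ℝ)
      (H : Fin d → Fin d → Esp d × ℝ → ℝ) (τ : Esp d × ℝ → ℝ),
      (∀ i j, Measurable (H i j)) → Measurable τ →
      (∀ i, IntegrableOn (D i) (Metric.ball 0 2)) →
      (∀ i, WeakDerivOn (Metric.ball 0 2) f (D i) (EuclideanSpace.single i 1, 0)) →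
      (∀ i j, WeakDerivOn (Metric.ball 0 2) (D i) (H i j) (EuclideanSpace.single j 1, 0)) →
      WeakDerivOn (Metric.ball 0 2) f τ (0, 1) → ∀ i,
      ∫⁻ p in Metric.ball (0 : Esp d × ℝ) 1, ∫⁻ p' in Metric.ball (0 : Esp d × ℝ) 1,
        ‖D i p - D i p'‖ₑ ^ 2 ≤
      C * ((∫⁻ p in Metric.ball (0 : Esp d × ℝ) 2,
        ((∑ i, ∑ j, ‖H i j p‖ₑ) + ‖τ p‖ₑ) ^ (2 * d / (d + 1) : ℝ)) ^
          (1 / (2 * d / (d + 1)) : ℝ)) ^ 2 := by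
  have hd' : (2:ℝ) ≤ d := by exact_mod_cast hd
  obtain ⟨C, hC, HC⟩ := exists_lintegral_lintegral_spaceDeriv_sub_le hd hk
  refine ⟨C, hC, fun f D H τ hHm hτm hD hfD hDH hfτ i => ?_⟩
  set q : ℝ := 2 * d / (d + 1) with hq
  have hq1 : 1 ≤ q := by rw [hq, le_div_iff₀ (by positivity)]; linarith
  have hq0 : 0 ≤ q := by linarith
  set V : Set (Esp d × ℝ) := Metric.ball 0 2
  set W : Set (Esp d × ℝ) := Metric.ball 0 (15 / 8)
  have hWV : Metric.closedBall (0 : Esp d × ℝ) (15 / 8) ⊆ V :=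
    Metric.closedBall_subset_ball (by norm_num)
  have hWV' : W ⊆ V := Metric.ball_subset_closedBall.trans hWV
  have h1W : Metric.ball (0 : Esp d × ℝ) 1 ⊆ W := Metric.ball_subset_ball (by norm_num)
  by_cases hf : LocallyIntegrableOn f V
  swap
  · have h0 := (hfD i).ae_eq_zero_of_not_locallyIntegrableOn Metric.isOpen_ball
      (by simp) (hD i) hf
    have h1 : ∀ᵐ p ∂volume.restrict (Metric.ball (0 : Esp d × ℝ) 1), D i p = 0 := by
      rw [ae_restrict_iff' measurableSet_ball]
      filter_upwards [h0] with p hp hp1 using hp (hWV' (h1W hp1))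
    refine le_trans (le_of_eq ?_) zero_le
    rw [lintegral_eq_zero_of_ae_eq_zero]
    filter_upwards [h1] with p hp
    refine lintegral_eq_zero_of_ae_eq_zero ?_
    filter_upwards [h1] with p' hp'
    simp [hp, hp']
  have hfW : LocallyIntegrable (W.indicator f) :=
    ((integrable_indicator_iff measurableSet_ball).2
      ((hf.integrableOn_compact_subset hWV (isCompact_closedBall _ _)).mono_set
        Metric.ball_subset_closedBall)).locallyIntegrable
  have hDW : ∀ i, LocallyIntegrable (W.indicator (D i)) := fun i =>
    ((integrable_indicator_iff measurableSet_ball).2 ((hD i).mono_set hWV')).locallyIntegrable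
  obtain ⟨ρ, hρ, hlim⟩ := exists_mollifier_seq d (r := 1 / 8) (by norm_num)
  set N : Esp d × ℝ → ℝ≥0∞ := fun p => (∑ i, ∑ j, ‖H i j p‖ₑ) + ‖τ p‖ₑ with hN
  have hNm : Measurable N := by
    refine Measurable.add ?_ hτm.enorm
    exact Finset.measurable_fun_sum _ fun i _ => Finset.measurable_fun_sum _ fun j _ =>
      (hHm i j).enorm
  set F : ℕ → Esp d × ℝ → ℝ := fun n => mollify (ρ n) (W.indicator f)
  have hFd : ∀ n, ContDiff ℝ (⊤ : ℕ∞) (F n) := fun n => contDiff_mollify (hρ n) hfW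
  have hFD : ∀ n i, ∀ p ∈ Metric.ball (0 : Esp d × ℝ) (3 / 2),
      spaceDeriv i (F n) p = mollify (ρ n) (W.indicator (D i)) p := by
    intro n i p hp
    rw [mem_ball_zero_iff] at hp
    exact fderiv_mollify_eq (hρ n) subset_rfl hfW (hfD i) (by linarith) (by linarith)
  have hFH : ∀ n i j, ∀ p ∈ Metric.ball (0 : Esp d × ℝ) (3 / 2),
      spaceDeriv j (spaceDeriv i (F n)) p = mollify (ρ n) (W.indicator (H i j)) p := by
    intro n i j p hp
    have : spaceDeriv i (F n) =ᶠ[nhds p] mollify (ρ n) (W.indicator (D i)) := by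
      filter_upwards [Metric.isOpen_ball.mem_nhds hp] with y hy using hFD n i y hy
    rw [mem_ball_zero_iff] at hp
    rw [spaceDeriv, this.fderiv_eq]
    exact fderiv_mollify_eq (hρ n) subset_rfl (hDW i) (hDH i j) (by linarith) (by linarith)
  have hFτ : ∀ n, ∀ p ∈ Metric.ball (0 : Esp d × ℝ) (3 / 2),
      timeDeriv (F n) p = mollify (ρ n) (W.indicator τ) p := by
    intro n p hp
    rw [mem_ball_zero_iff] at hp
    exact fderiv_mollify_eq (hρ n) subset_rfl hfW hfτ (by linarith) (by linarith)
  have hsize : ∀ n, ∀ p ∈ Metric.ball (0 : Esp d × ℝ) (3 / 2),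
      parabolicSize (F n) p ≤ ∫⁻ y, ‖ρ n (p - y)‖ₑ * W.indicator N y := by
    intro n p hp
    have hkm : Measurable fun y => ‖ρ n (p - y)‖ₑ := by
      have := (hρ n).contDiff.continuous
      exact Continuous.measurable (by fun_prop)
    have hind : ∀ g : Esp d × ℝ → ℝ, Measurable g →
        Measurable fun y => ‖ρ n (p - y)‖ₑ * ‖W.indicator g y‖ₑ := fun g hg =>
      hkm.mul (hg.indicator measurableSet_ball).enorm
    rw [parabolicSize, hFτ n p hp]
    calc _ ≤ (∑ i, ∑ j, ∫⁻ y, ‖ρ n (p - y)‖ₑ * ‖W.indicator (H i j) y‖ₑ) +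
          ∫⁻ y, ‖ρ n (p - y)‖ₑ * ‖W.indicator τ y‖ₑ := by
          refine add_le_add (Finset.sum_le_sum fun i _ => Finset.sum_le_sum fun j _ => ?_)
            (enorm_mollify_le p)
          rw [hFH n i j p hp]
          exact enorm_mollify_le p
      _ = ∫⁻ y, ((∑ i, ∑ j, ‖ρ n (p - y)‖ₑ * ‖W.indicator (H i j) y‖ₑ) +
          ‖ρ n (p - y)‖ₑ * ‖W.indicator τ y‖ₑ) := by
          rw [lintegral_add_right _ (hind τ hτm), lintegral_finsetSum _ fun i _ =>
            Finset.measurable_fun_sum _ fun j _ => hind _ (hHm i j)]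
          simp_rw [lintegral_finsetSum _ fun j _ => hind _ (hHm _ j)]
      _ = _ := by
          refine lintegral_congr fun y => ?_
          by_cases hy : y ∈ W
          · simp only [indicator_of_mem hy, hN, mul_add, Finset.mul_sum]
          · simp [hy]
  have hbound : ∀ n, ∫⁻ p in Metric.ball (0 : Esp d × ℝ) 1,
      ∫⁻ p' in Metric.ball (0 : Esp d × ℝ) 1,
        ‖mollify (ρ n) (W.indicator (D i)) p - mollify (ρ n) (W.indicator (D i)) p'‖ₑ ^ 2 ≤
      C * ((∫⁻ p in V, N p ^ q) ^ (1 / q)) ^ 2 := by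
    intro n
    have h13 : Metric.ball (0 : Esp d × ℝ) 1 ⊆ Metric.ball 0 (3 / 2) :=
      Metric.ball_subset_ball (by norm_num)
    calc _ = ∫⁻ p in Metric.ball (0 : Esp d × ℝ) 1, ∫⁻ p' in Metric.ball (0 : Esp d × ℝ) 1,
          ‖spaceDeriv i (F n) p - spaceDeriv i (F n) p'‖ₑ ^ 2 := by
          refine setLIntegral_congr_fun measurableSet_ball fun p hp => ?_
          refine setLIntegral_congr_fun measurableSet_ball fun p' hp' => ?_
          rw [hFD n i p (h13 hp), hFD n i p' (h13 hp')]
      _ ≤ _ := HC (F n) (hFd n) i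
      _ ≤ _ := by
          gcongr C * (?_ ^ (1 / q)) ^ 2
          calc _ ≤ ∫⁻ p in Metric.ball (0 : Esp d × ℝ) (3 / 2),
                (∫⁻ y, ‖ρ n (p - y)‖ₑ * W.indicator N y) ^ q :=
                setLIntegral_mono' measurableSet_ball fun p hp =>
                  ENNReal.rpow_le_rpow (hsize n p hp) hq0
            _ ≤ ∫⁻ p, (∫⁻ y, ‖ρ n (p - y)‖ₑ * W.indicator N y) ^ q :=
                setLIntegral_le_lintegral _ _
            _ ≤ ∫⁻ y, (W.indicator N y) ^ q :=
                lintegral_lintegral_kernel_rpow_le (hρ n) (hNm.indicator measurableSet_ball) hq1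
            _ = ∫⁻ y in W, N y ^ q := by
                rw [← lintegral_indicator (s := W) measurableSet_ball]
                refine lintegral_congr fun y => ?_
                by_cases hy : y ∈ W
                · simp [hy]
                · simp [hy, zero_lt_one.trans_le hq1]
            _ ≤ _ := lintegral_mono_set hWV'
  refine lintegral_lintegral_enorm_sub_sq_le_of_tendsto
    (fun n => (contDiff_mollify (hρ n) (hDW i)).continuous.measurable) ?_ hbound
  rw [ae_restrict_iff' measurableSet_ball]
  filter_upwards [hlim _ (hDW i)] with p hp hp1
  rwa [indicator_of_mem (h1W hp1)] at hp

/-- The parabolic dilation `(z, s) ↦ (ε z, ε² s)`. -/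
def pscale {d : ℕ} (ε : ℝ) : Esp d × ℝ →L[ℝ] Esp d × ℝ :=
  (ε • ContinuousLinearMap.id ℝ (Esp d)).prodMap (ε ^ 2 • ContinuousLinearMap.id ℝ ℝ)

section pscale
variable {d : ℕ} {ε : ℝ}

theorem pscale_apply (p : Esp d × ℝ) : pscale ε p = (ε • p.1, ε ^ 2 * p.2) := rfl

theorem pscale_inv_pscale (hε : ε ≠ 0) (p : Esp d × ℝ) : pscale ε⁻¹ (pscale ε p) = p := by
  ext <;> simp [pscale_apply, hε]

theorem pscale_pscale_inv (hε : ε ≠ 0) (p : Esp d × ℝ) : pscale ε (pscale ε⁻¹ p) = p := by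
  ext <;> simp [pscale_apply, hε]

theorem measurableEmbedding_pscale (hε : ε ≠ 0) :
    MeasurableEmbedding (pscale ε : Esp d × ℝ → Esp d × ℝ) :=
  Continuous.measurableEmbedding (pscale ε).continuous
    (Function.LeftInverse.injective (pscale_inv_pscale hε))

theorem measurableEmbedding_add_pscale (hε : ε ≠ 0) (c : Esp d × ℝ) :
    MeasurableEmbedding fun ξ : Esp d × ℝ => c + pscale ε ξ :=
  (measurableEmbedding_addLeft c).comp (measurableEmbedding_pscale hε)

theorem exists_map_add_pscale (hε : ε ≠ 0) :
    ∃ J : ℝ≥0∞, J ≠ ∞ ∧ ∀ c : Esp d × ℝ,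
      Measure.map (fun ξ => c + pscale ε ξ) volume = J • volume := by
  have hdet : LinearMap.det ((pscale ε : Esp d × ℝ →L[ℝ] Esp d × ℝ) :
      Esp d × ℝ →ₗ[ℝ] Esp d × ℝ) ≠ 0 := by
    let L : (Esp d × ℝ) ≃ₗ[ℝ] Esp d × ℝ := LinearEquiv.ofBijective
      ((pscale ε : Esp d × ℝ →L[ℝ] Esp d × ℝ) : Esp d × ℝ →ₗ[ℝ] Esp d × ℝ)
      ⟨Function.LeftInverse.injective (pscale_inv_pscale hε),
        Function.RightInverse.surjective (pscale_pscale_inv hε)⟩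
    exact (LinearEquiv.isUnit_det' L).ne_zero
  obtain ⟨r, hmap⟩ : ∃ r : ℝ, Measure.map (pscale ε : Esp d × ℝ → Esp d × ℝ) volume =
      ENNReal.ofReal r • volume :=
    ⟨_, Measure.map_linearMap_addHaar_eq_smul_addHaar (volume : Measure (Esp d × ℝ)) hdet⟩
  refine ⟨ENNReal.ofReal r, ENNReal.ofReal_ne_top, fun c => ?_⟩
  rw [show (fun ξ => c + pscale ε ξ) = (fun p => c + p) ∘ (pscale ε : Esp d × ℝ → Esp d × ℝ) from
    rfl, ← Measure.map_map (measurable_const_add c) (pscale ε).measurable,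
    hmap, Measure.map_smul, map_add_left_eq_self]

theorem exists_integral_comp_pscale (hε : ε ≠ 0) :
    ∃ J : ℝ, ∀ (F : Esp d × ℝ → ℝ) (c : Esp d × ℝ),
      ∫ ξ, F (c + pscale ε ξ) = J * ∫ p, F p := by
  obtain ⟨J, -, hJ⟩ := exists_map_add_pscale (d := d) hε
  refine ⟨J.toReal, fun F c => ?_⟩
  rw [← (measurableEmbedding_add_pscale hε c).integral_map, hJ, integral_smul_measure, smul_eq_mul]

theorem MeasureTheory.IntegrableOn.comp_pscale (hε : ε ≠ 0) {U V : Set (Esp d × ℝ)}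
    {F : Esp d × ℝ → ℝ} (hF : IntegrableOn F U) {c : Esp d × ℝ}
    (hsub : ∀ ξ ∈ V, c + pscale ε ξ ∈ U) : IntegrableOn (fun ξ => F (c + pscale ε ξ)) V := by
  obtain ⟨J, hJ, hmap⟩ := exists_map_add_pscale (d := d) hε
  refine IntegrableOn.mono_set (t := (fun ξ => c + pscale ε ξ) ⁻¹' U) ?_ hsub
  refine ((measurableEmbedding_add_pscale hε c).integrableOn_map_iff (f := F)).1 ?_
  rw [hmap c, IntegrableOn, Measure.restrict_smul]
  exact hF.smul_measure hJ

theorem WeakDerivOn.const_mul {V : Set (Esp d × ℝ)} {u v : Esp d × ℝ → ℝ} {e : Esp d × ℝ}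
    (h : WeakDerivOn V u v e) (a : ℝ) :
    WeakDerivOn V (fun p => a * u p) (fun p => a * v p) e := by
  intro φ hφ hc hs
  simp_rw [mul_assoc, integral_const_mul, h φ hφ hc hs]
  ring

theorem IsWeakDerivST.weakDerivOn_comp_pscale {U : Set (Esp d × ℝ)} {u v : Esp d → ℝ → ℝ}
    {e : Esp d × ℝ} (h : IsWeakDerivST U u v e) (hε : ε ≠ 0) {c : Esp d × ℝ} {a : ℝ}
    (ha : a ≠ 0) (he : pscale ε e = a • e) {V : Set (Esp d × ℝ)}
    (hsub : ∀ ξ ∈ V, c + pscale ε ξ ∈ U) :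
    WeakDerivOn V (fun ξ => u (c + pscale ε ξ).1 (c + pscale ε ξ).2)
      (fun ξ => a * v (c + pscale ε ξ).1 (c + pscale ε ξ).2) e := by
  intro φ hφ hc hs
  obtain ⟨J, hJ⟩ := exists_integral_comp_pscale (d := d) hε
  set B : Esp d × ℝ → Esp d × ℝ := fun p => pscale ε⁻¹ (p - c) with hB
  set ψ : Esp d × ℝ → ℝ := fun p => φ (B p) with hψ
  have hBA : ∀ ξ, B (c + pscale ε ξ) = ξ := fun ξ => by
    simp only [hB, add_sub_cancel_left, pscale_inv_pscale hε]
  have hAB : ∀ p, c + pscale ε (B p) = p := fun p => by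
    simp only [hB, pscale_pscale_inv hε, add_sub_cancel]
  have hBd : ContDiff ℝ (⊤ : ℕ∞) B := (pscale ε⁻¹).contDiff.comp (contDiff_id.sub contDiff_const)
  let A : Esp d × ℝ ≃ₜ Esp d × ℝ :=
    { toFun := B
      invFun := fun ξ => c + pscale ε ξ
      left_inv := hAB
      right_inv := hBA
      continuous_toFun := hBd.continuous
      continuous_invFun := by fun_prop }
  have hψd : ContDiff ℝ (⊤ : ℕ∞) ψ := hφ.comp hBd
  have hψc : HasCompactSupport ψ := hc.comp_homeomorph A
  have hψs : tsupport ψ ⊆ U := by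
    have : tsupport ψ ⊆ B ⁻¹' tsupport φ :=
      closure_minimal (fun y hy => subset_tsupport _ hy)
        ((isClosed_tsupport _).preimage hBd.continuous)
    intro p hp
    rw [← hAB p]
    exact hsub _ (hs (this hp))
  have hinv : pscale ε⁻¹ e = a⁻¹ • e := by
    rw [eq_inv_smul_iff₀ ha, ← map_smul, ← he, pscale_inv_pscale hε]
  have hψf : ∀ p, fderiv ℝ ψ p e = a⁻¹ * fderiv ℝ φ (B p) e := by
    intro p
    have h1 : HasFDerivAt B (pscale ε⁻¹) p := by
      have : HasFDerivAt B ((pscale ε⁻¹).comp (ContinuousLinearMap.id ℝ (Esp d × ℝ))) p :=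
        (pscale (d := d) ε⁻¹).hasFDerivAt.comp p ((hasFDerivAt_id p).sub_const c)
      rwa [ContinuousLinearMap.comp_id] at this
    have h2 := (hφ.differentiable (by simp) (B p)).hasFDerivAt.comp p h1
    have h3 : fderiv ℝ ψ p = _ := h2.fderiv
    rw [h3, ContinuousLinearMap.comp_apply, hinv, map_smul, smul_eq_mul]
  have hw := h ψ hψd hψc hψs
  rw [setIntegral_eq_integral_of_forall_compl_eq_zero,
    setIntegral_eq_integral_of_forall_compl_eq_zero] at hw
  rotate_left
  · intro p hp
    rw [image_eq_zero_of_notMem_tsupport fun h => hp (hψs h), mul_zero]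
  · intro p hp
    have : fderiv ℝ ψ p = 0 :=
      image_eq_zero_of_notMem_tsupport fun h => hp (hψs (tsupport_fderiv_subset ℝ h))
    simp [this]
  have e1 := hJ (fun w => u w.1 w.2 * fderiv ℝ ψ w e) c
  have e2 := hJ (fun w => v w.1 w.2 * ψ w) c
  simp only [hψf, hBA] at e1 hw
  simp only [hψ, hBA] at e2 hw
  have e3 : ∀ ξ, u (c + pscale ε ξ).1 (c + pscale ε ξ).2 * fderiv ℝ φ ξ e =
      a * (u (c + pscale ε ξ).1 (c + pscale ε ξ).2 * (a⁻¹ * fderiv ℝ φ ξ e)) := fun ξ => by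
    field_simp
  simp_rw [mul_assoc a, integral_const_mul, e2, e3, integral_const_mul, e1, hw]
  ring

theorem exists_lintegral_lintegral_pscale_weakGrad_sub_le {d : ℕ} (hd : 2 ≤ d) {k : Esp d → ℝ}
    (hk : GoodK2 k) :
    ∃ C : ℝ≥0∞, C ≠ ∞ ∧ ∀ (U : Set (Esp d × ℝ)) (f : Esp d → ℝ → ℝ) (D : Fin d → Esp d → ℝ → ℝ)
      (H : Fin d → Fin d → Esp d → ℝ → ℝ) (τ : Esp d → ℝ → ℝ),
      (∀ i j, Measurable fun w : Esp d × ℝ => H i j w.1 w.2) →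
      (Measurable fun w : Esp d × ℝ => τ w.1 w.2) →
      (∀ i, IntegrableOn (fun w : Esp d × ℝ => D i w.1 w.2) U) →
      (∀ i, IsWeakDerivST U f (D i) (EuclideanSpace.single i 1, 0)) →
      (∀ i j, IsWeakDerivST U (D i) (H i j) (EuclideanSpace.single j 1, 0)) →
      IsWeakDerivST U f τ (0, 1) → ∀ ε : ℝ, 0 < ε → ∀ c : Esp d × ℝ,
      (∀ ξ ∈ Metric.ball (0 : Esp d × ℝ) 2, c + pscale ε ξ ∈ U) → ∀ i,
      ∫⁻ p in Metric.ball (0 : Esp d × ℝ) 1, ∫⁻ p' in Metric.ball (0 : Esp d × ℝ) 1,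
        ‖D i (c + pscale ε p).1 (c + pscale ε p).2 -
          D i (c + pscale ε p').1 (c + pscale ε p').2‖ₑ ^ 2 ≤
      C * (ENNReal.ofReal ε * (∫⁻ p in Metric.ball (0 : Esp d × ℝ) 2,
        ((∑ i, ∑ j, ‖H i j (c + pscale ε p).1 (c + pscale ε p).2‖ₑ) +
          ‖τ (c + pscale ε p).1 (c + pscale ε p).2‖ₑ) ^ (2 * d / (d + 1) : ℝ)) ^
          (1 / (2 * d / (d + 1)) : ℝ)) ^ 2 := by
  obtain ⟨C, hC, HC⟩ := exists_lintegral_lintegral_weakGrad_sub_le hd hk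
  refine ⟨C, hC, fun U f D H τ hHm hτm hD hfD hDH hfτ ε hε c hsub i => ?_⟩
  set q : ℝ := 2 * d / (d + 1) with hq
  have hq0 : 0 < q := by
    have : (0:ℝ) < d := by exact_mod_cast (by omega : 0 < d)
    positivity
  set A : Esp d × ℝ → Esp d × ℝ := fun ξ => c + pscale ε ξ with hA
  have hAm : MeasurableEmbedding A :=
    measurableEmbedding_add_pscale hε.ne' c
  have hsx : ∀ i, pscale ε (EuclideanSpace.single i 1, (0:ℝ)) =
      ε • ((EuclideanSpace.single i 1, 0) : Esp d × ℝ) := fun i => by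
    simp [pscale_apply]
  have hst : pscale ε ((0 : Esp d), (1:ℝ)) = (ε ^ 2) • ((0, 1) : Esp d × ℝ) := by
    simp [pscale_apply]
  have hDi : ∀ i, IntegrableOn (fun ξ => ε * D i (A ξ).1 (A ξ).2) (Metric.ball 0 2) := fun i =>
    Integrable.const_mul ((hD i).comp_pscale hε.ne' hsub) ε
  have h := HC (fun ξ => f (A ξ).1 (A ξ).2) (fun i ξ => ε * D i (A ξ).1 (A ξ).2)
    (fun i j ξ => ε * (ε * H i j (A ξ).1 (A ξ).2)) (fun ξ => ε ^ 2 * τ (A ξ).1 (A ξ).2)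
    (fun i j => (((hHm i j).comp hAm.measurable).const_mul ε).const_mul ε)
    ((hτm.comp hAm.measurable).const_mul _) hDi
    (fun i => (hfD i).weakDerivOn_comp_pscale hε.ne' hε.ne' (hsx i) hsub)
    (fun i j => ((hDH i j).weakDerivOn_comp_pscale hε.ne' hε.ne' (hsx j) hsub).const_mul ε)
    (hfτ.weakDerivOn_comp_pscale hε.ne' (by positivity) hst hsub) i
  set a := ENNReal.ofReal ε with ha
  have ha0 : a ≠ 0 := by simpa [ha] using hε
  have hat : a ≠ ∞ := ENNReal.ofReal_ne_top
  have hεa : ‖ε‖ₑ = a := Real.enorm_of_nonneg hε.le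
  have hN : ∀ ξ, (∑ i, ∑ j, ‖ε * (ε * H i j (A ξ).1 (A ξ).2)‖ₑ) + ‖ε ^ 2 * τ (A ξ).1 (A ξ).2‖ₑ =
      a ^ 2 * ((∑ i, ∑ j, ‖H i j (A ξ).1 (A ξ).2‖ₑ) + ‖τ (A ξ).1 (A ξ).2‖ₑ) := fun ξ => by
    simp only [enorm_mul, enorm_pow, hεa, ← mul_assoc, ← sq, ← Finset.mul_sum, mul_add]
  simp only [hN] at h
  simp only [← mul_sub, enorm_mul, hεa, mul_pow] at h
  rw [← ENNReal.mul_le_mul_iff_right (pow_ne_zero 2 ha0) (ENNReal.pow_ne_top (n := 2) hat)]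
  simp only [ENNReal.mul_rpow_of_nonneg _ _ hq0.le] at h
  simp_rw [lintegral_const_mul' _ _ (ENNReal.pow_ne_top (n := 2) hat)] at h
  rw [lintegral_const_mul' _ _ (ENNReal.rpow_ne_top_of_nonneg hq0.le
    (ENNReal.pow_ne_top (n := 2) hat)), ENNReal.mul_rpow_of_nonneg _ _ (by positivity),
    ← ENNReal.rpow_mul, mul_one_div_cancel hq0.ne', ENNReal.rpow_one] at h
  refine h.trans (le_of_eq ?_)
  ring

end pscale

/-- The space-time kernel `(z, s) ↦ φ₂(z) φ₁(s)`. -/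
def prodKernel {d : ℕ} (φ₁ : ℝ → ℝ) (φ₂ : Esp d → ℝ) (ξ : Esp d × ℝ) : ℝ := φ₂ ξ.1 * φ₁ ξ.2

section smoothing
variable {d : ℕ} {φ₁ : ℝ → ℝ} {φ₂ : Esp d → ℝ} {ε : ℝ}

theorem continuous_prodKernel (hφ₁ : GoodK1 φ₁) (hφ₂ : GoodK2 φ₂) :
    Continuous (prodKernel φ₁ φ₂) :=
  (hφ₂.1.continuous.comp continuous_fst).mul (hφ₁.1.continuous.comp continuous_snd)

theorem exists_enorm_prodKernel_le (hφ₁ : GoodK1 φ₁) (hφ₂ : GoodK2 φ₂) :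
    ∃ K : ℝ≥0∞, K ≠ ∞ ∧ ∀ ξ, ‖prodKernel φ₁ φ₂ ξ‖ₑ ≤
      (Metric.ball (0 : Esp d × ℝ) (1 / 2)).indicator (fun _ => K) ξ := by
  obtain ⟨K₁, hK₁, h₁⟩ := exists_enorm_le_indicator hφ₁.1.continuous hφ₁.2.1 hφ₁.2.2.1
  obtain ⟨K₂, hK₂, h₂⟩ := exists_enorm_le_indicator hφ₂.1.continuous hφ₂.2.1 hφ₂.2.2.1
  refine ⟨K₂ * K₁, ENNReal.mul_ne_top hK₂ hK₁, fun ξ => ?_⟩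
  rw [prodKernel, enorm_mul]
  refine (mul_le_mul' (h₂ ξ.1) (h₁ ξ.2)).trans ?_
  rw [ball_prod_eq, Real.ball_eq_Ioo]
  by_cases hξ : ξ.1 ∈ Metric.ball (0 : Esp d) (1 / 2)
  · by_cases hξ' : ξ.2 ∈ Ioo (-(1 / 2) : ℝ) (1 / 2)
    · rw [indicator_of_mem hξ, indicator_of_mem hξ', indicator_of_mem]
      exact ⟨hξ, by simpa using hξ'⟩
    · rw [indicator_of_notMem hξ', mul_zero]
      exact zero_le
  · rw [indicator_of_notMem hξ, zero_mul]
    exact zero_le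

theorem lintegral_enorm_prodKernel (hφ₁ : GoodK1 φ₁) (hφ₂ : GoodK2 φ₂) :
    ∫⁻ ξ, ‖prodKernel φ₁ φ₂ ξ‖ₑ = 1 := by
  simp only [prodKernel, enorm_mul]
  rw [show (volume : Measure (Esp d × ℝ)) = (volume : Measure (Esp d)).prod volume from rfl,
    lintegral_prod_mul hφ₂.1.continuous.enorm.aemeasurable hφ₁.1.continuous.enorm.aemeasurable,
    lintegral_enorm_eq_one_of_nonneg hφ₁.2.2.2.1 hφ₁.2.2.2.2,
    lintegral_enorm_eq_one_of_nonneg hφ₂.2.2.2.1 hφ₂.2.2.2.2, one_mul]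

theorem integral_prodKernel (hφ₁ : GoodK1 φ₁) (hφ₂ : GoodK2 φ₂) :
    ∫ ξ, prodKernel φ₁ φ₂ ξ = 1 := by
  simp only [prodKernel]
  rw [show (volume : Measure (Esp d × ℝ)) = (volume : Measure (Esp d)).prod volume from rfl,
    integral_prod_mul, hφ₁.2.2.2.2, hφ₂.2.2.2.2, one_mul]

theorem S2_eq (hε : 0 < ε) (F : Esp d → ℝ → ℝ) (x : Esp d) (t : ℝ) :
    S2 φ₁ φ₂ ε F x t =
      ∫ s : ℝ, (∫ z : Esp d, F (x - ε • z) (t - ε ^ 2 * s) * φ₂ z) * φ₁ s := by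
  have hx : ∀ t, Sx2 φ₂ ε F x t = ∫ z : Esp d, F (x - ε • z) t * φ₂ z := by
    intro t
    have := Measure.integral_comp_smul (volume : Measure (Esp d))
      (fun z => F (x - z) t * φ₂ (ε⁻¹ • z)) ε
    simp only [inv_smul_smul₀ hε.ne', finrank_euclideanSpace, Fintype.card_fin] at this
    rw [this, abs_of_pos (by positivity), smul_eq_mul, ← integral_const_mul, Sx2]
    refine integral_congr_ae (Filter.Eventually.of_forall fun z => ?_)
    simp only
    ring
  have := Measure.integral_comp_mul_left
    (fun s => Sx2 φ₂ ε F x (t - s) * φ₁ (s / ε ^ 2)) (ε ^ 2)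
  simp only [mul_div_cancel_left₀ _ (pow_ne_zero 2 hε.ne')] at this
  simp_rw [← hx]
  rw [this, abs_of_pos (by positivity), smul_eq_mul, ← integral_const_mul, S2, St2]
  refine integral_congr_ae (Filter.Eventually.of_forall fun z => ?_)
  simp only
  ring

theorem enorm_S2_le (hε : 0 < ε) (hφ₁ : GoodK1 φ₁) (hφ₂ : GoodK2 φ₂) {F : Esp d → ℝ → ℝ}
    (hF : Measurable fun w : Esp d × ℝ => F w.1 w.2) (p : Esp d × ℝ) :
    ‖S2 φ₁ φ₂ ε F p.1 p.2‖ₑ ≤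
      ∫⁻ ξ, ‖F (p - pscale ε ξ).1 (p - pscale ε ξ).2‖ₑ * ‖prodKernel φ₁ φ₂ ξ‖ₑ := by
  have hm : Measurable fun ξ : Esp d × ℝ =>
      ‖F (p - pscale ε ξ).1 (p - pscale ε ξ).2‖ₑ * ‖prodKernel φ₁ φ₂ ξ‖ₑ :=
    (hF.comp (measurable_const.sub (pscale ε).measurable)).enorm.mul
      (continuous_prodKernel hφ₁ hφ₂).enorm.measurable
  rw [show (volume : Measure (Esp d × ℝ)) = (volume : Measure (Esp d)).prod volume from rfl,
    lintegral_prod_symm' _ hm, S2_eq hε]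
  refine (enorm_integral_le_lintegral_enorm _).trans (lintegral_mono fun s => ?_)
  rw [enorm_mul]
  refine (mul_le_mul_left (enorm_integral_le_lintegral_enorm _) _).trans ?_
  rw [← lintegral_mul_const' _ _ enorm_ne_top]
  refine lintegral_mono fun z => le_of_eq ?_
  simp only [prodKernel, enorm_mul, pscale_apply, Prod.fst_sub, Prod.snd_sub, mul_assoc]

theorem enorm_sub_S2_le (hε : 0 < ε) (hφ₁ : GoodK1 φ₁) (hφ₂ : GoodK2 φ₂) {F : Esp d → ℝ → ℝ}
    (hF : Integrable fun w : Esp d × ℝ => F w.1 w.2) (p : Esp d × ℝ) :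
    ‖F p.1 p.2 - S2 φ₁ φ₂ ε F p.1 p.2‖ₑ ≤
      ∫⁻ ξ, ‖F p.1 p.2 - F (p - pscale ε ξ).1 (p - pscale ε ξ).2‖ₑ * ‖prodKernel φ₁ φ₂ ξ‖ₑ := by
  have hk := continuous_prodKernel hφ₁ hφ₂
  obtain ⟨K, hK, hkK⟩ := exists_enorm_prodKernel_le hφ₁ hφ₂
  have hki : Integrable (prodKernel φ₁ φ₂) :=
    ⟨hk.aestronglyMeasurable, by
      rw [HasFiniteIntegral, lintegral_enorm_prodKernel hφ₁ hφ₂]; exact ENNReal.one_lt_top⟩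
  have hFi : Integrable fun ξ : Esp d × ℝ => F (p - pscale ε ξ).1 (p - pscale ε ξ).2 := by
    have hpm : ∀ ξ, p - pscale ε ξ = p + pscale ε (-ξ) := fun ξ => by rw [map_neg, sub_eq_add_neg]
    have h1 := (hF.integrableOn (s := univ)).comp_pscale hε.ne' (V := univ) (c := p)
      fun _ _ => mem_univ _
    rw [integrableOn_univ] at h1
    simp_rw [hpm]
    exact h1.comp_neg
  have hFk : Integrable fun ξ : Esp d × ℝ =>
      F (p - pscale ε ξ).1 (p - pscale ε ξ).2 * prodKernel φ₁ φ₂ ξ := by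
    refine hFi.mul_bdd (c := K.toReal) hk.aestronglyMeasurable
      (Filter.Eventually.of_forall fun ξ => ?_)
    rw [← toReal_enorm]
    exact ENNReal.toReal_mono hK ((hkK ξ).trans (indicator_le_self' (fun _ _ => zero_le) ξ))
  have hS : S2 φ₁ φ₂ ε F p.1 p.2 =
      ∫ ξ, F (p - pscale ε ξ).1 (p - pscale ε ξ).2 * prodKernel φ₁ φ₂ ξ := by
    rw [S2_eq hε, show (volume : Measure (Esp d × ℝ)) = (volume : Measure (Esp d)).prod volume
      from rfl, integral_prod_symm _ hFk]
    refine integral_congr_ae (Filter.Eventually.of_forall fun s => ?_)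
    simp only [prodKernel, pscale_apply, Prod.fst_sub, Prod.snd_sub]
    rw [← integral_mul_const]
    simp only [mul_assoc]
  have hc : F p.1 p.2 = ∫ ξ, F p.1 p.2 * prodKernel φ₁ φ₂ ξ := by
    rw [integral_const_mul, integral_prodKernel hφ₁ hφ₂, mul_one]
  rw [hS]
  conv_lhs => rw [hc]
  rw [← integral_sub (hki.const_mul _) hFk]
  refine (enorm_integral_le_lintegral_enorm _).trans (lintegral_mono fun ξ => ?_)
  rw [← enorm_mul, sub_mul]

end smoothing

section periodic
variable {d : ℕ}

theorem measurableSet_unitCell : MeasurableSet (unitCell d) := by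
  have : unitCell d = ⋂ i, (fun y : Esp d => y i) ⁻¹' Icc (0:ℝ) 1 := by
    ext y; simp [unitCell]
  rw [this]
  exact MeasurableSet.iInter fun i =>
    (EuclideanSpace.proj (𝕜 := ℝ) i).continuous.measurable measurableSet_Icc

theorem apply_add_eq_of_periodic {β : Type*} {G : Esp d × ℝ → β}
    (hx : ∀ i p, G (p + (EuclideanSpace.single i 1, 0)) = G p) (ht : ∀ p, G (p + (0, 1)) = G p)
    (m : Fin d → ℤ) (k : ℤ) (p : Esp d × ℝ) :
    G (p + (WithLp.toLp 2 (fun i => (m i : ℝ)), (k : ℝ))) = G p := by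
  let S : AddSubgroup (Esp d × ℝ) :=
    { carrier := {v | ∀ p, G (p + v) = G p}
      zero_mem' := fun p => by rw [add_zero]
      add_mem' := fun {a b} ha hb p => by rw [← add_assoc, hb, ha]
      neg_mem' := fun {a} ha p => by rw [← ha (p + -a), neg_add_cancel_right] }
  have hv : ((WithLp.toLp 2 (fun i => (m i : ℝ)), (k : ℝ)) : Esp d × ℝ) =
      (∑ i, m i • ((EuclideanSpace.single i 1, 0) : Esp d × ℝ)) + k • ((0, 1) : Esp d × ℝ) := by
    ext j
    · simp [Prod.fst_sum, Finset.sum_apply, Pi.single_apply]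
    · simp [Prod.snd_sum]
  have hmem : ((WithLp.toLp 2 (fun i => (m i : ℝ)), (k : ℝ)) : Esp d × ℝ) ∈ S := by
    rw [hv]
    exact S.add_mem (S.sum_mem fun i _ => S.zsmul_mem (fun p => hx i p) _) (S.zsmul_mem ht _)
  exact hmem p

theorem setLIntegral_ball_le_of_periodic {G : Esp d × ℝ → ℝ≥0∞}
    (hx : ∀ i p, G (p + (EuclideanSpace.single i 1, 0)) = G p) (ht : ∀ p, G (p + (0, 1)) = G p)
    (c : Esp d × ℝ) :
    ∫⁻ ξ in Metric.ball (0 : Esp d × ℝ) (1 / 2), G (c + ξ) ≤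
      (2 ^ d * 2) * ∫⁻ p in unitCell d ×ˢ Ioc (0:ℝ) 1, G p := by
  set Q : Set (Esp d × ℝ) := unitCell d ×ˢ Ioc (0:ℝ) 1 with hQ
  have hQm : MeasurableSet Q := measurableSet_unitCell.prod measurableSet_Ioc
  let v : (Fin d → Fin 2) × Fin 2 → Esp d × ℝ := fun m =>
    (WithLp.toLp 2 (fun i => ((⌊c.1 i - 1 / 2⌋ + ((m.1 i : ℕ) : ℤ) : ℤ) : ℝ)),
      ((⌈c.2 - 1 / 2⌉ - 1 + ((m.2 : ℕ) : ℤ) : ℤ) : ℝ))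
  have hv : ∀ m p, G (p + v m) = G p := fun m p => apply_add_eq_of_periodic hx ht _ _ p
  let S : (Fin d → Fin 2) × Fin 2 → Set (Esp d × ℝ) := fun m => {ξ | c + ξ - v m ∈ Q}
  have hcover : Metric.ball (0 : Esp d × ℝ) (1 / 2) ⊆ ⋃ m, S m := by
    intro ξ hξ
    rw [ball_prod_eq] at hξ
    obtain ⟨hξ1, hξ2⟩ := hξ
    rw [Real.ball_eq_Ioo] at hξ2
    have hξi : ∀ i, |ξ.1 i| < 1 / 2 := fun i =>
      (PiLp.norm_apply_le ξ.1 i).trans_lt (mem_ball_zero_iff.1 hξ1)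
    rw [mem_iUnion]
    refine ⟨⟨fun i => if ⌊c.1 i + ξ.1 i⌋ = ⌊c.1 i - 1 / 2⌋ then 0 else 1,
      if ⌈c.2 + ξ.2⌉ = ⌈c.2 - 1 / 2⌉ then 0 else 1⟩, fun i => ?_, ?_⟩
    · have h := abs_lt.1 (hξi i)
      have e1 : ⌊c.1 i - 1 / 2⌋ ≤ ⌊c.1 i + ξ.1 i⌋ := Int.floor_le_floor (by linarith)
      have e2 : ⌊c.1 i + ξ.1 i⌋ ≤ ⌊c.1 i - 1 / 2⌋ + 1 := by
        rw [← Int.floor_add_one]; exact Int.floor_le_floor (by linarith)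
      have e3 : (⌊c.1 i - 1 / 2⌋ + (((if ⌊c.1 i + ξ.1 i⌋ = ⌊c.1 i - 1 / 2⌋ then 0 else 1 : Fin 2)
          : ℕ) : ℤ) : ℤ) = ⌊c.1 i + ξ.1 i⌋ := by
        split_ifs with h'
        · simp [h']
        · rw [Fin.val_one, Nat.cast_one]; omega
      simp only [v, Prod.fst_sub, Prod.fst_add, PiLp.sub_apply, PiLp.add_apply, e3]
      exact ⟨sub_nonneg.2 (Int.floor_le _), by linarith [Int.lt_floor_add_one (c.1 i + ξ.1 i)]⟩
    · have h1 := hξ2.1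
      have h2 := hξ2.2
      have e1 : ⌈c.2 - 1 / 2⌉ ≤ ⌈c.2 + ξ.2⌉ := Int.ceil_le_ceil (by linarith)
      have e2 : ⌈c.2 + ξ.2⌉ ≤ ⌈c.2 - 1 / 2⌉ + 1 := by
        rw [← Int.ceil_add_one]; exact Int.ceil_le_ceil (by linarith)
      have e3 : (⌈c.2 - 1 / 2⌉ - 1 + (((if ⌈c.2 + ξ.2⌉ = ⌈c.2 - 1 / 2⌉ then 0 else 1 : Fin 2)
          : ℕ) : ℤ) : ℤ) = ⌈c.2 + ξ.2⌉ - 1 := by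
        split_ifs with h'
        · simp [h']
        · rw [Fin.val_one, Nat.cast_one]; omega
      simp only [v, Prod.snd_sub, Prod.snd_add, e3]
      push_cast
      exact ⟨by linarith [Int.ceil_lt_add_one (c.2 + ξ.2)], by linarith [Int.le_ceil (c.2 + ξ.2)]⟩
  have hS : ∀ m, ∫⁻ ξ in S m, G (c + ξ) = ∫⁻ p in Q, G p := by
    intro m
    have hSm : MeasurableSet (S m) := by
      have : Measurable fun ξ : Esp d × ℝ => c + ξ - v m := by fun_prop
      exact this hQm
    rw [← lintegral_indicator hSm, ← lintegral_indicator hQm,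
      ← lintegral_add_left_eq_self (Q.indicator G) (c - v m)]
    refine lintegral_congr fun ξ => ?_
    have e : c - v m + ξ = c + ξ - v m := by abel
    rw [e]
    by_cases hξ : c + ξ - v m ∈ Q
    · rw [indicator_of_mem (show ξ ∈ S m from hξ), indicator_of_mem hξ, ← hv m (c + ξ - v m),
        sub_add_cancel]
    · rw [indicator_of_notMem (show ξ ∉ S m from hξ), indicator_of_notMem hξ]
  calc _ ≤ ∫⁻ ξ in ⋃ m, S m, G (c + ξ) := lintegral_mono_set hcover
    _ ≤ ∑' m, ∫⁻ ξ in S m, G (c + ξ) := lintegral_iUnion_le _ _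
    _ = _ := by
        simp_rw [hS]
        rw [tsum_fintype, Finset.sum_const, Finset.card_univ, nsmul_eq_mul]
        simp

theorem cellNorm_two_two {F : Type*} [NormedAddCommGroup F] [MeasurableSpace F] [BorelSpace F]
    {g : Esp d → ℝ → F}
    (hg : Measurable fun w : Esp d × ℝ => g w.1 w.2) :
    cellNorm 2 2 (fun y τ => ‖g y τ‖) =
      (∫⁻ p in unitCell d ×ˢ Ioc (0:ℝ) 1, ‖g p.1 p.2‖ₑ ^ 2) ^ (1 / 2 : ℝ) := by
  rw [show (volume : Measure (Esp d × ℝ)) = (volume : Measure (Esp d)).prod volume from rfl,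
    ← Measure.prod_restrict, lintegral_prod_symm' _ (hg.enorm.pow_const 2)]
  simp only [cellNorm, eLp, ENNReal.ofNat_ne_top, if_false, ENNReal.toReal_ofNat]
  congr 1
  refine lintegral_congr fun τ => ?_
  rw [← ENNReal.rpow_mul, one_div_mul_cancel two_ne_zero, ENNReal.rpow_one]
  refine lintegral_congr fun y => ?_
  rw [← enorm_eq_nnnorm, enorm_norm]
  norm_num

end periodic

/-- The average oscillation of `F` around `p` at parabolic scale `ε`. -/
def meanOscillation {d : ℕ} (φ₁ : ℝ → ℝ) (φ₂ : Esp d → ℝ) (ε : ℝ) (F : Esp d × ℝ → ℝ)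
    (p : Esp d × ℝ) : ℝ≥0∞ :=
  ∫⁻ ξ, ‖F p - F (p - pscale ε ξ)‖ₑ * ‖prodKernel φ₁ φ₂ ξ‖ₑ

section meanOscillation
variable {d : ℕ} {φ₁ : ℝ → ℝ} {φ₂ : Esp d → ℝ} {ε : ℝ}

theorem measurable_meanOscillation (hφ₁ : GoodK1 φ₁) (hφ₂ : GoodK2 φ₂) {F : Esp d × ℝ → ℝ}
    (hF : Measurable F) : Measurable (meanOscillation φ₁ φ₂ ε F) := by
  refine Measurable.lintegral_prod_right'
    (f := fun z : (Esp d × ℝ) × (Esp d × ℝ) =>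
      ‖F z.1 - F (z.1 - pscale ε z.2)‖ₑ * ‖prodKernel φ₁ φ₂ z.2‖ₑ) ?_
  exact ((hF.comp measurable_fst).sub (hF.comp (measurable_fst.sub
    ((pscale ε).measurable.comp measurable_snd)))).enorm.mul
      ((continuous_prodKernel hφ₁ hφ₂).enorm.measurable.comp measurable_snd)

theorem lintegral_sq_meanOscillation_le (hφ₁ : GoodK1 φ₁) (hφ₂ : GoodK2 φ₂) {K : ℝ≥0∞} (hK : K ≠ ∞)
    (hk : ∀ ξ, ‖prodKernel φ₁ φ₂ ξ‖ₑ ≤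
      (Metric.ball (0 : Esp d × ℝ) (1 / 2)).indicator (fun _ => K) ξ)
    {F : Esp d × ℝ → ℝ} (hF : Measurable F) (c : Esp d × ℝ) :
    ∫⁻ ξ, meanOscillation φ₁ φ₂ ε F (c + pscale ε ξ) ^ 2 * ‖prodKernel φ₁ φ₂ ξ‖ₑ ≤
      K ^ 2 * ∫⁻ ξ in Metric.ball (0 : Esp d × ℝ) 1, ∫⁻ η in Metric.ball (0 : Esp d × ℝ) 1,
        ‖F (c + pscale ε ξ) - F (c + pscale ε η)‖ₑ ^ 2 := by
  set Q : Set (Esp d × ℝ) := Metric.ball 0 (1 / 2)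
  set B : Set (Esp d × ℝ) := Metric.ball 0 1
  have hQB : Q ⊆ B := Metric.ball_subset_ball (by norm_num)
  have hkm := (continuous_prodKernel hφ₁ hφ₂).enorm.measurable
  set f : Esp d × ℝ → Esp d × ℝ → ℝ≥0∞ := fun ξ η =>
    ‖F (c + pscale ε ξ) - F (c + pscale ε η)‖ₑ with hf
  have hinner : ∀ ξ ∈ Q, meanOscillation φ₁ φ₂ ε F (c + pscale ε ξ) ^ 2 ≤
      K * ∫⁻ η in B, f ξ η ^ 2 := by
    intro ξ hξ
    have e : ∀ η, c + pscale ε ξ - pscale ε η = c + pscale ε (ξ - η) := fun η => by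
      rw [map_sub]; abel
    have hfm : Measurable fun η => f ξ (ξ - η) := by
      have := (pscale (d := d) ε).measurable
      exact (measurable_const.sub (hF.comp (by fun_prop))).enorm
    calc _ = (∫⁻ η, ‖prodKernel φ₁ φ₂ η‖ₑ * f ξ (ξ - η)) ^ (2:ℝ) := by
          rw [ENNReal.rpow_two]
          simp_rw [meanOscillation, e, mul_comm, hf]
      _ ≤ ∫⁻ η, ‖prodKernel φ₁ φ₂ η‖ₑ * f ξ (ξ - η) ^ (2:ℝ) :=
          lintegral_mul_rpow_le_of_lintegral_le_one one_le_two hfm hkm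
            (lintegral_enorm_prodKernel hφ₁ hφ₂).le
      _ ≤ ∫⁻ η, K * B.indicator (fun η => f ξ η ^ 2) (ξ - η) := by
          refine lintegral_mono fun η => ?_
          rw [ENNReal.rpow_two]
          by_cases hη : η ∈ Q
          · have : ξ - η ∈ B := by
              rw [mem_ball_zero_iff] at *
              linarith [norm_sub_le ξ η]
            rw [indicator_of_mem this]
            gcongr
            exact (hk η).trans (indicator_le_self' (fun _ _ => zero_le) η)
          · refine (mul_le_mul_left (hk η) _).trans ?_
            rw [indicator_of_notMem hη, zero_mul]
            exact zero_le
      _ = K * ∫⁻ η in B, f ξ η ^ 2 := by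
          rw [lintegral_const_mul' _ _ hK, lintegral_sub_left_eq_self (B.indicator _) ξ,
            lintegral_indicator measurableSet_ball]
  calc _ ≤ ∫⁻ ξ, B.indicator (fun ξ => K ^ 2 * ∫⁻ η in B, f ξ η ^ 2) ξ := by
        refine lintegral_mono fun ξ => ?_
        by_cases hξ : ξ ∈ Q
        · rw [indicator_of_mem (hQB hξ)]
          calc _ ≤ (K * ∫⁻ η in B, f ξ η ^ 2) * K := mul_le_mul' (hinner ξ hξ)
                ((hk ξ).trans (indicator_le_self' (fun _ _ => zero_le) ξ))
            _ = _ := by ring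
        · refine (mul_le_mul_right (hk ξ) _).trans ?_
          rw [indicator_of_notMem hξ, mul_zero]
          exact zero_le
    _ = _ := by
        rw [lintegral_indicator measurableSet_ball, lintegral_const_mul' _ _ (by simp [hK])]

theorem exists_lintegral_meanOscillation_mul_le (hd : 2 ≤ d) (hφ₁ : GoodK1 φ₁) (hφ₂ : GoodK2 φ₂) :
    ∃ C : ℝ≥0∞, C ≠ ∞ ∧ ∀ (U : Set (Esp d × ℝ)) (f : Esp d → ℝ → ℝ) (Df : Esp d → ℝ → Esp d)
      (D2f : Esp d → ℝ → EuclideanSpace ℝ (Fin d × Fin d)) (Dtf : Esp d → ℝ → ℝ),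
      MeasurableSet U →
      Measurable (fun w : Esp d × ℝ => Df w.1 w.2) →
      Measurable (fun w : Esp d × ℝ => D2f w.1 w.2) →
      Measurable (fun w : Esp d × ℝ => Dtf w.1 w.2) →
      (∀ i, IntegrableOn (fun w : Esp d × ℝ => Df w.1 w.2 i) U) →
      (∀ i, IsWeakDerivST U f (fun x t => Df x t i) (EuclideanSpace.single i 1, (0:ℝ))) →
      (∀ i j, IsWeakDerivST U (fun x t => Df x t i) (fun x t => D2f x t (i, j))
        (EuclideanSpace.single j 1, (0:ℝ))) →
      IsWeakDerivST U f Dtf ((0 : Esp d), (1:ℝ)) →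
      ∀ ε : ℝ, 0 < ε → ∀ c : Esp d × ℝ,
      (∀ ξ ∈ Metric.ball (0 : Esp d × ℝ) 2, c + pscale ε ξ ∈ U) →
      ∀ (G : Esp d × ℝ → ℝ≥0∞), Measurable G →
      (∀ i p, G (p + (EuclideanSpace.single i 1, 0)) = G p) → (∀ p, G (p + (0, 1)) = G p) →
      ∀ c' : Esp d × ℝ,
      ∫⁻ ξ, (∑ i, meanOscillation φ₁ φ₂ ε (U.indicator fun w => Df w.1 w.2 i) (c + pscale ε ξ)) *
          G (c' + ξ) * ‖prodKernel φ₁ φ₂ ξ‖ₑ ≤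
        C * (ENNReal.ofReal ε * (∫⁻ ξ in Metric.ball (0 : Esp d × ℝ) 2,
          (U.indicator (fun w => ‖D2f w.1 w.2‖ₑ + ‖Dtf w.1 w.2‖ₑ) (c + pscale ε ξ)) ^
            (2 * d / (d + 1) : ℝ)) ^ (1 / (2 * d / (d + 1)) : ℝ)) *
        (∫⁻ p in unitCell d ×ˢ Ioc (0:ℝ) 1, G p ^ 2) ^ (1 / 2 : ℝ) := by
  have hd' : (2:ℝ) ≤ d := by exact_mod_cast hd
  obtain ⟨C, hC, HC⟩ := exists_lintegral_lintegral_pscale_weakGrad_sub_le hd hφ₂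
  obtain ⟨K, hK, hk⟩ := exists_enorm_prodKernel_le hφ₁ hφ₂
  set q : ℝ := 2 * d / (d + 1) with hq
  have hq1 : 1 ≤ q := by rw [hq, le_div_iff₀ (by positivity)]; linarith
  have hq0 : 0 < q := by linarith
  set C₁ : ℝ≥0∞ := d * (d * (K ^ 2 * (C * (d * d + 1) ^ 2))) with hC₁
  have hC₁t : C₁ ≠ ∞ := by
    rw [hC₁]
    refine ENNReal.mul_ne_top (by simp) (ENNReal.mul_ne_top (by simp) (ENNReal.mul_ne_top
      (by simp [hK]) (ENNReal.mul_ne_top hC (ENNReal.pow_ne_top ?_))))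
    exact ENNReal.add_ne_top.2 ⟨ENNReal.mul_ne_top (by simp) (by simp), by simp⟩
  refine ⟨C₁ ^ (1 / 2 : ℝ) * (K * (2 ^ d * 2)) ^ (1 / 2 : ℝ), ENNReal.mul_ne_top
    (ENNReal.rpow_ne_top_of_nonneg (by norm_num) hC₁t) (ENNReal.rpow_ne_top_of_nonneg (by norm_num)
      (ENNReal.mul_ne_top hK (by finiteness))), ?_⟩
  intro U f Df D2f Dtf hU hDm hD2m hDtm hDi hfD hDD hft ε hε c hsub G hG hGx hGt c'
  set F : Fin d → Esp d × ℝ → ℝ := fun i => U.indicator fun w => Df w.1 w.2 i with hF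
  have hFm : ∀ i, Measurable (F i) := fun i => Measurable.indicator
    ((EuclideanSpace.proj (𝕜 := ℝ) i).continuous.measurable.comp hDm) hU
  have hkm := (continuous_prodKernel hφ₁ hφ₂).enorm.measurable
  set B : Set (Esp d × ℝ) := Metric.ball 0 2
  set N : Esp d × ℝ → ℝ≥0∞ := U.indicator fun w => ‖D2f w.1 w.2‖ₑ + ‖Dtf w.1 w.2‖ₑ with hN
  set X : ℝ≥0∞ := ENNReal.ofReal ε * (∫⁻ ξ in B, N (c + pscale ε ξ) ^ q) ^ (1 / q) with hX
  have hpm : Measurable fun ξ => c + pscale ε ξ := by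
    have := (pscale (d := d) ε).measurable
    fun_prop
  have hosc : ∀ i, Measurable fun ξ => meanOscillation φ₁ φ₂ ε (F i) (c + pscale ε ξ) := fun i =>
    (measurable_meanOscillation hφ₁ hφ₂ (hFm i)).comp hpm
  have hcoord : ∀ (y : EuclideanSpace ℝ (Fin d × Fin d)) ij, ‖y ij‖ₑ ≤ ‖y‖ₑ := fun y ij => by
    rw [← enorm_norm, ← enorm_norm y, Real.enorm_of_nonneg (norm_nonneg _),
      Real.enorm_of_nonneg (norm_nonneg _)]
    exact ENNReal.ofReal_le_ofReal (PiLp.norm_apply_le y ij)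
  have h1B : Metric.ball (0 : Esp d × ℝ) 1 ⊆ B := Metric.ball_subset_ball (by norm_num)
  have hDbound : ∀ i, ∫⁻ ξ, meanOscillation φ₁ φ₂ ε (F i) (c + pscale ε ξ) ^ 2 *
      ‖prodKernel φ₁ φ₂ ξ‖ₑ ≤ K ^ 2 * (C * (d * d + 1) ^ 2) * X ^ 2 := by
    intro i
    refine (lintegral_sq_meanOscillation_le hφ₁ hφ₂ hK hk (hFm i) c).trans ?_
    rw [mul_assoc]
    gcongr
    calc _ = ∫⁻ ξ in Metric.ball (0 : Esp d × ℝ) 1, ∫⁻ η in Metric.ball (0 : Esp d × ℝ) 1,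
          ‖Df (c + pscale ε ξ).1 (c + pscale ε ξ).2 i -
            Df (c + pscale ε η).1 (c + pscale ε η).2 i‖ₑ ^ 2 := by
          refine setLIntegral_congr_fun measurableSet_ball fun ξ hξ => ?_
          refine setLIntegral_congr_fun measurableSet_ball fun η hη => ?_
          simp only [hF, indicator_of_mem (hsub ξ (h1B hξ)), indicator_of_mem (hsub η (h1B hη))]
      _ ≤ _ := HC U f (fun i x t => Df x t i) (fun i j x t => D2f x t (i, j)) Dtf
          (fun i j => (EuclideanSpace.proj (𝕜 := ℝ) (i, j)).continuous.measurable.comp hD2m)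
          hDtm hDi hfD hDD hft ε hε c hsub i
      _ ≤ C * (ENNReal.ofReal ε * (∫⁻ ξ in B, ((d * d + 1) * N (c + pscale ε ξ)) ^ q) ^
            (1 / q)) ^ 2 := by
          gcongr C * (_ * ?_ ^ (1 / q)) ^ 2
          refine setLIntegral_mono' measurableSet_ball fun ξ hξ => ?_
          refine ENNReal.rpow_le_rpow ?_ hq0.le
          rw [hN, indicator_of_mem (hsub ξ hξ)]
          calc _ ≤ (∑ _i : Fin d, ∑ _j : Fin d,
                ‖D2f (c + pscale ε ξ).1 (c + pscale ε ξ).2‖ₑ) +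
                ‖Dtf (c + pscale ε ξ).1 (c + pscale ε ξ).2‖ₑ := by
                  gcongr
                  exact hcoord _ _
            _ = d * d * ‖D2f (c + pscale ε ξ).1 (c + pscale ε ξ).2‖ₑ +
                1 * ‖Dtf (c + pscale ε ξ).1 (c + pscale ε ξ).2‖ₑ := by
                  simp [mul_assoc]
            _ ≤ (d * d + 1) * ‖D2f (c + pscale ε ξ).1 (c + pscale ε ξ).2‖ₑ +
                (d * d + 1) * ‖Dtf (c + pscale ε ξ).1 (c + pscale ε ξ).2‖ₑ := by
                  gcongr
                  · exact le_self_add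
                  · exact le_add_self
            _ = _ := (mul_add _ _ _).symm
      _ = _ := by
          simp_rw [ENNReal.mul_rpow_of_nonneg _ _ hq0.le]
          rw [lintegral_const_mul' _ _ (ENNReal.rpow_ne_top_of_nonneg hq0.le (by finiteness)),
            ENNReal.mul_rpow_of_nonneg _ _ (by positivity), ← ENNReal.rpow_mul,
            mul_one_div_cancel hq0.ne', ENNReal.rpow_one, hX]
          ring
  set S : Esp d × ℝ → ℝ≥0∞ := fun ξ => ∑ i, meanOscillation φ₁ φ₂ ε (F i) (c + pscale ε ξ) with hS
  have hSm : Measurable S := Finset.measurable_fun_sum _ fun i _ => hosc i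
  have hSbound : ∫⁻ ξ, (S ξ * ‖prodKernel φ₁ φ₂ ξ‖ₑ ^ (1 / 2 : ℝ)) ^ 2 ≤ C₁ * X ^ 2 := by
    calc _ = ∫⁻ ξ, S ξ ^ 2 * ‖prodKernel φ₁ φ₂ ξ‖ₑ := by
          refine lintegral_congr fun ξ => ?_
          rw [mul_pow, ← ENNReal.rpow_two (_ ^ (1 / 2 : ℝ)), ← ENNReal.rpow_mul]
          norm_num
      _ ≤ ∫⁻ ξ, ∑ i, d * (meanOscillation φ₁ φ₂ ε (F i) (c + pscale ε ξ) ^ 2 *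
          ‖prodKernel φ₁ φ₂ ξ‖ₑ) := by
          refine lintegral_mono fun ξ => ?_
          have h := sum_rpow_le_card_mul_sum (Finset.univ : Finset (Fin d)) one_le_two
            fun i => meanOscillation φ₁ φ₂ ε (F i) (c + pscale ε ξ)
          simp only [Finset.card_univ, Fintype.card_fin, ENNReal.rpow_two] at h
          norm_num at h
          refine (mul_le_mul_left h _).trans (le_of_eq ?_)
          rw [← Finset.mul_sum, ← Finset.sum_mul, mul_assoc]
      _ = ∑ i, d * ∫⁻ ξ, meanOscillation φ₁ φ₂ ε (F i) (c + pscale ε ξ) ^ 2 *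
          ‖prodKernel φ₁ φ₂ ξ‖ₑ := by
          have hterm : ∀ i ∈ Finset.univ, Measurable fun ξ =>
              (d : ℝ≥0∞) * (meanOscillation φ₁ φ₂ ε (F i) (c + pscale ε ξ) ^ 2 *
                ‖prodKernel φ₁ φ₂ ξ‖ₑ) := fun i _ => (((hosc i).pow_const 2).mul hkm).const_mul _
          rw [lintegral_finsetSum _ hterm]
          simp_rw [lintegral_const_mul' _ _ (ENNReal.natCast_ne_top d)]
      _ ≤ ∑ _i : Fin d, d * (K ^ 2 * (C * (d * d + 1) ^ 2) * X ^ 2) := by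
          gcongr with i
          exact hDbound i
      _ = C₁ * X ^ 2 := by
          rw [Finset.sum_const, Finset.card_univ, Fintype.card_fin, nsmul_eq_mul, hC₁]
          ring
  have hGbound : ∫⁻ ξ, (G (c' + ξ) * ‖prodKernel φ₁ φ₂ ξ‖ₑ ^ (1 / 2 : ℝ)) ^ 2 ≤
      K * (2 ^ d * 2) * ∫⁻ p in unitCell d ×ˢ Ioc (0:ℝ) 1, G p ^ 2 := by
    calc _ ≤ ∫⁻ ξ, K * (Metric.ball (0 : Esp d × ℝ) (1 / 2)).indicator
          (fun ξ => G (c' + ξ) ^ 2) ξ := by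
          refine lintegral_mono fun ξ => ?_
          rw [mul_pow, ← ENNReal.rpow_two (_ ^ (1 / 2 : ℝ)), ← ENNReal.rpow_mul,
            one_div_mul_cancel two_ne_zero, ENNReal.rpow_one]
          refine (mul_le_mul_right (hk ξ) _).trans (le_of_eq ?_)
          by_cases hξ : ξ ∈ Metric.ball (0 : Esp d × ℝ) (1 / 2)
          · rw [indicator_of_mem hξ, indicator_of_mem hξ, mul_comm]
          · rw [indicator_of_notMem hξ, indicator_of_notMem hξ, mul_zero, mul_zero]
      _ = K * ∫⁻ ξ in Metric.ball (0 : Esp d × ℝ) (1 / 2), G (c' + ξ) ^ 2 := by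
          rw [lintegral_const_mul' _ _ hK, lintegral_indicator measurableSet_ball]
      _ ≤ _ := by
          rw [mul_assoc]
          gcongr
          exact setLIntegral_ball_le_of_periodic (G := fun p => G p ^ 2)
            (fun i p => by rw [hGx]) (fun p => by rw [hGt]) c'
  calc _ = ∫⁻ ξ, (S ξ * ‖prodKernel φ₁ φ₂ ξ‖ₑ ^ (1 / 2 : ℝ)) *
        (G (c' + ξ) * ‖prodKernel φ₁ φ₂ ξ‖ₑ ^ (1 / 2 : ℝ)) := by
        refine lintegral_congr fun ξ => ?_
        have : ‖prodKernel φ₁ φ₂ ξ‖ₑ =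
            ‖prodKernel φ₁ φ₂ ξ‖ₑ ^ (1 / 2 : ℝ) * ‖prodKernel φ₁ φ₂ ξ‖ₑ ^ (1 / 2 : ℝ) := by
          rw [← ENNReal.rpow_add_of_nonneg _ _ (by norm_num) (by norm_num)]; norm_num
        conv_lhs => rw [this]
        ring
    _ ≤ (∫⁻ ξ, (S ξ * ‖prodKernel φ₁ φ₂ ξ‖ₑ ^ (1 / 2 : ℝ)) ^ 2) ^ (1 / 2 : ℝ) *
        (∫⁻ ξ, (G (c' + ξ) * ‖prodKernel φ₁ φ₂ ξ‖ₑ ^ (1 / 2 : ℝ)) ^ 2) ^ (1 / 2 : ℝ) :=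
        lintegral_mul_le_sq_mul_sq (hSm.mul (hkm.pow_const _)).aemeasurable
          ((hG.comp (measurable_const_add c')).mul (hkm.pow_const _)).aemeasurable
    _ ≤ (C₁ * X ^ 2) ^ (1 / 2 : ℝ) * (K * (2 ^ d * 2) *
        ∫⁻ p in unitCell d ×ˢ Ioc (0:ℝ) 1, G p ^ 2) ^ (1 / 2 : ℝ) := by gcongr
    _ = _ := by
        rw [ENNReal.mul_rpow_of_nonneg C₁ _ (by norm_num),
          ENNReal.mul_rpow_of_nonneg (K * (2 ^ d * 2)) _ (by norm_num), ← ENNReal.rpow_two X,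
          ← ENNReal.rpow_mul,
          mul_one_div_cancel two_ne_zero, ENNReal.rpow_one]
        ring

end meanOscillation

/-- The mixed `L²` in time, `L^r` in space norm on the whole space-time. -/
def mixedLp {d : ℕ} (r : ℝ) (N : Esp d × ℝ → ℝ≥0∞) : ℝ≥0∞ :=
  (∫⁻ t, ((∫⁻ x, N (x, t) ^ r) ^ (1 / r)) ^ 2) ^ (1 / 2 : ℝ)

section mixedLp
variable {d : ℕ} {r : ℝ} {M N : Esp d × ℝ → ℝ≥0∞}

theorem mixNorm_two_eq_mixedLp (hr : 0 < r) {U : Set (Esp d × ℝ)} (hU : MeasurableSet U)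
    (F : Esp d → ℝ → ℝ≥0∞) :
    mixNorm 2 (ENNReal.ofReal r) U F = mixedLp r (U.indicator fun w => F w.1 w.2) := by
  have hm : ∀ t : ℝ, MeasurableSet {x : Esp d | (x, t) ∈ U} := fun t =>
    measurable_prodMk_right hU
  simp only [mixNorm, eLp, mixedLp, ENNReal.ofNat_ne_top, ENNReal.ofReal_ne_top, if_false,
    ENNReal.toReal_ofReal hr.le, ENNReal.toReal_ofNat, ENNReal.rpow_two]
  congr 1
  refine lintegral_congr fun t => ?_
  rw [← lintegral_indicator (hm t)]
  congr 3 with x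
  by_cases hx : (x, t) ∈ U
  · rw [indicator_of_mem (show x ∈ {x | (x, t) ∈ U} from hx), indicator_of_mem hx]
  · rw [indicator_of_notMem (show x ∉ {x | (x, t) ∈ U} from hx), indicator_of_notMem hx,
      ENNReal.zero_rpow_of_pos hr]

theorem measurable_lintegral_space_rpow (hN : Measurable N) (r : ℝ) :
    Measurable fun t => ∫⁻ x, N (x, t) ^ r :=
  (hN.pow_const r).lintegral_prod_left'

theorem mixedLp_const_mul (hr : 0 < r) {c : ℝ≥0∞} (hc : c ≠ ∞) :
    mixedLp r (fun w => c * N w) = c * mixedLp r N := by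
  unfold mixedLp
  simp_rw [ENNReal.mul_rpow_of_nonneg _ _ hr.le]
  simp_rw [lintegral_const_mul' _ _ (ENNReal.rpow_ne_top_of_nonneg hr.le hc),
    ENNReal.mul_rpow_of_nonneg _ _ (one_div_pos.2 hr).le, ← ENNReal.rpow_mul,
    mul_one_div_cancel hr.ne', ENNReal.rpow_one, mul_pow]
  rw [lintegral_const_mul' _ _ (by simp [hc]), ENNReal.mul_rpow_of_nonneg _ _ (by norm_num),
    ← ENNReal.rpow_two, ← ENNReal.rpow_mul, mul_one_div_cancel two_ne_zero, ENNReal.rpow_one]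

theorem mixedLp_add_le (hr : 1 ≤ r) (hM : Measurable M) (hN : Measurable N) :
    mixedLp r (fun w => M w + N w) ≤ mixedLp r M + mixedLp r N := by
  calc _ ≤ (∫⁻ t, ((∫⁻ x, M (x, t) ^ r) ^ (1 / r) + (∫⁻ x, N (x, t) ^ r) ^ (1 / r)) ^ (2 : ℝ)) ^
        (1 / 2 : ℝ) := by
        unfold mixedLp
        simp_rw [← ENNReal.rpow_two]
        gcongr with t
        exact ENNReal.lintegral_Lp_add_le (hM.comp measurable_prodMk_right).aemeasurable
          (hN.comp measurable_prodMk_right).aemeasurable hr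
    _ ≤ _ := by
        unfold mixedLp
        simp_rw [← ENNReal.rpow_two]
        exact ENNReal.lintegral_Lp_add_le
          ((measurable_lintegral_space_rpow hM r).pow_const _).aemeasurable
          ((measurable_lintegral_space_rpow hN r).pow_const _).aemeasurable one_le_two

theorem lintegral_mul_le_mixedLp {p q : ℝ} (hpq : p.HolderConjugate q) (hM : Measurable M)
    (hN : Measurable N) : ∫⁻ w, M w * N w ≤ mixedLp p M * mixedLp q N := by
  rw [Measure.volume_eq_prod, lintegral_prod_symm (fun w => M w * N w) (hM.mul hN).aemeasurable]
  calc _ ≤ ∫⁻ t, (∫⁻ x, M (x, t) ^ p) ^ (1 / p) * (∫⁻ x, N (x, t) ^ q) ^ (1 / q) :=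
        lintegral_mono fun t => ENNReal.lintegral_mul_le_Lp_mul_Lq _ hpq
          (hM.comp measurable_prodMk_right).aemeasurable
          (hN.comp measurable_prodMk_right).aemeasurable
    _ ≤ _ := lintegral_mul_le_sq_mul_sq
          ((measurable_lintegral_space_rpow hM p).pow_const _).aemeasurable
          ((measurable_lintegral_space_rpow hN q).pow_const _).aemeasurable

theorem mixedLp_localAverage_le (hr : 0 < r) (hr2 : r ≤ 2) (hN : Measurable N) (ε : ℝ)
    {B : Set (Esp d × ℝ)} (hBf : volume B ≠ ∞) :
    mixedLp r (fun w => (∫⁻ ξ in B, N (w + pscale ε ξ) ^ r) ^ (1 / r)) ≤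
      volume B ^ (1 / r) * mixedLp r N := by
  set n : ℝ → ℝ≥0∞ := fun t => ∫⁻ x, N (x, t) ^ r with hn
  have hnm : Measurable n := measurable_lintegral_space_rpow hN r
  have hpm := (pscale (d := d) ε).measurable
  have h2r : 1 ≤ 2 / r := by rw [le_div_iff₀ hr]; linarith
  have hsq : ∀ a : ℝ≥0∞, (a ^ (1 / r)) ^ 2 = a ^ (2 / r) := fun a => by
    rw [← ENNReal.rpow_two, ← ENNReal.rpow_mul]; congr 1; ring
  have hspace : ∀ t : ℝ, ∫⁻ x, ((∫⁻ ξ in B, N ((x, t) + pscale ε ξ) ^ r) ^ (1 / r)) ^ r =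
      ∫⁻ ξ in B, n (t + ε ^ 2 * ξ.2) := by
    intro t
    simp_rw [← ENNReal.rpow_mul, one_div_mul_cancel hr.ne', ENNReal.rpow_one]
    rw [lintegral_lintegral_swap]
    · refine lintegral_congr fun ξ => ?_
      simp_rw [hn, pscale_apply, Prod.mk_add_mk]
      exact lintegral_add_right_eq_self (fun x => N (x, t + ε ^ 2 * ξ.2) ^ r) _
    · refine Measurable.aemeasurable ?_
      simp only [Function.uncurry_def]
      exact (hN.comp (by fun_prop)).pow_const r
  have htime : ∀ t : ℝ, (∫⁻ ξ in B, n (t + ε ^ 2 * ξ.2)) ^ (2 / r) ≤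
      volume B ^ (2 / r - 1) * ∫⁻ ξ in B, n (t + ε ^ 2 * ξ.2) ^ (2 / r) := by
    intro t
    have := lintegral_rpow_le_measure_mul (μ := volume.restrict B) (p := 2 / r) h2r
      (hnm.comp (by fun_prop : Measurable fun ξ : Esp d × ℝ => t + ε ^ 2 * ξ.2)).aemeasurable
    rwa [Measure.restrict_apply_univ] at this
  unfold mixedLp
  simp_rw [hspace, hsq]
  calc _ ≤ (volume B ^ (2 / r - 1) * (volume B * ∫⁻ t, n t ^ (2 / r))) ^ (1 / 2 : ℝ) := by
        refine ENNReal.rpow_le_rpow ?_ (by norm_num)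
        calc _ ≤ ∫⁻ t, volume B ^ (2 / r - 1) * ∫⁻ ξ in B, n (t + ε ^ 2 * ξ.2) ^ (2 / r) :=
              lintegral_mono htime
          _ = volume B ^ (2 / r - 1) * ∫⁻ ξ in B, ∫⁻ t, n (t + ε ^ 2 * ξ.2) ^ (2 / r) := by
              rw [lintegral_const_mul' _ _ (ENNReal.rpow_ne_top_of_nonneg (by linarith) hBf),
                lintegral_lintegral_swap]
              refine Measurable.aemeasurable ?_
              simp only [Function.uncurry_def]
              exact (hnm.comp (by fun_prop)).pow_const _
          _ = _ := by
              congr 1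
              calc _ = ∫⁻ _ξ in B, ∫⁻ t, n t ^ (2 / r) := lintegral_congr fun ξ =>
                    lintegral_add_right_eq_self (fun t => n t ^ (2 / r)) _
                _ = _ := by rw [lintegral_const, Measure.restrict_apply_univ, mul_comm]
    _ = (volume B ^ (2 / r) * ∫⁻ t, n t ^ (2 / r)) ^ (1 / 2 : ℝ) := by
        rw [← mul_assoc]
        congr 2
        conv_lhs => enter [2]; rw [← ENNReal.rpow_one (volume B)]
        rw [← ENNReal.rpow_add_of_nonneg _ _ (by linarith) zero_le_one]
        congr 1; ring
    _ = _ := by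
        rw [ENNReal.mul_rpow_of_nonneg _ _ (by norm_num), ← ENNReal.rpow_mul]
        congr 2; ring

theorem mixedLp_indicator_prod_ne_top (hr : 0 < r) {Ω : Set (Esp d)} {I : Set ℝ}
    (hI : MeasurableSet I) (hΩm : MeasurableSet Ω) (hΩ : volume Ω ≠ ∞) (hIv : volume I ≠ ∞) :
    mixedLp r ((Ω ×ˢ I).indicator 1) ≠ ∞ := by
  have : ∀ t, ((∫⁻ x : Esp d, (Ω ×ˢ I).indicator 1 (x, t) ^ r) ^ (1 / r)) ^ 2 =
      I.indicator (fun _ => (volume Ω ^ (1 / r)) ^ 2) t := by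
    intro t
    by_cases ht : t ∈ I
    · rw [indicator_of_mem ht, ← lintegral_indicator_one hΩm]
      congr 3 with x
      by_cases hx : x ∈ Ω <;> simp [hx, ht, hr]
    · simp [ht, hr]
  unfold mixedLp
  simp_rw [this]
  rw [lintegral_indicator hI, lintegral_const, Measure.restrict_apply_univ]
  exact ENNReal.rpow_ne_top_of_nonneg (by norm_num) (ENNReal.mul_ne_top
    (ENNReal.pow_ne_top (ENNReal.rpow_ne_top_of_nonneg (by positivity) hΩ)) hIv)

end mixedLp

section assembly
variable {d : ℕ}

theorem setLIntegral_mul_le_mixNorm_top {U : Set (Esp d × ℝ)} (hU : MeasurableSet U)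
    {A K : Esp d × ℝ → ℝ≥0∞} (hA : Measurable A) (hK : Measurable K) :
    ∫⁻ w in U, A w * K w ≤ (∫⁻ w in U, A w) * mixNorm ⊤ ⊤ U (fun x t => K (x, t)) := by
  have hs : ∀ t : ℝ, MeasurableSet {x : Esp d | (x, t) ∈ U} := fun t => measurable_prodMk_right hU
  have hslice : ∀ B : Esp d × ℝ → ℝ≥0∞, Measurable B →
      ∫⁻ w in U, B w = ∫⁻ t, ∫⁻ x in {x : Esp d | (x, t) ∈ U}, B (x, t) := by
    intro B hB
    rw [← lintegral_indicator hU, Measure.volume_eq_prod,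
      lintegral_prod_symm _ (hB.indicator hU).aemeasurable]
    refine lintegral_congr fun t => ?_
    rw [← lintegral_indicator (hs t)]
    rfl
  set m : ℝ → ℝ≥0∞ := fun t =>
    essSup (fun x => K (x, t)) (volume.restrict {x : Esp d | (x, t) ∈ U}) with hm
  have hmix : mixNorm ⊤ ⊤ U (fun x t => K (x, t)) = essSup m volume := by
    simp [mixNorm, eLp, hm]
  rw [hslice (fun w => A w * K w) (hA.mul hK), hslice _ hA, hmix, ← lintegral_mul_const'']
  · refine lintegral_mono_ae ?_
    filter_upwards [ENNReal.ae_le_essSup m] with t ht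
    refine le_trans ?_ (mul_le_mul_right ht _)
    rw [← lintegral_mul_const (f := fun x => A (x, t)) _ (hA.comp measurable_prodMk_right)]
    refine lintegral_mono_ae ?_
    filter_upwards [ENNReal.ae_le_essSup (μ := volume.restrict {x : Esp d | (x, t) ∈ U})
      fun x => K (x, t)] with x hx
    exact mul_le_mul_right hx _
  · refine Measurable.aemeasurable ?_
    simp_rw [← lintegral_indicator (hs _)]
    exact (hA.indicator hU).lintegral_prod_left'

theorem lintegral_mul_lintegral_pscale_swap {ε : ℝ} (hε : ε ≠ 0) {S H κ : Esp d × ℝ → ℝ≥0∞}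
    {G : Esp d × ℝ → Esp d × ℝ → ℝ≥0∞} (hS : Measurable S) (hH : Measurable H) (hκ : Measurable κ)
    (hG : Measurable fun w : (Esp d × ℝ) × Esp d × ℝ => G w.1 w.2) :
    ∫⁻ p, S p * ∫⁻ ξ, G (p - pscale ε ξ) (pscale ε⁻¹ p) * H (p - pscale ε ξ) * κ ξ =
      ∫⁻ p, H p * ∫⁻ ξ, S (p + pscale ε ξ) * G p (pscale ε⁻¹ p + ξ) * κ ξ := by
  have hpm := (pscale (d := d) ε).measurable
  have hpm' := (pscale (d := d) ε⁻¹).measurable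
  have hG1 : Measurable fun z : (Esp d × ℝ) × Esp d × ℝ =>
      G (z.1 - pscale ε z.2) (pscale ε⁻¹ z.1) :=
    hG.comp (by fun_prop : Measurable fun z : (Esp d × ℝ) × Esp d × ℝ =>
      (z.1 - pscale ε z.2, pscale ε⁻¹ z.1))
  have hG2 : Measurable fun z : (Esp d × ℝ) × Esp d × ℝ => G z.1 (pscale ε⁻¹ z.1 + z.2) :=
    hG.comp (by fun_prop : Measurable fun z : (Esp d × ℝ) × Esp d × ℝ =>
      (z.1, pscale ε⁻¹ z.1 + z.2))
  have h1 : Measurable fun z : (Esp d × ℝ) × Esp d × ℝ =>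
      G (z.1 - pscale ε z.2) (pscale ε⁻¹ z.1) * H (z.1 - pscale ε z.2) * κ z.2 := by fun_prop
  have h2 : Measurable fun z : (Esp d × ℝ) × Esp d × ℝ =>
      S (z.1 + pscale ε z.2) * G z.1 (pscale ε⁻¹ z.1 + z.2) * κ z.2 := by fun_prop
  calc _ = ∫⁻ p, ∫⁻ ξ, S p *
        (G (p - pscale ε ξ) (pscale ε⁻¹ p) * H (p - pscale ε ξ) * κ ξ) :=
        lintegral_congr fun p => (lintegral_const_mul _ (h1.comp measurable_prodMk_left)).symm
    _ = ∫⁻ ξ, ∫⁻ p, S p *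
        (G (p - pscale ε ξ) (pscale ε⁻¹ p) * H (p - pscale ε ξ) * κ ξ) :=
        lintegral_lintegral_swap ((hS.comp measurable_fst).mul h1).aemeasurable
    _ = ∫⁻ ξ, ∫⁻ p, H p * (S (p + pscale ε ξ) * G p (pscale ε⁻¹ p + ξ) * κ ξ) := by
        refine lintegral_congr fun ξ => ?_
        rw [← lintegral_add_right_eq_self _ (pscale ε ξ)]
        refine lintegral_congr fun p => ?_
        rw [add_sub_cancel_right, map_add, pscale_inv_pscale hε]
        ring
    _ = ∫⁻ p, ∫⁻ ξ, H p * (S (p + pscale ε ξ) * G p (pscale ε⁻¹ p + ξ) * κ ξ) :=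
        (lintegral_lintegral_swap ((hH.comp measurable_fst).mul h2).aemeasurable).symm
    _ = _ := lintegral_congr fun p => lintegral_const_mul _ (h2.comp measurable_prodMk_left)

theorem add_pscale_mem_timeSpace {Ω : Set (Esp d)} {T ε : ℝ} (hε : 0 < ε) {p : Esp d × ℝ}
    (hp : p ∈ timeSpace Ω T \ blayer Ω T 2 ε) {ξ : Esp d × ℝ}
    (hξ : ξ ∈ Metric.ball (0 : Esp d × ℝ) 2) : p + pscale ε ξ ∈ timeSpace Ω T := by
  obtain ⟨⟨hpΩ, ht0, htT⟩, hpb⟩ := hp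
  simp only [blayer, mem_union, mem_prod, mem_ofPred_eq, mem_Ioo, not_or, not_and, not_lt] at hpb
  obtain ⟨⟨hx, hl⟩, hr⟩ := hpb
  rw [ball_prod_eq, mem_prod, mem_ball_zero_iff, mem_ball_zero_iff, Real.norm_eq_abs,
    abs_lt] at hξ
  obtain ⟨hz, hs1, hs2⟩ := hξ
  have hε2 : 0 < ε ^ 2 := by positivity
  have hdist : 2 * ε ≤ Metric.infDist p.1 Ωᶜ := by
    by_contra h
    exact htT.not_ge (hx ⟨hpΩ, not_le.1 h⟩ ht0)
  have hl' : 2 * ε ^ 2 ≤ p.2 := hl hpΩ ht0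
  have hr' : p.2 ≤ T - 2 * ε ^ 2 := by
    by_contra h
    exact htT.not_ge (hr hpΩ (not_le.1 h))
  refine ⟨?_, ?_, ?_⟩
  · by_contra h
    have h1 := Metric.infDist_le_dist_of_mem (x := p.1) (mem_compl h)
    have h2 : dist p.1 (p + pscale ε ξ).1 = ε * ‖ξ.1‖ := by
      rw [pscale_apply, Prod.fst_add, dist_self_add_right, norm_smul, Real.norm_of_nonneg hε.le]
    nlinarith
  · simp only [pscale_apply, Prod.snd_add]; nlinarith
  · simp only [pscale_apply, Prod.snd_add]; nlinarith

end assembly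

section assembly
variable {d : ℕ}

theorem q0star_eq_p0E (hd : 2 ≤ d) : q0star d = p0E d := by
  have hd' : (2:ℝ) ≤ d := by exact_mod_cast hd
  have h1 : (d:ℝ) - 1 ≠ 0 := by linarith
  have h2 : (d:ℝ) - 2 * d / (d + 1) = d * (d - 1) / (d + 1) := by field_simp; ring
  rw [q0star, p0E, h2]
  congr 1
  field_simp

theorem holderConjugate_exponents (hd : 2 ≤ d) :
    (2 * (d:ℝ) / (d - 1)).HolderConjugate (2 * (d:ℝ) / (d + 1)) := by
  have hd' : (2:ℝ) ≤ d := by exact_mod_cast hd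
  have h1 : (0:ℝ) < d - 1 := by linarith
  rw [Real.holderConjugate_iff]
  refine ⟨by rw [lt_div_iff₀ h1]; linarith, ?_⟩
  rw [inv_div, inv_div]
  field_simp
  ring

theorem integrableOn_timeSpace_of_mixNorm_ne_top (hd : 2 ≤ d) {Ω : Set (Esp d)} (hΩ : IsOpen Ω)
    (hΩb : Bornology.IsBounded Ω) {T : ℝ} {F : Esp d → ℝ → Esp d}
    (hF : Measurable fun w : Esp d × ℝ => F w.1 w.2)
    (h : mixNorm 2 (p0E d) (timeSpace Ω T) (fun x t => ‖F x t‖ₑ) ≠ ∞) (i : Fin d) :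
    IntegrableOn (fun w : Esp d × ℝ => F w.1 w.2 i) (timeSpace Ω T) := by
  have hd' : (2:ℝ) ≤ d := by exact_mod_cast hd
  have hU : MeasurableSet (timeSpace Ω T) := hΩ.measurableSet.prod measurableSet_Ioo
  have hp : 0 < 2 * (d:ℝ) / (d - 1) := div_pos (by positivity) (by linarith)
  rw [p0E, mixNorm_two_eq_mixedLp hp hU] at h
  refine ⟨((EuclideanSpace.proj (𝕜 := ℝ) i).continuous.measurable.comp hF).aestronglyMeasurable, ?_⟩
  have hle := lintegral_mul_le_mixedLp (holderConjugate_exponents hd) (hF.enorm.indicator hU)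
    ((measurable_one (α := ℝ≥0∞)).indicator hU)
  refine lt_of_le_of_lt ?_ (hle.trans_lt (ENNReal.mul_lt_top h.lt_top
    (mixedLp_indicator_prod_ne_top (by positivity) measurableSet_Ioo hΩ.measurableSet
      hΩb.measure_lt_top.ne (by simp)).lt_top))
  rw [← lintegral_indicator hU]
  refine lintegral_mono fun w => ?_
  by_cases hw : w ∈ timeSpace Ω T
  · simp only [indicator_of_mem hw, Pi.one_apply, mul_one]
    exact enorm_le_iff_norm_le.2 (PiLp.norm_apply_le _ i)
  · simp [indicator_of_notMem hw]

theorem enorm_integrand_le {φ₁ : ℝ → ℝ} {φ₂ : Esp d → ℝ} (hφ₁ : GoodK1 φ₁) (hφ₂ : GoodK2 φ₂)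
    {ε : ℝ} (hε : 0 < ε) {U : Set (Esp d × ℝ)} (hU : MeasurableSet U)
    {g : Esp d → ℝ → Esp d → ℝ → Esp d} {Df : Esp d → ℝ → Esp d} {h : Esp d → ℝ → ℝ}
    (hg : Measurable (fun w : (Esp d × ℝ) × Esp d × ℝ => g w.1.1 w.1.2 w.2.1 w.2.2))
    (hh : Measurable (fun w : Esp d × ℝ => h w.1 w.2))
    (hDi : ∀ i, IntegrableOn (fun w : Esp d × ℝ => Df w.1 w.2 i) U)
    {w : Esp d × ℝ} (hw : w ∈ U) :
    ‖∑ i, (Df w.1 w.2 i - S2 φ₁ φ₂ ε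
        (fun a b => U.indicator (fun w' : Esp d × ℝ => Df w'.1 w'.2 i) (a, b)) w.1 w.2) *
        osc4 ε (S4 φ₁ φ₂ ε (fun a b c e => g a b c e i * h a b)) w.1 w.2‖ₑ ≤
      (∑ i, meanOscillation φ₁ φ₂ ε (U.indicator fun w => Df w.1 w.2 i) w) *
        ∫⁻ ξ, ‖g (w - pscale ε ξ).1 (w - pscale ε ξ).2 (pscale ε⁻¹ w).1 (pscale ε⁻¹ w).2‖ₑ *
          ‖h (w - pscale ε ξ).1 (w - pscale ε ξ).2‖ₑ * ‖prodKernel φ₁ φ₂ ξ‖ₑ := by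
  refine (enorm_sum_le _ _).trans ?_
  rw [Finset.sum_mul]
  refine Finset.sum_le_sum fun i _ => ?_
  rw [enorm_mul]
  refine mul_le_mul' ?_ ?_
  · have := enorm_sub_S2_le (φ₁ := φ₁) (φ₂ := φ₂) hε hφ₁ hφ₂
      (F := fun a b => U.indicator (fun w' : Esp d × ℝ => Df w'.1 w'.2 i) (a, b))
      ((hDi i).integrable_indicator hU) w
    simp only [Prod.mk.eta] at this
    rw [indicator_of_mem hw] at this
    refine this.trans (le_of_eq ?_)
    simp only [meanOscillation, indicator_of_mem hw]
  · have hτ : w.2 / ε ^ 2 = (pscale ε⁻¹ w).2 := by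
      rw [pscale_apply]; field_simp
    have hy : ε⁻¹ • w.1 = (pscale ε⁻¹ w).1 := rfl
    have hgm : Measurable fun v : Esp d × ℝ =>
        g v.1 v.2 (pscale ε⁻¹ w).1 (pscale ε⁻¹ w).2 :=
      hg.comp (measurable_id.prodMk measurable_const)
    refine (enorm_S2_le (φ₁ := φ₁) (φ₂ := φ₂) hε hφ₁ hφ₂
      (F := fun a b => g a b (ε⁻¹ • w.1) (w.2 / ε ^ 2) i * h a b) ?_ w).trans ?_
    · rw [hτ, hy]
      exact ((EuclideanSpace.proj (𝕜 := ℝ) i).continuous.measurable.comp hgm).mul hh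
    · rw [hτ, hy]
      refine lintegral_mono fun ξ => ?_
      rw [enorm_mul]
      gcongr
      exact enorm_le_iff_norm_le.2 (PiLp.norm_apply_le _ i)

end assembly

theorem stmt_14 (d : ℕ) (hd : 2 ≤ d) (φ₁ : ℝ → ℝ) (φ₂ : Esp d → ℝ)
    (hφ₁ : GoodK1 φ₁) (hφ₂ : GoodK2 φ₂) :
    ∃ C : ℝ, 0 < C ∧
      ∀ (Ω : Set (Esp d)), IsOpen Ω → Bornology.IsBounded Ω → ∀ T : ℝ, 0 < T →
      ∀ ε : ℝ, 0 < ε →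
      ∀ (g : Esp d → ℝ → Esp d → ℝ → Esp d) (f : Esp d → ℝ → ℝ) (Df : Esp d → ℝ → Esp d)
        (D2f : Esp d → ℝ → EuclideanSpace ℝ (Fin d × Fin d)) (Dtf : Esp d → ℝ → ℝ)
        (h : Esp d → ℝ → ℝ),
        Measurable (fun w : (Esp d × ℝ) × Esp d × ℝ => g w.1.1 w.1.2 w.2.1 w.2.2) →
        (∀ x t y τ, (∀ i, g x t (y + EuclideanSpace.single i 1) τ = g x t y τ) ∧
          g x t y (τ + 1) = g x t y τ) →
        mixNorm ⊤ ⊤ (timeSpace Ω T)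
            (fun x t => cellNorm 2 2 (fun y τ => ‖g x t y τ‖)) < ∞ →
        Measurable (fun w : Esp d × ℝ => f w.1 w.2) →
        Measurable (fun w : Esp d × ℝ => Df w.1 w.2) →
        Measurable (fun w : Esp d × ℝ => D2f w.1 w.2) →
        Measurable (fun w : Esp d × ℝ => Dtf w.1 w.2) →
        Measurable (fun w : Esp d × ℝ => h w.1 w.2) →
        (∀ i, IsWeakDerivST (timeSpace Ω T) f (fun x t => Df x t i)
          (EuclideanSpace.single i 1, (0:ℝ))) →
        (∀ i j, IsWeakDerivST (timeSpace Ω T) (fun x t => Df x t i)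
          (fun x t => D2f x t (i, j)) (EuclideanSpace.single j 1, (0:ℝ))) →
        IsWeakDerivST (timeSpace Ω T) f Dtf ((0 : Esp d), (1:ℝ)) →
        mixNorm 2 (q0E d) (timeSpace Ω T) (fun x t => (‖Dtf x t‖₊ : ℝ≥0∞)) < ∞ →
        mixNorm 2 (q0star d) (timeSpace Ω T) (fun x t => (‖Df x t‖₊ : ℝ≥0∞)) < ∞ →
        mixNorm 2 (q0E d) (timeSpace Ω T) (fun x t => (‖D2f x t‖₊ : ℝ≥0∞)) < ∞ →
        mixNorm 2 (p0E d) (timeSpace Ω T) (fun x t => (‖h x t‖₊ : ℝ≥0∞)) < ∞ →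
        Function.support (fun w : Esp d × ℝ => h w.1 w.2) ⊆
          timeSpace Ω T \ blayer Ω T 2 ε →
        (‖∫ w in timeSpace Ω T, ∑ i,
            (Df w.1 w.2 i -
              S2 φ₁ φ₂ ε (fun a b =>
                Set.indicator (timeSpace Ω T) (fun w' : Esp d × ℝ => Df w'.1 w'.2 i) (a, b))
                w.1 w.2) *
            osc4 ε (S4 φ₁ φ₂ ε (fun a b c e => g a b c e i * h a b)) w.1 w.2‖₊ : ℝ≥0∞) ≤
          ENNReal.ofReal (C * ε) *
            (mixNorm 2 (q0E d) (timeSpace Ω T) (fun x t => (‖D2f x t‖₊ : ℝ≥0∞)) +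
              mixNorm 2 (q0E d) (timeSpace Ω T) (fun x t => (‖Dtf x t‖₊ : ℝ≥0∞))) *
            mixNorm ⊤ ⊤ (timeSpace Ω T)
              (fun x t => cellNorm 2 2 (fun y τ => ‖g x t y τ‖)) *
            mixNorm 2 (p0E d) (timeSpace Ω T) (fun x t => (‖h x t‖₊ : ℝ≥0∞)) := by
  have hd' : (2:ℝ) ≤ d := by exact_mod_cast hd
  obtain ⟨C₀, hC₀, H⟩ := exists_lintegral_meanOscillation_mul_le hd hφ₁ hφ₂
  set q : ℝ := 2 * d / (d + 1) with hq
  set p : ℝ := 2 * d / (d - 1) with hp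
  have hq1 : 1 ≤ q := by rw [hq, le_div_iff₀ (by positivity)]; linarith
  have hq2 : q ≤ 2 := by rw [hq, div_le_iff₀ (by positivity)]; linarith
  have hq0 : 0 < q := by linarith
  have hp0 : 0 < p := div_pos (by positivity) (by linarith)
  have hB : volume (Metric.ball (0 : Esp d × ℝ) 2) ≠ ∞ := measure_ball_lt_top.ne
  set C : ℝ≥0∞ := C₀ * volume (Metric.ball (0 : Esp d × ℝ) 2) ^ (1 / q) with hC
  have hCt : C ≠ ∞ := ENNReal.mul_ne_top hC₀ (ENNReal.rpow_ne_top_of_nonneg (by positivity) hB)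
  refine ⟨C.toReal + 1, by positivity, ?_⟩
  intro Ω hΩ hΩb T _ ε hε g f Df D2f Dtf h hg hgper _ _ hDm hD2m hDtm hhm
    hfD hDD hft _ hDn _ _ hsupp
  have hU : MeasurableSet (timeSpace Ω T) := hΩ.measurableSet.prod measurableSet_Ioo
  rw [q0star_eq_p0E hd] at hDn
  have hDi := integrableOn_timeSpace_of_mixNorm_ne_top hd hΩ hΩb hDm hDn.ne
  set U := timeSpace Ω T with hUdef
  set S : Esp d × ℝ → ℝ≥0∞ := fun w =>
    ∑ i, meanOscillation φ₁ φ₂ ε (U.indicator fun w => Df w.1 w.2 i) w with hS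
  set N : Esp d × ℝ → ℝ≥0∞ := U.indicator fun w => ‖D2f w.1 w.2‖ₑ + ‖Dtf w.1 w.2‖ₑ with hN
  set L : Esp d × ℝ → ℝ≥0∞ := fun w =>
    (∫⁻ ξ in Metric.ball (0 : Esp d × ℝ) 2, N (w + pscale ε ξ) ^ q) ^ (1 / q) with hL
  set K : Esp d × ℝ → ℝ≥0∞ := fun w => cellNorm 2 2 (fun y τ => ‖g w.1 w.2 y τ‖) with hK
  have hgw : ∀ w : Esp d × ℝ, Measurable fun v : Esp d × ℝ => g w.1 w.2 v.1 v.2 := fun w =>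
    hg.comp (measurable_const.prodMk measurable_id)
  have hKeq : ∀ w, K w =
      (∫⁻ v in unitCell d ×ˢ Ioc (0:ℝ) 1, ‖g w.1 w.2 v.1 v.2‖ₑ ^ 2) ^ (1 / 2 : ℝ) :=
    fun w => cellNorm_two_two (hgw w)
  have hKm : Measurable K := by
    rw [funext hKeq]
    exact (Measurable.lintegral_prod_right' (hg.enorm.pow_const 2)).pow_const _
  have hNm : Measurable N := (hD2m.enorm.add hDtm.enorm).indicator hU
  have hLm : Measurable L := by
    have := (pscale (d := d) ε).measurable
    exact (Measurable.lintegral_prod_right' (f := fun z : (Esp d × ℝ) × Esp d × ℝ =>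
      N (z.1 + pscale ε z.2) ^ q) ((hNm.comp (by fun_prop)).pow_const q)).pow_const _
  have hSm : Measurable S := Finset.measurable_fun_sum _ fun i _ =>
    measurable_meanOscillation hφ₁ hφ₂ (Measurable.indicator
      ((EuclideanSpace.proj (𝕜 := ℝ) i).continuous.measurable.comp hDm) hU)
  have hpoint : ∀ w, ‖h w.1 w.2‖ₑ * ∫⁻ ξ, S (w + pscale ε ξ) *
        ‖g w.1 w.2 (pscale ε⁻¹ w + ξ).1 (pscale ε⁻¹ w + ξ).2‖ₑ * ‖prodKernel φ₁ φ₂ ξ‖ₑ ≤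
      U.indicator (fun w => ‖h w.1 w.2‖ₑ * (C₀ * ENNReal.ofReal ε * L w) * K w) w := by
    intro w
    by_cases hw : h w.1 w.2 = 0
    · simp [hw]
    have hwU := hsupp (show w ∈ Function.support fun w : Esp d × ℝ => h w.1 w.2 from hw)
    rw [indicator_of_mem hwU.1, mul_assoc]
    gcongr
    refine (H U f Df D2f Dtf hU hDm hD2m hDtm hDi hfD hDD hft ε hε w
      (fun ξ hξ => add_pscale_mem_timeSpace hε hwU hξ)
      (fun v => ‖g w.1 w.2 v.1 v.2‖ₑ) (hgw w).enorm
      (fun i v => ?_) (fun v => ?_) (pscale ε⁻¹ w)).trans (le_of_eq ?_)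
    · simp [(hgper w.1 w.2 v.1 v.2).1 i]
    · simp [(hgper w.1 w.2 v.1 v.2).2]
    · rw [hKeq, ← mul_assoc]
  have hmixh : mixNorm 2 (p0E d) U (fun x t => (‖h x t‖₊ : ℝ≥0∞)) =
      mixedLp p (U.indicator fun w => ‖h w.1 w.2‖ₑ) := mixNorm_two_eq_mixedLp hp0 hU _
  have hmixN : mixedLp q N ≤ mixNorm 2 (q0E d) U (fun x t => (‖D2f x t‖₊ : ℝ≥0∞)) +
      mixNorm 2 (q0E d) U (fun x t => (‖Dtf x t‖₊ : ℝ≥0∞)) := by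
    rw [q0E, mixNorm_two_eq_mixedLp hq0 hU, mixNorm_two_eq_mixedLp hq0 hU]
    refine le_trans (le_of_eq ?_) (mixedLp_add_le hq1 (hD2m.enorm.indicator hU)
      (hDtm.enorm.indicator hU))
    rw [hN, indicator_add]
    rfl
  have hHolder : ∫⁻ w in U, ‖h w.1 w.2‖ₑ * (C₀ * ENNReal.ofReal ε * L w) ≤
      mixedLp p (U.indicator fun w => ‖h w.1 w.2‖ₑ) *
        (C₀ * ENNReal.ofReal ε * mixedLp q L) := by
    rw [← mixedLp_const_mul hq0 (ENNReal.mul_ne_top hC₀ ENNReal.ofReal_ne_top),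
      ← lintegral_indicator hU]
    refine le_trans (le_of_eq ?_) (lintegral_mul_le_mixedLp (holderConjugate_exponents hd)
      (hhm.enorm.indicator hU) (hLm.const_mul _))
    simp_rw [indicator_mul_left]
  calc _ ≤ ∫⁻ w in U, S w * ∫⁻ ξ,
        ‖g (w - pscale ε ξ).1 (w - pscale ε ξ).2 (pscale ε⁻¹ w).1 (pscale ε⁻¹ w).2‖ₑ *
          ‖h (w - pscale ε ξ).1 (w - pscale ε ξ).2‖ₑ * ‖prodKernel φ₁ φ₂ ξ‖ₑ :=
        (enorm_integral_le_lintegral_enorm _).trans (setLIntegral_mono' hU fun w hw =>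
          enorm_integrand_le hφ₁ hφ₂ hε hU hg hhm hDi hw)
    _ ≤ _ := setLIntegral_le_lintegral _ _
    _ = ∫⁻ w, ‖h w.1 w.2‖ₑ * ∫⁻ ξ, S (w + pscale ε ξ) *
          ‖g w.1 w.2 (pscale ε⁻¹ w + ξ).1 (pscale ε⁻¹ w + ξ).2‖ₑ * ‖prodKernel φ₁ φ₂ ξ‖ₑ :=
        lintegral_mul_lintegral_pscale_swap hε.ne' hSm hhm.enorm
          (continuous_prodKernel hφ₁ hφ₂).enorm.measurable
          (G := fun w v => ‖g w.1 w.2 v.1 v.2‖ₑ) hg.enorm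
    _ ≤ ∫⁻ w in U, ‖h w.1 w.2‖ₑ * (C₀ * ENNReal.ofReal ε * L w) * K w := by
        rw [← lintegral_indicator hU]
        exact lintegral_mono hpoint
    _ ≤ (∫⁻ w in U, ‖h w.1 w.2‖ₑ * (C₀ * ENNReal.ofReal ε * L w)) *
        mixNorm ⊤ ⊤ U (fun x t => K (x, t)) :=
        setLIntegral_mul_le_mixNorm_top hU (hhm.enorm.mul (hLm.const_mul _)) hKm
    _ ≤ (mixedLp p (U.indicator fun w => ‖h w.1 w.2‖ₑ) * (C₀ * ENNReal.ofReal ε *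
        (volume (Metric.ball (0 : Esp d × ℝ) 2) ^ (1 / q) * mixedLp q N))) *
        mixNorm ⊤ ⊤ U (fun x t => K (x, t)) := by
        gcongr
        refine hHolder.trans ?_
        gcongr
        exact mixedLp_localAverage_le hq0 hq2 hNm ε hB
    _ = C * ENNReal.ofReal ε * mixedLp q N * mixNorm ⊤ ⊤ U (fun x t => K (x, t)) *
        mixedLp p (U.indicator fun w => ‖h w.1 w.2‖ₑ) := by rw [hC]; ring
    _ ≤ _ := by
        rw [hmixh, ENNReal.ofReal_mul (by positivity)]
        gcongr
        rw [← ENNReal.ofReal_toReal hCt]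
        exact ENNReal.ofReal_le_ofReal (by simp)

end
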